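/- arXiv:1908.08069 — 2 statements merged into one kernel-verified Lean document; each statement's English description precedes it below -/
import Mathlib

section
/- For all n ≥ 8: Δ(H_n) ≥ Δ(H^B_7)/32, and Δ(H^B_7) > 0; in particular the spectral gaps Δ(H_n) are bounded below by a positive constant independent of n. -/
open MeasureTheory Matrix Finset
open scoped Real ComplexConjugate ComplexOrder

noncomputable section

instance {m n α : Type*} [MeasurableSpace α] : MeasurableSpace (Matrix m n α) :=
  inferInstanceAs (MeasurableSpace (m → n → α))

/-- The spectral gap of a (positive semidefinite) matrix: its smallest nonzero
(= smallest positive) eigenvalue. -/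
def specGap {d : Type*} [Fintype d] [DecidableEq d] (A : Matrix d d ℂ) : ℝ :=
  sInf {c : ℝ | 0 < c ∧ (c : ℂ) ∈ spectrum ℂ A}

/-- The matrix exponential, defined by its power series. -/
def mexp {d : Type*} [Fintype d] [DecidableEq d] (A : Matrix d d ℂ) : Matrix d d ℂ :=
  ∑' k : ℕ, ((k.factorial : ℂ))⁻¹ • A ^ k

/-- `U^{⊗t}` as a matrix, entrywise. -/
def tpow {d : Type*} [Fintype d] (t : ℕ) (U : Matrix d d ℂ) :
    Matrix (Fin t → d) (Fin t → d) ℂ :=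
  Matrix.of fun x y => ∏ i, U (x i) (y i)

/-- `U^{⊗t,t} = U^{⊗t} ⊗ (conj U)^{⊗t}` as a matrix, entrywise. -/
def tpow2 {d : Type*} [Fintype d] (t : ℕ) (U : Matrix d d ℂ) :
    Matrix ((Fin t → d) × (Fin t → d)) ((Fin t → d) × (Fin t → d)) ℂ :=
  Matrix.of fun x y => (∏ i, U (x.1 i) (y.1 i)) * ∏ i, conj (U (x.2 i) (y.2 i))

/-- The Hilbert space of `n` qubits is indexed by bit strings `Fin n → Fin 2`. -/
abbrev QMat (n : ℕ) := Matrix (Fin n → Fin 2) (Fin n → Fin 2) ℂ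

def pauliX : Matrix (Fin 2) (Fin 2) ℂ := !![0, 1; 1, 0]
def pauliZ : Matrix (Fin 2) (Fin 2) ℂ := !![1, 0; 0, -1]
def hadamardMat : Matrix (Fin 2) (Fin 2) ℂ :=
  (((Real.sqrt 2 : ℝ) : ℂ))⁻¹ • !![1, 1; 1, -1]

/-- A single-qubit operator `A` acting on qubit `i` of `n` qubits. -/
def op1 {n : ℕ} (i : Fin n) (A : Matrix (Fin 2) (Fin 2) ℂ) : QMat n :=
  Matrix.of fun x y =>
    A (x i) (y i) * ∏ j ∈ Finset.univ.erase i, (if x j = y j then (1 : ℂ) else 0)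

/-- Pauli `X` on qubit `i`. -/
def Xop {n : ℕ} (i : Fin n) : QMat n := op1 i pauliX
/-- Pauli `Z` on qubit `i`. -/
def Zop {n : ℕ} (i : Fin n) : QMat n := op1 i pauliZ

/-- `ZXZ_i = Z_{i-1} X_i Z_{i+1}`, with the `Z` factors dropped at the boundary
(so `ZXZ_1 = X_1 Z_2` and `ZXZ_n = Z_{n-1} X_n`). -/
def ZXZop {n : ℕ} (i : Fin n) : QMat n :=
  (if h : 0 < (i : ℕ) then Zop ⟨(i : ℕ) - 1, by have := i.isLt; omega⟩ else 1) *
    Xop i *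
    (if h : (i : ℕ) + 1 < n then Zop ⟨(i : ℕ) + 1, h⟩ else 1)

/-- The gate `e^{iφ A}`. -/
def rotGate {n : ℕ} (φ : ℝ) (A : QMat n) : QMat n :=
  mexp ((Complex.I * (φ : ℂ)) • A)

/-- `P_A := (1/2π)∫₀^{2π} (e^{iφA})^{⊗2,2} dφ`, defined entrywise. -/
def Pproj {n : ℕ} (A : QMat n) :
    Matrix ((Fin 2 → (Fin n → Fin 2)) × (Fin 2 → (Fin n → Fin 2)))
           ((Fin 2 → (Fin n → Fin 2)) × (Fin 2 → (Fin n → Fin 2))) ℂ :=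
  Matrix.of fun x y =>
    ((2 * Real.pi : ℝ) : ℂ)⁻¹ * ∫ φ in (0 : ℝ)..(2 * Real.pi), tpow2 2 (rotGate φ A) x y

/-- `H_n = ∑ᵢ (1 - P^X_i) + ∑ᵢ (1 - P^Z_i) + ∑ᵢ (1 - P^{ZXZ}_i)`. -/
def Hham (n : ℕ) :
    Matrix ((Fin 2 → (Fin n → Fin 2)) × (Fin 2 → (Fin n → Fin 2)))
           ((Fin 2 → (Fin n → Fin 2)) × (Fin 2 → (Fin n → Fin 2))) ℂ :=
  (∑ i : Fin n, (1 - Pproj (Xop i))) + (∑ i : Fin n, (1 - Pproj (Zop i))) +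
    (∑ i : Fin n, (1 - Pproj (ZXZop i)))

/-- `H^L_n = H_n - (1 - P^{ZXZ}_n)` (boundary term at the right edge removed). -/
def HhamL (n : ℕ) (hn : 0 < n) :
    Matrix ((Fin 2 → (Fin n → Fin 2)) × (Fin 2 → (Fin n → Fin 2)))
           ((Fin 2 → (Fin n → Fin 2)) × (Fin 2 → (Fin n → Fin 2))) ℂ :=
  Hham n - (1 - Pproj (ZXZop (⟨n - 1, by omega⟩ : Fin n)))

/-- `H^B_n = H_n - (1 - P^{ZXZ}_1) - (1 - P^{ZXZ}_n)` (both boundary terms removed). -/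
def HhamB (n : ℕ) (hn : 0 < n) :
    Matrix ((Fin 2 → (Fin n → Fin 2)) × (Fin 2 → (Fin n → Fin 2)))
           ((Fin 2 → (Fin n → Fin 2)) × (Fin 2 → (Fin n → Fin 2))) ℂ :=
  HhamL n hn - (1 - Pproj (ZXZop (⟨0, hn⟩ : Fin n)))

section HilbertSpace

variable {E : Type*} [NormedAddCommGroup E] [InnerProductSpace ℂ E]

theorem norm_add_sq_re (x y : E) :
    ‖x + y‖ ^ 2 = ‖x‖ ^ 2 + 2 * (inner ℂ x y).re + ‖y‖ ^ 2 := by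
  simpa using @norm_add_sq ℂ E _ _ _ x y

theorem norm_sub_sq_re (x y : E) :
    ‖x - y‖ ^ 2 = ‖x‖ ^ 2 - 2 * (inner ℂ x y).re + ‖y‖ ^ 2 := by
  simpa using @norm_sub_sq ℂ E _ _ _ x y

theorem re_inner_self (x : E) : (inner ℂ x x).re = ‖x‖ ^ 2 := by
  simpa using (@norm_sq_eq_re_inner ℂ E _ _ _ x).symm

theorem re_inner_le_norm' (x y : E) : (inner ℂ x y).re ≤ ‖x‖ * ‖y‖ := by
  simpa using @re_inner_le_norm ℂ E _ _ _ x y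

variable [FiniteDimensional ℂ E]

/-- The component of `v` orthogonal to `V`. -/
def perp (V : Submodule ℂ E) (v : E) : E := v - V.starProjection v

theorem perp_mem (V : Submodule ℂ E) (v : E) : perp V v ∈ Vᗮ :=
  Submodule.sub_starProjection_mem_orthogonal v

theorem perp_eq_zero_iff {V : Submodule ℂ E} {v : E} : perp V v = 0 ↔ v ∈ V := by
  rw [perp, sub_eq_zero, eq_comm, Submodule.starProjection_eq_self_iff]

theorem perp_of_mem_orthogonal {V : Submodule ℂ E} {v : E} (hv : v ∈ Vᗮ) : perp V v = v := by
  rw [perp, Submodule.eq_starProjection_of_mem_orthogonal (v := (0 : E)) V.zero_mem (by simpa),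
    sub_zero]

theorem inner_perp_left (V : Submodule ℂ E) (v w : E) :
    inner ℂ (perp V v) w = inner ℂ v (perp V w) := by
  simp only [perp, inner_sub_left, inner_sub_right, Submodule.inner_starProjection_left_eq_right]

theorem perp_perp (V : Submodule ℂ E) (v : E) : perp V (perp V v) = perp V v :=
  perp_of_mem_orthogonal (perp_mem V v)

theorem re_inner_perp (V : Submodule ℂ E) (v : E) :
    (inner ℂ v (perp V v)).re = ‖perp V v‖ ^ 2 := by
  rw [← re_inner_self, inner_perp_left, perp_perp]

theorem perp_sub (V : Submodule ℂ E) (v w : E) : perp V (v - w) = perp V v - perp V w := by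
  simp only [perp, map_sub]; abel

theorem perp_perp_of_le {V W : Submodule ℂ E} (h : W ≤ V) (v : E) :
    perp V (perp W v) = perp V v := by
  rw [show perp W v = v - W.starProjection v from rfl, perp_sub,
    perp_eq_zero_iff.2 (h (W.starProjection_apply_mem v)), sub_zero]

/-- A symmetric positive operator whose positive eigenvalues are at least `c` is bounded below
by `c` on the orthogonal complement of its kernel. -/
theorem gap_le_re_inner {T : E →ₗ[ℂ] E} (hT : T.IsSymmetric)
    (hpos : ∀ v, 0 ≤ (inner ℂ (T v) v).re) {c : ℝ}
    (hc : ∀ (μ : ℝ) (v : E), 0 < μ → v ≠ 0 → T v = (μ : ℂ) • v → c ≤ μ) (v : E) :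
    c * ‖perp (LinearMap.ker T) v‖ ^ 2 ≤ (inner ℂ (T v) v).re := by
  set w := perp (LinearMap.ker T) v with hw
  have hw' : w ∈ (LinearMap.ker T)ᗮ := perp_mem _ _
  have hTw : T v = T w := by
    have : T ((LinearMap.ker T).starProjection v) = 0 :=
      (LinearMap.ker T).starProjection_apply_mem v
    rw [hw, perp, map_sub, this, sub_zero]
  have hvw : inner ℂ (T v) v = inner ℂ (T w) w := by
    rw [hTw, hT w v, hTw, ← hT w w]
  rw [hvw]
  set b := hT.eigenvectorBasis rfl with hb
  rw [← b.sum_sq_norm_inner_right w, ← b.sum_inner_mul_inner (T w) w, Finset.mul_sum,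
    Complex.re_sum]
  refine Finset.sum_le_sum fun i _ => ?_
  have hev : T (b i) = ((hT.eigenvalues rfl i : ℝ) : ℂ) • b i := hT.apply_eigenvectorBasis rfl i
  set μ := hT.eigenvalues rfl i
  have h1 : inner ℂ (T w) (b i) * inner ℂ (b i) w
      = ((μ * ‖(inner ℂ (b i) w : ℂ)‖ ^ 2 : ℝ) : ℂ) := by
    rw [hT w (b i), hev, inner_smul_right, ← inner_conj_symm w (b i), mul_assoc,
      ← Complex.normSq_eq_conj_mul_self, Complex.normSq_eq_norm_sq]
    push_cast; ring
  rw [h1, Complex.ofReal_re]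
  have hμ : 0 ≤ μ := by
    have := hpos (b i)
    rw [hev, inner_smul_left, inner_self_eq_norm_sq_to_K, b.orthonormal.1 i] at this
    simpa using this
  rcases hμ.eq_or_lt with h0 | h0
  · have hk : b i ∈ LinearMap.ker T := by
      rw [LinearMap.mem_ker, hev, ← h0]; simp
    have : inner ℂ (b i) w = 0 := hw' _ hk
    simp [this]
  · have hne : b i ≠ 0 := by
      intro h
      have := b.orthonormal.1 i
      simp [h] at this
    exact mul_le_mul_of_nonneg_right (hc μ (b i) h0 hne hev) (by positivity)

section TwoSubspaces

variable {V₁ V₂ V : Submodule ℂ E} {ε : ℝ}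

/-- `V₁` and `V₂` make an angle with cosine at most `ε` outside the common subspace `V`. -/
def AngleLE (V₁ V₂ V : Submodule ℂ E) (ε : ℝ) : Prop :=
  ∀ x ∈ V₁, x ∈ Vᗮ → ∀ y ∈ V₂, y ∈ Vᗮ →
    2 * (inner ℂ x y).re ≤ ε * (‖x‖ ^ 2 + ‖y‖ ^ 2)

theorem AngleLE.perp_sq_le (h : AngleLE V₁ V₂ V ε) (h₁ : V ≤ V₁) (h₂ : V ≤ V₂) (hε : 0 ≤ ε)
    (v : E) :
    (1 - ε) * ‖perp V v‖ ^ 2 ≤ ‖perp V₁ v‖ ^ 2 + ‖perp V₂ v‖ ^ 2 := by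
  set w := perp V v with hw
  have key : ∀ U : Submodule ℂ E, V ≤ U → ∃ x ∈ U, x ∈ Vᗮ ∧
      ‖perp U v‖ ^ 2 = ‖w‖ ^ 2 - ‖x‖ ^ 2 ∧ (inner ℂ w x).re = ‖x‖ ^ 2 := by
    intro U hU
    refine ⟨U.starProjection w, U.starProjection_apply_mem w, ?_, ?_⟩
    · have : U.starProjection w = w - perp U w := by rw [perp]; abel
      rw [this]
      exact Submodule.sub_mem _ (perp_mem V v) (Submodule.orthogonal_le hU (perp_mem U w))
    have h0 : (inner ℂ w (U.starProjection w)).re = ‖U.starProjection w‖ ^ 2 := by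
      rw [← re_inner_self, Submodule.inner_starProjection_left_eq_right,
        Submodule.starProjection_eq_self_iff.2 (U.starProjection_apply_mem w)]
    refine ⟨?_, h0⟩
    rw [← perp_perp_of_le hU v, ← hw, perp, norm_sub_sq_re, h0]; ring
  obtain ⟨x, hx, hx', hxn, hxi⟩ := key V₁ h₁
  obtain ⟨y, hy, hy', hyn, hyi⟩ := key V₂ h₂
  have hxy := h x hx hx' y hy hy'
  have h3 := re_inner_le_norm' w (x + y)
  rw [inner_add_right, Complex.add_re, hxi, hyi] at h3
  have h4 := norm_add_sq_re x y
  rw [hxn, hyn]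
  set s := ‖x‖ ^ 2 + ‖y‖ ^ 2 with hs
  have hs0 : 0 ≤ s := by positivity
  have h5 : ‖x + y‖ ^ 2 ≤ (1 + ε) * s := by linarith
  have h6 : s ^ 2 ≤ ‖w‖ ^ 2 * ((1 + ε) * s) := by
    calc s ^ 2 ≤ (‖w‖ * ‖x + y‖) ^ 2 := by gcongr
      _ = ‖w‖ ^ 2 * ‖x + y‖ ^ 2 := by ring
      _ ≤ _ := by gcongr
  have h7 : s ≤ (1 + ε) * ‖w‖ ^ 2 := by
    rcases hs0.eq_or_lt with h0 | h0
    · rw [← h0]; positivity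
    · nlinarith
  linarith

theorem AngleLE.inf_le (h : AngleLE V₁ V₂ V ε) (h₁ : V ≤ V₁) (h₂ : V ≤ V₂) (hε : 0 ≤ ε)
    (hε1 : ε < 1) : V₁ ⊓ V₂ ≤ V := by
  intro v hv
  have := h.perp_sq_le h₁ h₂ hε v
  rw [perp_eq_zero_iff.2 hv.1, perp_eq_zero_iff.2 hv.2] at this
  rw [← perp_eq_zero_iff, ← norm_eq_zero]
  simp only [norm_zero] at this
  have h2 : ‖perp V v‖ ^ 2 ≤ 0 := by nlinarith [sq_nonneg ‖perp V v‖]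
  exact pow_eq_zero_iff (two_ne_zero) |>.1 (le_antisymm h2 (sq_nonneg _))

theorem AngleLE.neg_le_re_inner (h : AngleLE V₁ V₂ V ε) (h₁ : V ≤ V₁) (h₂ : V ≤ V₂)
    (hε : 0 ≤ ε) (hε1 : ε < 1) (v : E) :
    -(ε * (‖perp V₁ v‖ ^ 2 + ‖perp V₂ v‖ ^ 2)) ≤ 2 * (inner ℂ (perp V₁ v) (perp V₂ v)).re := by
  have h3 := h.perp_sq_le h₁ h₂ hε v
  set w := perp V v with hw
  have e1 : perp V₁ v = perp V₁ w := (perp_perp_of_le h₁ v).symm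
  have e2 : perp V₂ v = perp V₂ w := (perp_perp_of_le h₂ v).symm
  have h4 := re_inner_le_norm' w (perp V₁ w + perp V₂ w)
  rw [inner_add_right, Complex.add_re, re_inner_perp, re_inner_perp] at h4
  rw [e1, e2] at h3 ⊢
  have h5 := norm_add_sq_re (perp V₁ w) (perp V₂ w)
  set s := ‖perp V₁ w‖ ^ 2 + ‖perp V₂ w‖ ^ 2 with hs
  have hs0 : 0 ≤ s := by positivity
  set t := ‖perp V₁ w + perp V₂ w‖ with ht
  have ht0 : 0 ≤ t := norm_nonneg _
  have hw0 : 0 ≤ ‖w‖ := norm_nonneg _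
  suffices (1 - ε) * s ≤ t ^ 2 by linarith
  have h6 : (1 - ε) * ‖w‖ ≤ t := by
    rcases hw0.eq_or_lt with h0 | h0
    · rw [← h0]; simpa
    · nlinarith
  nlinarith

end TwoSubspaces

/-- Knabe-type estimate for a chain of subspaces. -/
theorem knabe_chain (V : ℕ → Submodule ℂ E) {ε : ℝ} (v : E) (q : ℕ)
    (hadj : ∀ j < q, -(ε * (‖perp (V j) v‖ ^ 2 + ‖perp (V (j + 1)) v‖ ^ 2))
      ≤ 2 * (inner ℂ (perp (V j) v) (perp (V (j + 1)) v)).re)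
    (hfar : ∀ i j, i + 2 ≤ j → j ≤ q → 0 ≤ (inner ℂ (perp (V i) v) (perp (V j) v)).re)
    (hε : 0 ≤ ε) :
    (1 - 2 * ε) * ∑ j ∈ range (q + 1), ‖perp (V j) v‖ ^ 2 + ε * ‖perp (V q) v‖ ^ 2
      ≤ ‖∑ j ∈ range (q + 1), perp (V j) v‖ ^ 2 := by
  induction q with
  | zero => simp only [zero_add, Finset.sum_range_one]; nlinarith [sq_nonneg ‖perp (V 0) v‖]
  | succ q ih =>
    have ih' := ih (fun j hj => hadj j (by omega)) (fun i j hij hj => hfar i j hij (by omega))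
    rw [Finset.sum_range_succ _ (q + 1), Finset.sum_range_succ _ (q + 1), norm_add_sq_re]
    have h1 : (inner ℂ (perp (V q) v) (perp (V (q + 1)) v)).re
        ≤ (inner ℂ (∑ j ∈ range (q + 1), perp (V j) v) (perp (V (q + 1)) v)).re := by
      rw [Finset.sum_range_succ, inner_add_left, Complex.add_re, sum_inner, Complex.re_sum]
      have : 0 ≤ ∑ i ∈ range q, (inner ℂ (perp (V i) v) (perp (V (q + 1)) v)).re :=
        Finset.sum_nonneg fun i hi => hfar i (q + 1) (by simp at hi; omega) le_rfl
      linarith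
    have h2 := hadj q (by omega)
    linarith

/-- If `(∑ⱼ hⱼ)² ≥ c ∑ⱼ hⱼ` for the projections `hⱼ` onto `(V j)ᗮ`, then `∑ⱼ hⱼ ≥ c (1 - G)`,
with `G` the projection onto any subspace that contains the intersection of the `V j`. -/
theorem perp_sq_le_sum (V : ℕ → Submodule ℂ E) (U : Submodule ℂ E) {c : ℝ} (hc : 0 ≤ c)
    (q : ℕ) (hU : ∀ v, (∀ j ∈ range q, v ∈ V j) → v ∈ U)
    (h : ∀ v, c * ∑ j ∈ range q, ‖perp (V j) v‖ ^ 2 ≤ ‖∑ j ∈ range q, perp (V j) v‖ ^ 2)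
    (v : E) : c * ‖perp U v‖ ^ 2 ≤ ∑ j ∈ range q, ‖perp (V j) v‖ ^ 2 := by
  set T : E →ₗ[ℂ] E := ∑ j ∈ range q, (LinearMap.id - (V j).starProjection.toLinearMap) with hTd
  have hTv : ∀ v, T v = ∑ j ∈ range q, perp (V j) v := by
    intro v; simp [hTd, perp, LinearMap.sum_apply]
  have hT : T.IsSymmetric := by
    intro x y
    rw [hTv, hTv, sum_inner, inner_sum]
    exact Finset.sum_congr rfl fun j _ => inner_perp_left _ _ _
  have hq : ∀ v, (inner ℂ (T v) v).re = ∑ j ∈ range q, ‖perp (V j) v‖ ^ 2 := by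
    intro v
    rw [hTv, sum_inner, Complex.re_sum]
    exact Finset.sum_congr rfl fun j _ => by rw [inner_perp_left, re_inner_perp]
  have hpos : ∀ v, 0 ≤ (inner ℂ (T v) v).re := fun v => by
    rw [hq]; exact Finset.sum_nonneg fun _ _ => sq_nonneg _
  have hk : LinearMap.ker T ≤ U := by
    intro w hw
    refine hU w fun j hj => ?_
    have h0 := hq w
    rw [LinearMap.mem_ker.1 hw] at h0
    simp only [inner_zero_left, Complex.zero_re] at h0
    have := (Finset.sum_eq_zero_iff_of_nonneg (fun _ _ => sq_nonneg _)).1 h0.symm j hj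
    rw [← perp_eq_zero_iff]
    exact norm_eq_zero.1 (pow_eq_zero_iff two_ne_zero |>.1 this)
  have hgap := gap_le_re_inner hT hpos (c := c) (fun μ w hμ hw hev => by
    have h1 := h w
    rw [← hq, ← hTv, hev, inner_smul_left, norm_smul, inner_self_eq_norm_sq_to_K] at h1
    have hw' : 0 < ‖w‖ ^ 2 := by positivity
    have h2 : c * (μ * ‖w‖ ^ 2) ≤ (μ * ‖w‖) ^ 2 := by
      have e1 : ((starRingEnd ℂ) (μ : ℂ) * ((‖w‖ : ℝ) : ℂ) ^ 2).re = μ * ‖w‖ ^ 2 := by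
        rw [Complex.conj_ofReal]; norm_cast
      have e2 : ‖(μ : ℂ)‖ = μ := by simp [abs_of_pos hμ]
      rw [e2] at h1
      calc _ = _ := by rw [← e1]; rfl
        _ ≤ _ := h1
    by_contra hlt
    push Not at hlt
    nlinarith [mul_pos hμ hw', mul_pos (sub_pos.2 hlt) (mul_pos hμ hw')]) v
  rw [hq] at hgap
  refine le_trans ?_ hgap
  have : ‖perp U v‖ ≤ ‖perp (LinearMap.ker T) v‖ := by
    rw [← perp_perp_of_le hk v]
    have := re_inner_perp U (perp (LinearMap.ker T) v)
    have h2 := re_inner_le_norm' (perp (LinearMap.ker T) v) (perp U (perp (LinearMap.ker T) v))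
    rw [this] at h2
    by_contra hlt
    push Not at hlt
    nlinarith [norm_nonneg (perp (LinearMap.ker T) v)]
  gcongr

end HilbertSpace

section ProjectionFamily

variable {E : Type*} [NormedAddCommGroup E] [InnerProductSpace ℂ E]
variable {ι : Type*}

/-- The sum of the ranges of `Q 0 W`, `Q 1 W`, `Q 2 W`. -/
def groundSpace (Q : Fin 3 → Finset ι → E →L[ℂ] E) (W : Finset ι) : Submodule ℂ E where
  carrier := {x | ∃ f : Fin 3 → E, (∀ i, Q i W (f i) = f i) ∧ ∑ i, f i = x}
  zero_mem' := ⟨0, by simp, by simp⟩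
  add_mem' := by
    rintro _ _ ⟨f, hf, rfl⟩ ⟨g, hg, rfl⟩
    exact ⟨f + g, fun i => by simp [hf, hg], by simp [Finset.sum_add_distrib]⟩
  smul_mem' := by
    rintro c _ ⟨f, hf, rfl⟩
    exact ⟨c • f, fun i => by simp [hf], by simp [Finset.smul_sum]⟩

variable {Q : Fin 3 → Finset ι → E →L[ℂ] E}

theorem mem_groundSpace_of_eq {W : Finset ι} {i : Fin 3} {x : E} (hx : Q i W x = x) :
    x ∈ groundSpace Q W := by
  refine ⟨fun j => if j = i then x else 0, fun j => ?_, by simp⟩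
  by_cases h : j = i
  · subst h; simpa
  · simp [h]

variable [DecidableEq ι]

/-- Three families of orthogonal projections `Q i W`, multiplicative in the set of sites `W`,
commuting on disjoint sets and with pairwise overlaps `2 ^ (-|W|)` on each set. -/
structure ProjFamily (Q : Fin 3 → Finset ι → E →L[ℂ] E) : Prop where
  symm : ∀ i W x y, inner ℂ (Q i W x) y = inner ℂ x (Q i W y)
  idem : ∀ i W x, Q i W (Q i W x) = Q i W x
  union : ∀ i X Y, Disjoint X Y → ∀ x, Q i (X ∪ Y) x = Q i X (Q i Y x)
  comm : ∀ i j X Y, Disjoint X Y → ∀ x, Q i X (Q j Y x) = Q j Y (Q i X x)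
  small : ∀ i j X, i ≠ j → ∀ x, ‖Q i X (Q j X x)‖ ≤ (1 / 2) ^ X.card * ‖x‖

namespace ProjFamily

theorem fix_of_subset (hQ : ProjFamily Q) {X Y : Finset ι} (h : X ⊆ Y) {i : Fin 3} {x : E}
    (hx : Q i Y x = x) : Q i X x = x := by
  rw [← hx, ← Finset.union_sdiff_of_subset h, hQ.union i _ _ Finset.disjoint_sdiff, hQ.idem]

theorem groundSpace_anti (hQ : ProjFamily Q) {X Y : Finset ι} (h : X ⊆ Y) :
    groundSpace Q Y ≤ groundSpace Q X := by
  rintro _ ⟨f, hf, rfl⟩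
  exact ⟨f, fun i => hQ.fix_of_subset h (hf i), rfl⟩

theorem apply_eq_zero_of_orthogonal (hQ : ProjFamily Q) {W : Finset ι} {x : E}
    (hx : x ∈ (groundSpace Q W)ᗮ) (i : Fin 3) : Q i W x = 0 := by
  have h0 : inner ℂ (Q i W x) x = 0 := hx _ (mem_groundSpace_of_eq (hQ.idem i W x))
  have h1 := re_inner_self (Q i W x)
  rw [hQ.symm, hQ.idem, ← hQ.symm, h0, Complex.zero_re] at h1
  exact norm_eq_zero.1 (pow_eq_zero_iff two_ne_zero |>.1 h1.symm)

theorem mem_orthogonal_of_apply_eq_zero (hQ : ProjFamily Q) {W : Finset ι} {x : E}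
    (hx : ∀ i, Q i W x = 0) : x ∈ (groundSpace Q W)ᗮ := by
  rintro _ ⟨f, hf, rfl⟩
  rw [sum_inner]
  refine Finset.sum_eq_zero fun i _ => ?_
  rw [← hf i, hQ.symm, hx i, inner_zero_right]

theorem re_inner_le (hQ : ProjFamily Q) {W : Finset ι} {q : ℝ} (hq : (1 / 2) ^ W.card ≤ q)
    {i j : Fin 3} (hij : i ≠ j) {x y : E} (hx : Q i W x = x) (hy : Q j W y = y) :
    |(inner ℂ x y).re| ≤ q * (‖x‖ * ‖y‖) := by
  rw [← hx, ← hy, hQ.symm, hx]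
  have h := hQ.small i j W hij y
  calc _ ≤ ‖inner ℂ x (Q i W (Q j W y))‖ := Complex.abs_re_le_norm _
    _ ≤ ‖x‖ * ‖Q i W (Q j W y)‖ := norm_inner_le_norm _ _
    _ ≤ ‖x‖ * ((1 / 2) ^ W.card * ‖y‖) := by gcongr
    _ ≤ ‖x‖ * (q * ‖y‖) := by gcongr
    _ = q * (‖x‖ * ‖Q j W y‖) := by rw [hy]; ring

theorem norm_sum_sq_bounds (hQ : ProjFamily Q) {W : Finset ι} {q : ℝ}
    (hq : (1 / 2) ^ W.card ≤ q) {f : Fin 3 → E} (hf : ∀ i, Q i W (f i) = f i) :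
    (1 - 2 * q) * ∑ i, ‖f i‖ ^ 2 ≤ ‖∑ i, f i‖ ^ 2 ∧
      ‖∑ i, f i‖ ^ 2 ≤ (1 + 2 * q) * ∑ i, ‖f i‖ ^ 2 := by
  have hq0 : 0 ≤ q := le_trans (by positivity) hq
  have key : ∀ i j : Fin 3, i ≠ j →
      |(inner ℂ (f i) (f j)).re| ≤ q * ((‖f i‖ ^ 2 + ‖f j‖ ^ 2) / 2) := by
    intro i j hij
    refine (hQ.re_inner_le hq hij (hf i) (hf j)).trans ?_
    gcongr
    nlinarith [sq_nonneg (‖f i‖ - ‖f j‖)]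
  have h01 := abs_le.1 (key 0 1 (by decide))
  have h02 := abs_le.1 (key 0 2 (by decide))
  have h12 := abs_le.1 (key 1 2 (by decide))
  simp only [Fin.sum_univ_three]
  rw [norm_add_sq_re, norm_add_sq_re, inner_add_left, Complex.add_re]
  constructor <;> nlinarith

theorem sum_norm_sq_le (hQ : ProjFamily Q) {W : Finset ι} {q : ℝ}
    (hq : (1 / 2) ^ W.card ≤ q) (x : E) :
    ∑ i, ‖Q i W x‖ ^ 2 ≤ (1 + 2 * q) * ‖x‖ ^ 2 := by
  have hq0 : 0 ≤ q := le_trans (by positivity) hq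
  have h1 := (hQ.norm_sum_sq_bounds hq (f := fun i => Q i W x) fun i => hQ.idem i W x).2
  have h2 : (inner ℂ x (∑ i, Q i W x)).re = ∑ i, ‖Q i W x‖ ^ 2 := by
    rw [inner_sum, Complex.re_sum]
    refine Finset.sum_congr rfl fun i _ => ?_
    rw [← re_inner_self, hQ.symm, hQ.idem]
  have h3 := re_inner_le_norm' x (∑ i, Q i W x)
  rw [h2] at h3
  set s := ∑ i, ‖Q i W x‖ ^ 2
  have hs0 : 0 ≤ s := by positivity
  have h4 : s ^ 2 ≤ ‖x‖ ^ 2 * ((1 + 2 * q) * s) := by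
    calc s ^ 2 ≤ (‖x‖ * ‖∑ i, Q i W x‖) ^ 2 := by gcongr
      _ = ‖x‖ ^ 2 * ‖∑ i, Q i W x‖ ^ 2 := by ring
      _ ≤ _ := by gcongr
  rcases hs0.eq_or_lt with h0 | h0
  · rw [← h0]; positivity
  · nlinarith

/-- Bounds for the components on a block `Z` disjoint from `W` of a vector of the ground space
of `W` that is orthogonal to the ground space of `W ∪ Z`. -/
theorem far_bounds (hQ : ProjFamily Q) {W Z : Finset ι} (hWZ : Disjoint W Z) {p r : ℝ}
    (hp : (1 / 2) ^ Z.card ≤ p) (hr : (1 / 2) ^ W.card ≤ r) {f : Fin 3 → E}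
    (hf : ∀ i, Q i W (f i) = f i) (hx : ∑ i, f i ∈ (groundSpace Q (W ∪ Z))ᗮ) :
    (∑ i, ‖Q i Z (f i)‖ ^ 2 ≤ 2 * r ^ 2 * ∑ i, ∑ j ∈ univ.erase i, ‖Q j Z (f i)‖ ^ 2) ∧
      (1 - 2 * r) * ∑ i, ∑ j ∈ univ.erase i, ‖Q j Z (f i)‖ ^ 2
        ≤ (1 + 2 * p) * ‖∑ i, f i‖ ^ 2 := by
  have hr0 : 0 ≤ r := le_trans (by positivity) hr
  have hp0 : 0 ≤ p := le_trans (by positivity) hp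
  have hfix : ∀ i j, Q i W (Q j Z (f i)) = Q j Z (f i) := fun i j => by
    rw [hQ.comm i j W Z hWZ, hf]
  constructor
  · have hdiag : ∀ j, Q j Z (f j) = -∑ i ∈ univ.erase j, Q j W (Q j Z (f i)) := by
      intro j
      have h0 := hQ.apply_eq_zero_of_orthogonal hx j
      rw [hQ.union j W Z hWZ, map_sum, map_sum, ← Finset.add_sum_erase _ _ (mem_univ j),
        hfix] at h0
      exact eq_neg_of_add_eq_zero_left h0
    have hle : ∀ i j, i ≠ j → ‖Q j W (Q j Z (f i))‖ ≤ r * ‖Q j Z (f i)‖ := by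
      intro i j hij
      calc _ = ‖Q j W (Q i W (Q j Z (f i)))‖ := by rw [hfix]
        _ ≤ _ := (hQ.small j i W hij.symm _).trans (by gcongr)
    have hcol : ∀ j, ‖Q j Z (f j)‖ ^ 2
        ≤ 2 * r ^ 2 * ∑ i ∈ univ.erase j, ‖Q j Z (f i)‖ ^ 2 := by
      intro j
      have h1 : ‖Q j Z (f j)‖ ≤ r * ∑ i ∈ univ.erase j, ‖Q j Z (f i)‖ := by
        rw [hdiag j, norm_neg, Finset.mul_sum]
        exact (norm_sum_le _ _).trans
          (Finset.sum_le_sum fun i hi => hle i j (Finset.ne_of_mem_erase hi))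
      have h2 := sq_sum_le_card_mul_sum_sq (s := univ.erase j) (f := fun i => ‖Q j Z (f i)‖)
      rw [Finset.card_erase_of_mem (mem_univ j), Finset.card_univ, Fintype.card_fin] at h2
      calc _ ≤ (r * ∑ i ∈ univ.erase j, ‖Q j Z (f i)‖) ^ 2 := by gcongr
        _ = r ^ 2 * (∑ i ∈ univ.erase j, ‖Q j Z (f i)‖) ^ 2 := by ring
        _ ≤ r ^ 2 * (((3 - 1 : ℕ) : ℝ) * ∑ i ∈ univ.erase j, ‖Q j Z (f i)‖ ^ 2) := by gcongr
        _ = _ := by norm_num; ring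
    refine (Finset.sum_le_sum fun j _ => hcol j).trans (le_of_eq ?_)
    rw [← Finset.mul_sum]
    congr 1
    exact Finset.sum_comm' (by simp [eq_comm])
  · have h1 : ∑ i, ∑ j ∈ univ.erase i, ‖Q j Z (f i)‖ ^ 2 ≤ (1 + 2 * p) * ∑ i, ‖f i‖ ^ 2 := by
      rw [Finset.mul_sum]
      refine Finset.sum_le_sum fun i _ => ?_
      exact (Finset.sum_le_sum_of_subset_of_nonneg (Finset.erase_subset _ _)
        fun _ _ _ => sq_nonneg _).trans (hQ.sum_norm_sq_le hp (f i))
    have h2 := (hQ.norm_sum_sq_bounds hr hf).1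
    rcases le_or_gt 0 (1 - 2 * r) with h | h
    · nlinarith
    · have h3 : 0 ≤ ∑ i, ∑ j ∈ univ.erase i, ‖Q j Z (f i)‖ ^ 2 := by positivity
      nlinarith [mul_nonneg (by linarith : 0 ≤ 1 + 2 * p) (sq_nonneg ‖∑ i, f i‖)]

theorem angleLE (hQ : ProjFamily Q) {X Y Z : Finset ι} (hXY : Disjoint X Y)
    (hXZ : Disjoint X Z) (hYZ : Disjoint Y Z) {p q r ε : ℝ} (hX : (1 / 2) ^ X.card ≤ p)
    (hZ : (1 / 2) ^ Z.card ≤ p) (hY : (1 / 2) ^ Y.card ≤ q)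
    (hr₁ : (1 / 2) ^ (X ∪ Y).card ≤ r) (hr₂ : (1 / 2) ^ (Y ∪ Z).card ≤ r)
    (hε : (q + 2 * r ^ 2) * (1 + 2 * p) ≤ ε * (1 - 2 * r)) (hr : 0 < 1 - 2 * r) :
    AngleLE (groundSpace Q (X ∪ Y)) (groundSpace Q (Y ∪ Z)) (groundSpace Q (X ∪ Y ∪ Z)) ε := by
  have hq0 : 0 ≤ q := le_trans (by positivity) hY
  rintro _ ⟨f, hf, rfl⟩ hx _ ⟨g, hg, rfl⟩ hy
  have hfX : ∀ i, Q i X (f i) = f i := fun i => hQ.fix_of_subset subset_union_left (hf i)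
  have hfY : ∀ i, Q i Y (f i) = f i := fun i => hQ.fix_of_subset subset_union_right (hf i)
  have hgY : ∀ i, Q i Y (g i) = g i := fun i => hQ.fix_of_subset subset_union_left (hg i)
  have hgZ : ∀ i, Q i Z (g i) = g i := fun i => hQ.fix_of_subset subset_union_right (hg i)
  obtain ⟨hA, hA'⟩ := hQ.far_bounds (disjoint_union_left.2 ⟨hXZ, hYZ⟩) hZ hr₁ hf hx
  obtain ⟨hB, hB'⟩ := hQ.far_bounds (disjoint_union_left.2 ⟨hXY.symm, hXZ.symm⟩) hX hr₂ hg
    (by rwa [union_comm, ← union_assoc])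
  have hmove : ∀ i j, inner ℂ (f i) (g j) = inner ℂ (Q j Z (f i)) (Q i X (g j)) := by
    intro i j
    rw [← hQ.symm, hQ.comm i j X Z hXZ, hfX, hQ.symm, hgZ]
  have hoff : ∀ i j, i ≠ j → 2 * (inner ℂ (f i) (g j)).re
      ≤ q * (‖Q j Z (f i)‖ ^ 2 + ‖Q i X (g j)‖ ^ 2) := by
    intro i j hij
    rw [hmove]
    have h1 := le_of_abs_le (hQ.re_inner_le hY hij (x := Q j Z (f i)) (y := Q i X (g j))
      (by rw [hQ.comm i j Y Z hYZ, hfY]) (by rw [hQ.comm j i Y X hXY.symm, hgY]))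
    nlinarith [mul_nonneg hq0 (sq_nonneg (‖Q j Z (f i)‖ - ‖Q i X (g j)‖))]
  have hdiag : ∀ i, 2 * (inner ℂ (f i) (g i)).re ≤ ‖Q i Z (f i)‖ ^ 2 + ‖Q i X (g i)‖ ^ 2 := by
    intro i
    rw [hmove]
    nlinarith [re_inner_le_norm' (Q i Z (f i)) (Q i X (g i)),
      sq_nonneg (‖Q i Z (f i)‖ - ‖Q i X (g i)‖)]
  set A := ∑ i, ∑ j ∈ univ.erase i, ‖Q j Z (f i)‖ ^ 2 with hAd
  set B := ∑ i, ∑ j ∈ univ.erase i, ‖Q j X (g i)‖ ^ 2 with hBd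
  have hB2 : B = ∑ i, ∑ j ∈ univ.erase i, ‖Q i X (g j)‖ ^ 2 :=
    Finset.sum_comm' (by simp [eq_comm])
  have hsum : 2 * (inner ℂ (∑ i, f i) (∑ i, g i)).re
      ≤ (∑ i, ‖Q i Z (f i)‖ ^ 2 + ∑ i, ‖Q i X (g i)‖ ^ 2) + q * (A + B) := by
    rw [hB2, hAd, ← Finset.sum_add_distrib, ← Finset.sum_add_distrib, Finset.mul_sum,
      ← Finset.sum_add_distrib, sum_inner, Complex.re_sum, Finset.mul_sum]
    refine Finset.sum_le_sum fun i _ => ?_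
    rw [inner_sum, Complex.re_sum, ← Finset.add_sum_erase _ _ (mem_univ i), mul_add,
      Finset.mul_sum, ← Finset.sum_add_distrib, Finset.mul_sum]
    exact add_le_add (hdiag i)
      (Finset.sum_le_sum fun j hj => hoff i j (Finset.ne_of_mem_erase hj).symm)
  have h2 : 2 * (inner ℂ (∑ i, f i) (∑ i, g i)).re ≤ (q + 2 * r ^ 2) * (A + B) := by
    linarith
  set s := ‖∑ i, f i‖ ^ 2 + ‖∑ i, g i‖ ^ 2 with hs
  have h3 : (1 - 2 * r) * (A + B) ≤ (1 + 2 * p) * s := by rw [hs]; linarith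
  have hs0 : 0 ≤ s := by positivity
  have h4 : (q + 2 * r ^ 2) * ((1 - 2 * r) * (A + B)) ≤ (q + 2 * r ^ 2) * ((1 + 2 * p) * s) := by
    gcongr
  have h5 := mul_le_mul_of_nonneg_right hε hs0
  refine le_of_mul_le_mul_left ?_ hr
  nlinarith

variable [FiniteDimensional ℂ E]

theorem starProjection_comm (hQ : ProjFamily Q) {X Y : Finset ι} (h : Disjoint X Y) (v : E) :
    (groundSpace Q X).starProjection ((groundSpace Q Y).starProjection v)
      = (groundSpace Q Y).starProjection ((groundSpace Q X).starProjection v) := by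
  have inv : ∀ (T : E →L[ℂ] E) (U : Submodule ℂ E),
      (∀ x y, inner ℂ (T x) y = inner ℂ x (T y)) → (∀ x ∈ U, T x ∈ U) →
      ∀ v, T (U.starProjection v) = U.starProjection (T v) := by
    intro T U hT hU v
    symm
    refine Submodule.eq_starProjection_of_mem_orthogonal
      (hU _ (U.starProjection_apply_mem v)) ?_
    rw [← map_sub]
    intro x hx
    rw [← hT]
    exact Submodule.sub_starProjection_mem_orthogonal v _ (hU x hx)
  have h1 : ∀ j v, Q j Y ((groundSpace Q X).starProjection v)
      = (groundSpace Q X).starProjection (Q j Y v) := fun j =>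
    inv (Q j Y) _ (hQ.symm j Y) (by
      rintro _ ⟨f, hf, rfl⟩
      exact ⟨fun i => Q j Y (f i), fun i => by rw [hQ.comm i j X Y h, hf], by simp⟩)
  refine inv _ _ (fun x y => Submodule.inner_starProjection_left_eq_right _ x y) ?_ v
  rintro _ ⟨f, hf, rfl⟩
  exact ⟨fun i => (groundSpace Q X).starProjection (f i), fun i => by rw [h1, hf], by simp⟩

theorem re_inner_perp_nonneg (hQ : ProjFamily Q) {X Y : Finset ι} (h : Disjoint X Y) (v : E) :
    0 ≤ (inner ℂ (perp (groundSpace Q X) v) (perp (groundSpace Q Y) v)).re := by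
  have hc : perp (groundSpace Q X) (perp (groundSpace Q Y) v)
      = perp (groundSpace Q Y) (perp (groundSpace Q X) v) := by
    simp only [perp, map_sub, hQ.starProjection_comm h]; abel
  rw [← perp_perp (groundSpace Q X) v, inner_perp_left, hc, re_inner_perp]
  positivity

end ProjFamily

end ProjectionFamily

section Twirl

theorem pow_of_sq_eq_one {R : Type*} [Ring R] [Algebra ℂ R] {A : R} (hA : A * A = 1) (k : ℕ) :
    A ^ k = ((1 + (-1) ^ k) / 2 : ℂ) • (1 : R) + ((1 - (-1) ^ k) / 2 : ℂ) • A := by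
  induction k with
  | zero => norm_num
  | succ k ih =>
    rw [pow_succ, ih, add_mul, smul_mul_assoc, smul_mul_assoc, hA, one_mul, add_comm]
    congr 2 <;> ring

theorem rotGate_eq {n : ℕ} {A : QMat n} (hA : A * A = 1) (φ : ℝ) :
    rotGate φ A = (Real.cos φ : ℂ) • (1 : QMat n) + (Complex.I * Real.sin φ : ℂ) • A := by
  have key : ∀ z : ℂ, mexp (z • A)
      = ((Complex.exp z + Complex.exp (-z)) / 2) • (1 : QMat n)
        + ((Complex.exp z - Complex.exp (-z)) / 2) • A := by
    intro z
    have hexp : ∀ w : ℂ, HasSum (fun k : ℕ => (k.factorial : ℂ)⁻¹ * w ^ k) (Complex.exp w) := by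
      intro w
      have := NormedSpace.expSeries_hasSum_exp (𝕂 := ℂ) (𝔸 := ℂ) w
      rw [← Complex.exp_eq_exp_ℂ] at this
      simpa only [NormedSpace.expSeries_apply_eq, smul_eq_mul] using this
    have h1 := (((hexp z).add (hexp (-z))).div_const 2).smul_const (1 : QMat n)
    have h2 := (((hexp z).sub (hexp (-z))).div_const 2).smul_const A
    refine HasSum.tsum_eq ((h1.add h2).congr_fun ?_)
    intro k
    rw [smul_pow, pow_of_sq_eq_one hA k, smul_add, smul_add, smul_smul, smul_smul, smul_smul,
      smul_smul, neg_pow z]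
    congr 2 <;> ring
  rw [rotGate, key, Complex.ofReal_cos, Complex.ofReal_sin, Complex.cos, Complex.sin]
  congr 2
  · ring_nf
  · ring_nf
    simp [Complex.I_sq]
    ring

theorem integral_twirl (a b₁ b₂ c d : ℂ) :
    ((2 * Real.pi : ℝ) : ℂ)⁻¹ * ∫ φ in (0 : ℝ)..(2 * Real.pi),
      ((Real.cos φ ^ 4 : ℝ) * a + (Real.sin φ ^ 2 * Real.cos φ ^ 2 : ℝ) * c
        + (Real.sin φ ^ 4 : ℝ) * d + (Real.sin φ * Real.cos φ ^ 3 : ℝ) * b₁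
        + (Real.sin φ ^ 3 * Real.cos φ : ℝ) * b₂ : ℂ)
      = (3 * a + c + 3 * d) / 8 := by
  have hint : ∀ (g : ℝ → ℝ) (hg : Continuous g) (z : ℂ),
      IntervalIntegrable (fun φ => (g φ : ℂ) * z) volume 0 (2 * Real.pi) := fun g hg z =>
    Continuous.intervalIntegrable (by fun_prop) _ _
  have i1 : ∫ φ in (0 : ℝ)..(2 * Real.pi), Real.cos φ ^ 4 = 3 / 4 * Real.pi := by
    rw [integral_cos_pow]; simp; ring
  have i2 : ∫ φ in (0 : ℝ)..(2 * Real.pi), Real.sin φ ^ 2 * Real.cos φ ^ 2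
      = Real.pi / 4 := by
    rw [integral_sin_sq_mul_cos_sq]
    have : Real.sin (4 * (2 * Real.pi)) = 0 := by
      rw [show 4 * (2 * Real.pi) = (8 : ℕ) * Real.pi by push_cast; ring, Real.sin_nat_mul_pi]
    rw [this]; simp; ring
  have i3 : ∫ φ in (0 : ℝ)..(2 * Real.pi), Real.sin φ ^ 4 = 3 / 4 * Real.pi := by
    rw [integral_sin_pow]; simp; ring
  have i4 : ∫ φ in (0 : ℝ)..(2 * Real.pi), Real.sin φ * Real.cos φ ^ 3 = 0 := by
    have := integral_sin_pow_mul_cos_pow_odd (a := 0) (b := 2 * Real.pi) 1 1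
    simpa using this
  have i5 : ∫ φ in (0 : ℝ)..(2 * Real.pi), Real.sin φ ^ 3 * Real.cos φ = 0 := by
    have := integral_sin_pow_mul_cos_pow_odd (a := 0) (b := 2 * Real.pi) 3 0
    simpa using this
  rw [intervalIntegral.integral_add, intervalIntegral.integral_add,
    intervalIntegral.integral_add, intervalIntegral.integral_add]
  · simp only [intervalIntegral.integral_mul_const, intervalIntegral.integral_ofReal, i1, i2, i3,
      i4, i5]
    have := Real.pi_ne_zero
    push_cast
    field_simp
    ring
  all_goals exact Continuous.intervalIntegrable (by fun_prop) _ _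

end Twirl

section Sites

/-- The state space of the four copies of a single qubit. -/
abbrev Site := Fin 2 × Fin 2 × Fin 2 × Fin 2

/-- Collecting the four copies of each qubit. -/
def siteEquiv (n : ℕ) :
    ((Fin 2 → Fin n → Fin 2) × (Fin 2 → Fin n → Fin 2)) ≃ (Fin n → Site) where
  toFun x p := (x.1 0 p, x.1 1 p, x.2 0 p, x.2 1 p)
  invFun g := (fun k p => ![(g p).1, (g p).2.1] k, fun k p => ![(g p).2.2.1, (g p).2.2.2] k)
  left_inv x := by
    ext k p <;> fin_cases k <;> rfl
  right_inv g := by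
    ext p <;> rfl

variable {κ : Type*} [Fintype κ]

/-- The tensor product of single-site matrices. -/
def ten (M : κ → Matrix Site Site ℂ) : Matrix (κ → Site) (κ → Site) ℂ :=
  Matrix.of fun x y => ∏ p, M p (x p) (y p)

theorem ten_mul [DecidableEq κ] (M N : κ → Matrix Site Site ℂ) :
    ten M * ten N = ten (fun p => M p * N p) := by
  ext x y
  simp only [ten, Matrix.mul_apply, Matrix.of_apply, ← Finset.prod_mul_distrib]
  rw [Finset.prod_univ_sum]
  simp

theorem ten_one [DecidableEq κ] : ten (fun _ : κ => (1 : Matrix Site Site ℂ)) = 1 := by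
  ext x y
  simp only [ten, Matrix.of_apply, Matrix.one_apply]
  by_cases h : x = y
  · simp [h]
  · obtain ⟨p, hp⟩ := Function.ne_iff.1 h
    rw [if_neg h]
    exact Finset.prod_eq_zero (Finset.mem_univ p) (if_neg hp)

theorem ten_conjTranspose (M : κ → Matrix Site Site ℂ) : (ten M)ᴴ = ten (fun p => (M p)ᴴ) := by
  ext x y
  simp [ten, Matrix.conjTranspose_apply]

theorem ten_eq_zero {M : κ → Matrix Site Site ℂ} {p : κ} (h : M p = 0) : ten M = 0 := by
  ext x y
  exact Finset.prod_eq_zero (Finset.mem_univ p) (by simp [h])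

theorem ten_smul (c : κ → ℂ) (M : κ → Matrix Site Site ℂ) :
    ten (fun p => c p • M p) = (∏ p, c p) • ten M := by
  ext x y
  simp [ten, Finset.prod_mul_distrib]

/-- The tensor product of four single-qubit matrices. -/
def tau (b₁ b₂ b₃ b₄ : Matrix (Fin 2) (Fin 2) ℂ) : Matrix Site Site ℂ :=
  Matrix.of fun s t =>
    b₁ s.1 t.1 * b₂ s.2.1 t.2.1 * b₃ s.2.2.1 t.2.2.1 * b₄ s.2.2.2 t.2.2.2

theorem tau_mul (b₁ b₂ b₃ b₄ c₁ c₂ c₃ c₄ : Matrix (Fin 2) (Fin 2) ℂ) :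
    tau b₁ b₂ b₃ b₄ * tau c₁ c₂ c₃ c₄ = tau (b₁ * c₁) (b₂ * c₂) (b₃ * c₃) (b₄ * c₄) := by
  ext s t
  simp only [tau, Matrix.mul_apply, Matrix.of_apply, Fintype.sum_prod_type, Fin.sum_univ_two]
  ring

theorem tau_one : tau 1 1 1 1 = 1 := by
  ext s t
  obtain ⟨s₁, s₂, s₃, s₄⟩ := s
  obtain ⟨t₁, t₂, t₃, t₄⟩ := t
  simp only [tau, Matrix.of_apply, Matrix.one_apply, Prod.mk.injEq]
  by_cases h₁ : s₁ = t₁ <;> by_cases h₂ : s₂ = t₂ <;> by_cases h₃ : s₃ = t₃ <;>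
    by_cases h₄ : s₄ = t₄ <;> simp [h₁, h₂, h₃, h₄]

theorem tau_conjTranspose (b₁ b₂ b₃ b₄ : Matrix (Fin 2) (Fin 2) ℂ) :
    (tau b₁ b₂ b₃ b₄)ᴴ = tau b₁ᴴ b₂ᴴ b₃ᴴ b₄ᴴ := by
  ext s t
  simp [tau, Matrix.conjTranspose_apply]

/-- A string of single-qubit matrices. -/
def qstring {n : ℕ} (a : Fin n → Matrix (Fin 2) (Fin 2) ℂ) : QMat n :=
  Matrix.of fun x y => ∏ p, a p (x p) (y p)

theorem qstring_mul {n : ℕ} (a b : Fin n → Matrix (Fin 2) (Fin 2) ℂ) :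
    qstring a * qstring b = qstring (fun p => a p * b p) := by
  ext x y
  simp only [qstring, Matrix.mul_apply, Matrix.of_apply, ← Finset.prod_mul_distrib]
  rw [Finset.prod_univ_sum]
  simp

theorem qstring_one {n : ℕ} : qstring (fun _ : Fin n => 1) = 1 := by
  ext x y
  simp only [qstring, Matrix.of_apply, Matrix.one_apply]
  by_cases h : x = y
  · simp [h]
  · obtain ⟨p, hp⟩ := Function.ne_iff.1 h
    rw [if_neg h]
    exact Finset.prod_eq_zero (Finset.mem_univ p) (if_neg hp)

theorem op1_eq_qstring {n : ℕ} (i : Fin n) (A : Matrix (Fin 2) (Fin 2) ℂ) :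
    op1 i A = qstring (fun p => if p = i then A else 1) := by
  ext x y
  simp only [op1, qstring, Matrix.of_apply]
  rw [← Finset.mul_prod_erase Finset.univ _ (Finset.mem_univ i), if_pos rfl]
  congr 1
  refine Finset.prod_congr rfl fun j hj => ?_
  rw [if_neg (Finset.ne_of_mem_erase hj), Matrix.one_apply]

/-- The matrix of the `(2,2)`-twirl of the one-parameter group generated by an involution which
is a tensor product of the single-qubit matrices `a`. -/
def twirl [DecidableEq κ] (a : κ → Matrix (Fin 2) (Fin 2) ℂ) :
    Matrix (κ → Site) (κ → Site) ℂ :=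
  (1 / 8 : ℂ) • ((3 : ℂ) • 1
    + ten (fun p => tau (a p) 1 (a p) 1) + ten (fun p => tau (a p) 1 1 (a p))
    + ten (fun p => tau 1 (a p) (a p) 1) + ten (fun p => tau 1 (a p) 1 (a p))
    - ten (fun p => tau (a p) (a p) 1 1) - ten (fun p => tau 1 1 (a p) (a p))
    + (3 : ℂ) • ten (fun p => tau (a p) (a p) (a p) (a p)))

theorem ten_tau_apply (b₁ b₂ b₃ b₄ : κ → Matrix (Fin 2) (Fin 2) ℂ) (x y : κ → Site) :
    ten (fun p => tau (b₁ p) (b₂ p) (b₃ p) (b₄ p)) x y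
      = (∏ p, b₁ p (x p).1 (y p).1) * (∏ p, b₂ p (x p).2.1 (y p).2.1)
        * (∏ p, b₃ p (x p).2.2.1 (y p).2.2.1) * (∏ p, b₄ p (x p).2.2.2 (y p).2.2.2) := by
  simp [ten, tau, Finset.prod_mul_distrib]

theorem ten_tau_siteEquiv {n : ℕ} (b₁ b₂ b₃ b₄ : Fin n → Matrix (Fin 2) (Fin 2) ℂ)
    (x y : (Fin 2 → Fin n → Fin 2) × (Fin 2 → Fin n → Fin 2)) :
    ten (fun p => tau (b₁ p) (b₂ p) (b₃ p) (b₄ p)) (siteEquiv n x) (siteEquiv n y)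
      = (∏ p, b₁ p (x.1 0 p) (y.1 0 p)) * (∏ p, b₂ p (x.1 1 p) (y.1 1 p))
        * (∏ p, b₃ p (x.2 0 p) (y.2 0 p)) * (∏ p, b₄ p (x.2 1 p) (y.2 1 p)) :=
  ten_tau_apply b₁ b₂ b₃ b₄ _ _

theorem reindex_Pproj {n : ℕ} (a : Fin n → Matrix (Fin 2) (Fin 2) ℂ) (ha : ∀ p, a p * a p = 1)
    (hr : ∀ p i j, conj (a p i j) = a p i j) :
    Matrix.reindex (siteEquiv n) (siteEquiv n) (Pproj (qstring a)) = twirl a := by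
  have hA : qstring a * qstring a = 1 := by
    rw [qstring_mul]; simp only [ha, qstring_one]
  have hR : ∀ x y, conj (qstring a x y) = qstring a x y := fun x y => by
    simp [qstring, map_prod, hr]
  have h1 : ∀ x y : Fin n → Fin 2,
      (1 : QMat n) x y = ∏ p, (1 : Matrix (Fin 2) (Fin 2) ℂ) (x p) (y p) := fun x y => by
    rw [← qstring_one]; rfl
  rw [Matrix.reindex_apply]
  ext x' y'
  obtain ⟨x, rfl⟩ := (siteEquiv n).surjective x'
  obtain ⟨y, rfl⟩ := (siteEquiv n).surjective y'
  rw [Matrix.submatrix_apply, Equiv.symm_apply_apply, Equiv.symm_apply_apply]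
  obtain ⟨δ, hδ⟩ : ∃ D : QMat n, D = 1 := ⟨_, rfl⟩
  obtain ⟨A, hA'⟩ : ∃ D : QMat n, D = qstring a := ⟨_, rfl⟩
  rw [← hA'] at hA hR ⊢
  rw [← hδ] at h1
  have hconjδ : ∀ x y, conj (δ x y) = δ x y := fun x y => by
    rw [hδ, Matrix.one_apply]; split_ifs <;> simp
  have e1 : ∀ φ : ℝ, tpow2 2 (rotGate φ A) x y
      = ((Real.cos φ ^ 4 : ℝ) * (δ (x.1 0) (y.1 0) * δ (x.1 1) (y.1 1) * δ (x.2 0) (y.2 0)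
            * δ (x.2 1) (y.2 1))
        + (Real.sin φ ^ 2 * Real.cos φ ^ 2 : ℝ) * (
            A (x.1 0) (y.1 0) * δ (x.1 1) (y.1 1) * A (x.2 0) (y.2 0) * δ (x.2 1) (y.2 1)
            + A (x.1 0) (y.1 0) * δ (x.1 1) (y.1 1) * δ (x.2 0) (y.2 0) * A (x.2 1) (y.2 1)
            + δ (x.1 0) (y.1 0) * A (x.1 1) (y.1 1) * A (x.2 0) (y.2 0) * δ (x.2 1) (y.2 1)
            + δ (x.1 0) (y.1 0) * A (x.1 1) (y.1 1) * δ (x.2 0) (y.2 0) * A (x.2 1) (y.2 1)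
            - A (x.1 0) (y.1 0) * A (x.1 1) (y.1 1) * δ (x.2 0) (y.2 0) * δ (x.2 1) (y.2 1)
            - δ (x.1 0) (y.1 0) * δ (x.1 1) (y.1 1) * A (x.2 0) (y.2 0) * A (x.2 1) (y.2 1))
        + (Real.sin φ ^ 4 : ℝ) * (A (x.1 0) (y.1 0) * A (x.1 1) (y.1 1) * A (x.2 0) (y.2 0)
            * A (x.2 1) (y.2 1))
        + (Real.sin φ * Real.cos φ ^ 3 : ℝ) * (Complex.I * (
            A (x.1 0) (y.1 0) * δ (x.1 1) (y.1 1) * δ (x.2 0) (y.2 0) * δ (x.2 1) (y.2 1)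
            + δ (x.1 0) (y.1 0) * A (x.1 1) (y.1 1) * δ (x.2 0) (y.2 0) * δ (x.2 1) (y.2 1)
            - δ (x.1 0) (y.1 0) * δ (x.1 1) (y.1 1) * A (x.2 0) (y.2 0) * δ (x.2 1) (y.2 1)
            - δ (x.1 0) (y.1 0) * δ (x.1 1) (y.1 1) * δ (x.2 0) (y.2 0) * A (x.2 1) (y.2 1)))
        + (Real.sin φ ^ 3 * Real.cos φ : ℝ) * (-Complex.I * (
            δ (x.1 0) (y.1 0) * A (x.1 1) (y.1 1) * A (x.2 0) (y.2 0) * A (x.2 1) (y.2 1)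
            + A (x.1 0) (y.1 0) * δ (x.1 1) (y.1 1) * A (x.2 0) (y.2 0) * A (x.2 1) (y.2 1)
            - A (x.1 0) (y.1 0) * A (x.1 1) (y.1 1) * δ (x.2 0) (y.2 0) * A (x.2 1) (y.2 1)
            - A (x.1 0) (y.1 0) * A (x.1 1) (y.1 1) * A (x.2 0) (y.2 0) * δ (x.2 1) (y.2 1)))
        : ℂ) := by
    intro φ
    have hU : ∀ x y, rotGate φ A x y
        = (Real.cos φ : ℂ) * δ x y + Complex.I * Real.sin φ * A x y := fun x y => by
      rw [rotGate_eq hA, ← hδ]; rfl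
    have hU' : ∀ x y, conj (rotGate φ A x y)
        = (Real.cos φ : ℂ) * δ x y - Complex.I * Real.sin φ * A x y := fun x y => by
      rw [hU, map_add, map_mul, map_mul, map_mul, hconjδ, hR, Complex.conj_ofReal,
        Complex.conj_ofReal, Complex.conj_I]
      ring
    simp only [tpow2, Matrix.of_apply, Fin.prod_univ_two, hU']
    simp only [hU, Complex.ofReal_mul, Complex.ofReal_pow]
    generalize (Real.cos φ : ℂ) = c
    generalize (Real.sin φ : ℂ) = s
    have hI : Complex.I ^ 2 = -1 := Complex.I_sq
    have hI3 : Complex.I ^ 3 = -Complex.I := Complex.I_pow_three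
    have hI4 : Complex.I ^ 4 = 1 := Complex.I_pow_four
    ring_nf
    simp only [hI, hI3, hI4]
    ring
  have e2 : ∀ x y, A x y = ∏ p, a p (x p) (y p) := fun x y => by rw [hA']; rfl
  simp only [Pproj, Matrix.of_apply, e1]
  rw [integral_twirl]
  have h1' : (1 : Matrix (Fin n → Site) (Fin n → Site) ℂ) = ten (fun _ => tau 1 1 1 1) := by
    rw [tau_one, ten_one]
  simp only [twirl, Matrix.smul_apply, Matrix.add_apply, Matrix.sub_apply, h1',
    ten_tau_siteEquiv, smul_eq_mul, e2, h1]
  ring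

end Sites

section TwirlProjection

variable {κ : Type*} [Fintype κ] [DecidableEq κ]

theorem twirl_mul_self {a : κ → Matrix (Fin 2) (Fin 2) ℂ} (ha : ∀ p, a p * a p = 1) :
    twirl a * twirl a = twirl a := by
  have h1 : ten (fun _ : κ => tau 1 1 1 1) = 1 := by rw [tau_one, ten_one]
  simp only [twirl, mul_add, add_mul, mul_sub, sub_mul, smul_mul_assoc, mul_smul_comm,
    ten_mul, tau_mul, ha, mul_one, one_mul, h1]
  module

theorem twirl_conjTranspose {a : κ → Matrix (Fin 2) (Fin 2) ℂ} (ha : ∀ p, (a p)ᴴ = a p) :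
    (twirl a)ᴴ = twirl a := by
  simp [twirl, Matrix.conjTranspose_add, Matrix.conjTranspose_sub, Matrix.conjTranspose_smul,
    ten_conjTranspose, tau_conjTranspose, ha]

end TwirlProjection

section GroundVectors

/-- The three single-site ground vectors: the two pairings of copies and the antisymmetric one. -/
def groundVec : Fin 3 → Site → ℂ
  | 0 => fun s => if s.1 = s.2.2.1 ∧ s.2.1 = s.2.2.2 then 1 / 2 else 0
  | 1 => fun s => if s.1 = s.2.2.2 ∧ s.2.1 = s.2.2.1 then 1 / 2 else 0
  | 2 => fun s => (if s.1 = s.2.2.1 ∧ s.2.1 = s.2.2.2 then 1 / 2 else 0)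
      - if s.1 = s.2.2.2 ∧ s.2.1 = s.2.2.1 then 1 / 2 else 0

/-- The projection onto a ground vector. -/
def groundProj (i : Fin 3) : Matrix Site Site ℂ :=
  Matrix.vecMulVec (groundVec i) (groundVec i)

theorem groundVec_dotProduct_self (i : Fin 3) : groundVec i ⬝ᵥ groundVec i = 1 := by
  fin_cases i <;> simp [groundVec, dotProduct, Fintype.sum_prod_type, Fin.sum_univ_two] <;>
    norm_num

theorem groundVec_dotProduct_sq {i j : Fin 3} (h : i ≠ j) :
    (groundVec i ⬝ᵥ groundVec j) * (groundVec j ⬝ᵥ groundVec i) = 1 / 4 := by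
  fin_cases i <;> fin_cases j <;> first | exact absurd rfl h | skip
  all_goals
    simp [groundVec, dotProduct, Fintype.sum_prod_type, Fin.sum_univ_two]
    norm_num

theorem groundProj_mul (i j : Fin 3) : groundProj i * groundProj j
    = (groundVec i ⬝ᵥ groundVec j) • Matrix.vecMulVec (groundVec i) (groundVec j) := by
  simp [groundProj, Matrix.vecMulVec_mul_vecMulVec]

theorem groundProj_mul_self (i : Fin 3) : groundProj i * groundProj i = groundProj i := by
  rw [groundProj_mul, groundVec_dotProduct_self, one_smul, groundProj]

theorem groundProj_mul_mul {i j : Fin 3} (h : i ≠ j) :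
    groundProj i * groundProj j * groundProj i = (1 / 4 : ℂ) • groundProj i := by
  rw [groundProj_mul, groundProj, smul_mul_assoc, Matrix.vecMulVec_mul_vecMulVec,
    ← groundVec_dotProduct_sq h, mul_smul]
  simp

theorem groundProj_conjTranspose (i : Fin 3) : (groundProj i)ᴴ = groundProj i := by
  have h : ∀ s, star (groundVec i s) = groundVec i s := by
    intro s
    fin_cases i <;> simp only [groundVec, star_sub] <;> congr 1 <;> split_ifs <;> simp
  ext s t
  simp only [groundProj, Matrix.conjTranspose_apply, Matrix.vecMulVec_apply, star_mul', h]
  ring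

/-- The single-qubit matrices occurring in the generators. -/
def IsPauli (b : Matrix (Fin 2) (Fin 2) ℂ) : Prop := b = 1 ∨ b = pauliX ∨ b = pauliZ

theorem IsPauli.mul_self {b : Matrix (Fin 2) (Fin 2) ℂ} (hb : IsPauli b) : b * b = 1 := by
  rcases hb with rfl | rfl | rfl
  · simp
  all_goals
    ext i j; fin_cases i <;> fin_cases j <;> simp [pauliX, pauliZ]

theorem IsPauli.conj_apply {b : Matrix (Fin 2) (Fin 2) ℂ} (hb : IsPauli b) (i j : Fin 2) :
    conj (b i j) = b i j := by
  rcases hb with rfl | rfl | rfl <;> fin_cases i <;> fin_cases j <;> simp [pauliX, pauliZ]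

theorem IsPauli.conjTranspose {b : Matrix (Fin 2) (Fin 2) ℂ} (hb : IsPauli b) : bᴴ = b := by
  rcases hb with rfl | rfl | rfl
  · simp
  all_goals
    ext i j; fin_cases i <;> fin_cases j <;> simp [pauliX, pauliZ]

theorem mul_groundProj_of_mulVec {M : Matrix Site Site ℂ} {c : ℂ} {i : Fin 3}
    (h : M *ᵥ groundVec i = c • groundVec i) : M * groundProj i = c • groundProj i := by
  rw [groundProj, Matrix.mul_vecMulVec, h, Matrix.smul_vecMulVec]

/-- `M` is a generalized permutation matrix: its row `i` has the single entry `φ i`, in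
column `f i`. -/
def IsMono {ι : Type*} [DecidableEq ι] (M : Matrix ι ι ℂ) (f : ι → ι) (φ : ι → ℂ) : Prop :=
  ∀ i j, M i j = if j = f i then φ i else 0

theorem IsMono.mulVec {ι : Type*} [Fintype ι] [DecidableEq ι] {M : Matrix ι ι ℂ} {f : ι → ι}
    {φ : ι → ℂ} (h : IsMono M f φ) (v : ι → ℂ) (i : ι) : (M *ᵥ v) i = φ i * v (f i) := by
  simp [Matrix.mulVec, dotProduct, h i]

theorem isMono_one : IsMono (1 : Matrix (Fin 2) (Fin 2) ℂ) id 1 := fun i j => by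
  simp [Matrix.one_apply, eq_comm]

theorem isMono_pauliX : IsMono pauliX (fun i => 1 - i) 1 := fun i j => by
  fin_cases i <;> fin_cases j <;> simp [pauliX]

theorem isMono_pauliZ : IsMono pauliZ id ![1, -1] := fun i j => by
  fin_cases i <;> fin_cases j <;> simp [pauliZ]

theorem IsMono.tau {b₁ b₂ b₃ b₄ : Matrix (Fin 2) (Fin 2) ℂ} {f₁ f₂ f₃ f₄ : Fin 2 → Fin 2}
    {φ₁ φ₂ φ₃ φ₄ : Fin 2 → ℂ} (h₁ : IsMono b₁ f₁ φ₁) (h₂ : IsMono b₂ f₂ φ₂)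
    (h₃ : IsMono b₃ f₃ φ₃) (h₄ : IsMono b₄ f₄ φ₄) :
    IsMono (_root_.tau b₁ b₂ b₃ b₄) (fun s => (f₁ s.1, f₂ s.2.1, f₃ s.2.2.1, f₄ s.2.2.2))
      (fun s => φ₁ s.1 * φ₂ s.2.1 * φ₃ s.2.2.1 * φ₄ s.2.2.2) := by
  rintro s ⟨t₁, t₂, t₃, t₄⟩
  simp only [_root_.tau, Matrix.of_apply, h₁ _ _, h₂ _ _, h₃ _ _, h₄ _ _, Prod.mk.injEq]
  split_ifs <;> simp_all

theorem IsMono.ten {κ : Type*} [Fintype κ] [DecidableEq κ] {M : κ → Matrix Site Site ℂ}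
    {f : κ → Site → Site} {φ : κ → Site → ℂ} (h : ∀ p, IsMono (M p) (f p) (φ p)) :
    IsMono (_root_.ten M) (fun x p => f p (x p)) (fun x => ∏ p, φ p (x p)) := by
  intro x y
  simp only [_root_.ten, Matrix.of_apply, fun p => h p (x p) (y p)]
  split_ifs with hy
  · exact Finset.prod_congr rfl fun p _ => if_pos (congrFun hy p)
  · obtain ⟨p, hp⟩ := Function.ne_iff.1 hy
    exact Finset.prod_eq_zero (Finset.mem_univ p) (if_neg hp)

theorem det_pauliX : pauliX.det = -1 := by simp [pauliX, Matrix.det_fin_two]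

theorem det_pauliZ : pauliZ.det = -1 := by simp [pauliZ, Matrix.det_fin_two]

theorem IsPauli.tau_mulVec {b : Matrix (Fin 2) (Fin 2) ℂ} (hb : IsPauli b) :
    (tau b 1 b 1 *ᵥ groundVec 0 = (1 : ℂ) • groundVec 0 ∧
      tau 1 b 1 b *ᵥ groundVec 0 = (1 : ℂ) • groundVec 0) ∧
    (tau b 1 1 b *ᵥ groundVec 1 = (1 : ℂ) • groundVec 1 ∧
      tau 1 b b 1 *ᵥ groundVec 1 = (1 : ℂ) • groundVec 1) ∧
    (tau b b 1 1 *ᵥ groundVec 2 = b.det • groundVec 2 ∧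
      tau 1 1 b b *ᵥ groundVec 2 = b.det • groundVec 2) := by
  have h1 := isMono_one
  rcases hb with rfl | rfl | rfl
  · simp [tau_one]
  · have hX := isMono_pauliX
    refine ⟨⟨?_, ?_⟩, ⟨?_, ?_⟩, ?_, ?_⟩
    all_goals
      ext ⟨s₁, s₂, s₃, s₄⟩
      simp only [(hX.tau h1 hX h1).mulVec, (h1.tau hX h1 hX).mulVec, (hX.tau h1 h1 hX).mulVec,
        (h1.tau hX hX h1).mulVec, (hX.tau hX h1 h1).mulVec, (h1.tau h1 hX hX).mulVec, det_pauliX]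
      revert s₁ s₂ s₃ s₄
      simp [Fin.forall_fin_two, groundVec]
  · have hZ := isMono_pauliZ
    refine ⟨⟨?_, ?_⟩, ⟨?_, ?_⟩, ?_, ?_⟩
    all_goals
      ext ⟨s₁, s₂, s₃, s₄⟩
      simp only [(hZ.tau h1 hZ h1).mulVec, (h1.tau hZ h1 hZ).mulVec, (hZ.tau h1 h1 hZ).mulVec,
        (h1.tau hZ hZ h1).mulVec, (hZ.tau hZ h1 h1).mulVec, (h1.tau h1 hZ hZ).mulVec, det_pauliZ]
      revert s₁ s₂ s₃ s₄
      simp [Fin.forall_fin_two, groundVec]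

theorem groundProj_mul_tau_mul {b : Matrix (Fin 2) (Fin 2) ℂ} (hb : b = pauliX ∨ b = pauliZ) :
    groundProj 2 * (tau b 1 b 1 * groundProj 2) = 0 := by
  rw [groundProj, Matrix.mul_vecMulVec, Matrix.vecMulVec_mul_vecMulVec]
  have : groundVec 2 ⬝ᵥ (tau b 1 b 1 *ᵥ groundVec 2) = 0 := by
    have h1 := isMono_one
    rcases hb with rfl | rfl
    · simp [dotProduct, (isMono_pauliX.tau h1 isMono_pauliX h1).mulVec, groundVec,
        Fintype.sum_prod_type]
    · simp [dotProduct, (isMono_pauliZ.tau h1 isMono_pauliZ h1).mulVec, groundVec,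
        Fintype.sum_prod_type]
  simp [this]

end GroundVectors

section BlockProjections

variable {κ : Type*} [Fintype κ] [DecidableEq κ]

/-- The projection onto the ground vector `i` at each site of `W`. -/
def blockProj (i : Fin 3) (W : Finset κ) : Matrix (κ → Site) (κ → Site) ℂ :=
  ten (fun p => if p ∈ W then groundProj i else 1)

theorem ten_mul_blockProj {B : κ → Matrix Site Site ℂ} {c : κ → ℂ} {i : Fin 3} {W : Finset κ}
    (h : ∀ p, B p *ᵥ groundVec i = c p • groundVec i) (h1 : ∀ p ∉ W, B p = c p • 1) :
    ten B * blockProj i W = (∏ p, c p) • blockProj i W := by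
  rw [blockProj, ten_mul, ← ten_smul]
  congr 1
  ext1 p
  split_ifs with hp
  · exact mul_groundProj_of_mulVec (h p)
  · rw [mul_one, h1 p hp]

theorem blockProj_mul_self (i : Fin 3) (W : Finset κ) :
    blockProj i W * blockProj i W = blockProj i W := by
  rw [blockProj, ten_mul]
  congr 1
  ext1 p
  split_ifs
  exacts [groundProj_mul_self i, mul_one 1]

section Fix

variable {a : κ → Matrix (Fin 2) (Fin 2) ℂ} {W : Finset κ}

theorem twirl_mul_eq_of_fixed₁ {R : Matrix (κ → Site) (κ → Site) ℂ} (ha : ∀ p, a p * a p = 1)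
    (h13 : ten (fun p => tau (a p) 1 (a p) 1) * R = R)
    (h24 : ten (fun p => tau 1 (a p) 1 (a p)) * R = R) : twirl a * R = R := by
  have h1234 := congrArg (ten (fun p => tau (a p) 1 (a p) 1) * ·) h24
  have h12 := congrArg (ten (fun p => tau (a p) 1 1 (a p)) * ·) h24
  have h34 := congrArg (ten (fun p => tau (a p) 1 1 (a p)) * ·) h13
  simp only [← mul_assoc, ten_mul, tau_mul, ha, mul_one, one_mul] at h1234 h12 h34
  have h23 := congrArg (ten (fun p => tau (a p) 1 1 (a p)) * ·) h1234
  simp only [← mul_assoc, ten_mul, tau_mul, ha, one_mul, h13] at h23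
  simp only [twirl, add_mul, sub_mul, smul_mul_assoc, one_mul, h13, h24, h1234, h12, h34, h23]
  module

theorem twirl_mul_eq_of_fixed₂ {R : Matrix (κ → Site) (κ → Site) ℂ} (ha : ∀ p, a p * a p = 1)
    (h14 : ten (fun p => tau (a p) 1 1 (a p)) * R = R)
    (h23 : ten (fun p => tau 1 (a p) (a p) 1) * R = R) : twirl a * R = R := by
  have h1234 := congrArg (ten (fun p => tau (a p) 1 1 (a p)) * ·) h23
  have h12 := congrArg (ten (fun p => tau (a p) 1 (a p) 1) * ·) h23
  have h34 := congrArg (ten (fun p => tau (a p) 1 (a p) 1) * ·) h14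
  simp only [← mul_assoc, ten_mul, tau_mul, ha, mul_one, one_mul] at h1234 h12 h34
  have h24 := congrArg (ten (fun p => tau (a p) 1 (a p) 1) * ·) h1234
  simp only [← mul_assoc, ten_mul, tau_mul, ha, one_mul, h14] at h24
  simp only [twirl, add_mul, sub_mul, smul_mul_assoc, one_mul, h14, h23, h1234, h12, h34, h24]
  module

theorem twirl_mul_of_eigen {R : Matrix (κ → Site) (κ → Site) ℂ} {z : ℂ} (hz : z * z = 1)
    (ha : ∀ p, a p * a p = 1) (h12 : ten (fun p => tau (a p) (a p) 1 1) * R = z • R)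
    (h34 : ten (fun p => tau 1 1 (a p) (a p)) * R = z • R) :
    twirl a * R = ((3 - z) / 4) • R
      + ((1 + z) / 4) • (ten (fun p => tau (a p) 1 (a p) 1) * R) := by
  have h1234 := congrArg (ten (fun p => tau (a p) (a p) 1 1) * ·) h34
  have h23 := congrArg (ten (fun p => tau (a p) 1 (a p) 1) * ·) h12
  have h14 := congrArg (ten (fun p => tau (a p) 1 (a p) 1) * ·) h34
  simp only [← mul_assoc, ten_mul, tau_mul, ha, mul_one, one_mul, mul_smul_comm]
    at h1234 h23 h14
  rw [h12, smul_smul, hz, one_smul] at h1234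
  have h24 := congrArg (ten (fun p => tau (a p) 1 (a p) 1) * ·) h1234
  simp only [← mul_assoc, ten_mul, tau_mul, ha, one_mul] at h24
  simp only [twirl, add_mul, sub_mul, smul_mul_assoc, one_mul, h24, h1234, h12, h34, h23, h14]
  module

theorem twirl_mul_blockProj (ha : ∀ p, IsPauli (a p)) (hW : ∀ p ∉ W, a p = 1) {i : Fin 3}
    (hi : i = 2 → ∏ p, (a p).det = -1) : twirl a * blockProj i W = blockProj i W := by
  have hsq := fun p => (ha p).mul_self
  fin_cases i
  · refine twirl_mul_eq_of_fixed₁ hsq ?_ ?_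
    · simpa using ten_mul_blockProj (c := fun _ => 1) (W := W) (fun p => (ha p).tau_mulVec.1.1)
        fun p hp => by simp [hW p hp, tau_one]
    · simpa using ten_mul_blockProj (c := fun _ => 1) (W := W) (fun p => (ha p).tau_mulVec.1.2)
        fun p hp => by simp [hW p hp, tau_one]
  · refine twirl_mul_eq_of_fixed₂ hsq ?_ ?_
    · simpa using ten_mul_blockProj (c := fun _ => 1) (W := W) (fun p => (ha p).tau_mulVec.2.1.1)
        fun p hp => by simp [hW p hp, tau_one]
    · simpa using ten_mul_blockProj (c := fun _ => 1) (W := W) (fun p => (ha p).tau_mulVec.2.1.2)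
        fun p hp => by simp [hW p hp, tau_one]
  · have h12 := ten_mul_blockProj (W := W) (fun p => (ha p).tau_mulVec.2.2.1)
        fun p hp => by simp [hW p hp, tau_one]
    have h34 := ten_mul_blockProj (W := W) (fun p => (ha p).tau_mulVec.2.2.2)
        fun p hp => by simp [hW p hp, tau_one]
    rw [hi rfl] at h12 h34
    have := twirl_mul_of_eigen (by norm_num) hsq h12 h34
    norm_num at this
    exact this

theorem blockProj_mul_twirl_mul (ha : ∀ p, IsPauli (a p)) (hW : ∀ p ∉ W, a p = 1)
    (hdet : ∏ p, (a p).det = 1) {q : κ} (hq : q ∈ W) (haq : a q = pauliX ∨ a q = pauliZ) :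
    blockProj 2 W * (twirl a * blockProj 2 W) = (1 / 2 : ℂ) • blockProj 2 W := by
  have hsq := fun p => (ha p).mul_self
  have h12 := ten_mul_blockProj (W := W) (fun p => (ha p).tau_mulVec.2.2.1)
      fun p hp => by simp [hW p hp, tau_one]
  have h34 := ten_mul_blockProj (W := W) (fun p => (ha p).tau_mulVec.2.2.2)
      fun p hp => by simp [hW p hp, tau_one]
  rw [hdet] at h12 h34
  have h0 : blockProj 2 W * (ten (fun p => tau (a p) 1 (a p) 1) * blockProj 2 W) = 0 := by
    rw [blockProj, ten_mul, ten_mul]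
    exact ten_eq_zero (p := q) (by simp only [if_pos hq, groundProj_mul_tau_mul haq])
  rw [twirl_mul_of_eigen (by norm_num) hsq h12 h34, mul_add, mul_smul_comm, mul_smul_comm,
    blockProj_mul_self, h0]
  norm_num

end Fix

/-- The operator on the Hilbert space attached to `blockProj`. -/
def blockOp (i : Fin 3) (W : Finset κ) :
    EuclideanSpace ℂ (κ → Site) →L[ℂ] EuclideanSpace ℂ (κ → Site) :=
  Matrix.toEuclideanCLM (𝕜 := ℂ) (blockProj i W)

theorem inner_toEuclideanCLM {ι : Type*} [Fintype ι] [DecidableEq ι] {M : Matrix ι ι ℂ}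
    (hM : Mᴴ = M) (x y : EuclideanSpace ℂ ι) :
    inner ℂ (Matrix.toEuclideanCLM (𝕜 := ℂ) M x) y
      = inner ℂ x (Matrix.toEuclideanCLM (𝕜 := ℂ) M y) := by
  have h : star (Matrix.toEuclideanCLM (n := ι) (𝕜 := ℂ) M)
      = Matrix.toEuclideanCLM (𝕜 := ℂ) M := by
    rw [← map_star, Matrix.star_eq_conjTranspose, hM]
  rw [← ContinuousLinearMap.adjoint_inner_right, ← ContinuousLinearMap.star_eq_adjoint, h]

theorem toEuclideanCLM_mul_apply {ι : Type*} [Fintype ι] [DecidableEq ι] (M N : Matrix ι ι ℂ)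
    (x : EuclideanSpace ℂ ι) :
    Matrix.toEuclideanCLM (𝕜 := ℂ) M (Matrix.toEuclideanCLM (𝕜 := ℂ) N x)
      = Matrix.toEuclideanCLM (𝕜 := ℂ) (M * N) x := by
  rw [map_mul]; rfl

theorem blockProj_conjTranspose (i : Fin 3) (W : Finset κ) :
    (blockProj i W)ᴴ = blockProj i W := by
  rw [blockProj, ten_conjTranspose]
  congr 1
  ext1 p
  split_ifs
  exacts [groundProj_conjTranspose i, Matrix.conjTranspose_one]

theorem blockProj_union (i : Fin 3) {X Y : Finset κ} (h : Disjoint X Y) :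
    blockProj i (X ∪ Y) = blockProj i X * blockProj i Y := by
  simp only [blockProj, ten_mul]
  congr 1
  ext1 p
  by_cases hX : p ∈ X
  · simp [hX, Finset.disjoint_left.1 h hX]
  · simp [hX]

theorem blockProj_comm (i j : Fin 3) {X Y : Finset κ} (h : Disjoint X Y) :
    blockProj i X * blockProj j Y = blockProj j Y * blockProj i X := by
  simp only [blockProj, ten_mul]
  congr 1
  ext1 p
  by_cases hX : p ∈ X
  · simp [hX, Finset.disjoint_left.1 h hX]
  · simp [hX]

theorem blockProj_mul_mul {i j : Fin 3} (h : i ≠ j) (W : Finset κ) :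
    blockProj i W * blockProj j W * blockProj i W = ((1 / 4 : ℂ) ^ W.card) • blockProj i W := by
  have : ((1 / 4 : ℂ) ^ W.card) = ∏ p : κ, if p ∈ W then 1 / 4 else 1 := by
    rw [Finset.prod_ite_mem, Finset.univ_inter, Finset.prod_const]
  rw [this, blockProj, blockProj, ten_mul, ten_mul, ← ten_smul]
  congr 1
  ext1 p
  split_ifs
  · exact groundProj_mul_mul h
  · simp

theorem projFamily_blockOp : ProjFamily (blockOp (κ := κ)) where
  symm i W := inner_toEuclideanCLM (blockProj_conjTranspose i W)
  idem i W x := by rw [blockOp, toEuclideanCLM_mul_apply, blockProj_mul_self]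
  union i X Y h x := by rw [blockOp, blockProj_union i h, ← toEuclideanCLM_mul_apply]; rfl
  comm i j X Y h x := by
    rw [blockOp, blockOp, toEuclideanCLM_mul_apply, toEuclideanCLM_mul_apply,
      blockProj_comm i j h]
  small i j W h x := by
    have hs := fun i => inner_toEuclideanCLM (blockProj_conjTranspose (κ := κ) i W)
    have hle : ‖blockOp j W x‖ ≤ ‖x‖ := by
      have h1 := re_inner_self (blockOp j W x)
      rw [blockOp, hs, toEuclideanCLM_mul_apply, blockProj_mul_self] at h1
      have h2 := re_inner_le_norm' x (blockOp j W x)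
      rw [blockOp, h1] at h2
      by_contra hc
      push Not at hc
      rw [blockOp] at hc
      nlinarith [norm_nonneg x]
    have h1 := re_inner_self (blockOp i W (blockOp j W x))
    have h2 := re_inner_self (blockOp j W x)
    rw [blockOp, blockOp, hs, toEuclideanCLM_mul_apply, toEuclideanCLM_mul_apply,
      toEuclideanCLM_mul_apply, blockProj_mul_self, hs, toEuclideanCLM_mul_apply, ← mul_assoc,
      blockProj_mul_mul h.symm, map_smul, _root_.smul_apply, inner_smul_right] at h1
    rw [blockOp, hs, toEuclideanCLM_mul_apply, blockProj_mul_self] at h2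
    have h3 : ((1 / 4 : ℂ) ^ W.card) = (((1 / 4 : ℝ) ^ W.card : ℝ) : ℂ) := by push_cast; rfl
    rw [h3, Complex.re_ofReal_mul, h2, show (1 / 4 : ℝ) = (1 / 2) ^ 2 by norm_num, ← pow_mul,
      mul_comm 2, pow_mul, ← mul_pow] at h1
    have h4 := (pow_left_inj₀ (by positivity) (by positivity) two_ne_zero).1 h1
    rw [blockOp, blockOp, ← toEuclideanCLM_mul_apply] at *
    rw [← h4]
    exact mul_le_mul_of_nonneg_left hle (by positivity)

end BlockProjections

section Strings

variable {n : ℕ}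

/-- The string with the single nontrivial factor `b` at site `i`. -/
def oneSite (i : Fin n) (b : Matrix (Fin 2) (Fin 2) ℂ) (p : Fin n) : Matrix (Fin 2) (Fin 2) ℂ :=
  if p = i then b else 1

/-- The string of the stabilizer generator `Z X Z` centred at site `i`. -/
def cluster (i p : Fin n) : Matrix (Fin 2) (Fin 2) ℂ :=
  if p = i then pauliX else if (p : ℕ) + 1 = i ∨ (i : ℕ) + 1 = p then pauliZ else 1

theorem isPauli_oneSite (i : Fin n) {b : Matrix (Fin 2) (Fin 2) ℂ} (hb : IsPauli b) (p : Fin n) :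
    IsPauli (oneSite i b p) := by
  unfold oneSite
  split_ifs
  exacts [hb, Or.inl rfl]

theorem isPauli_cluster (i p : Fin n) : IsPauli (cluster i p) := by
  unfold cluster
  split_ifs
  exacts [Or.inr (Or.inl rfl), Or.inr (Or.inr rfl), Or.inl rfl]

theorem isPauli_pauliX : IsPauli pauliX := Or.inr (Or.inl rfl)

theorem isPauli_pauliZ : IsPauli pauliZ := Or.inr (Or.inr rfl)

theorem ZXZop_eq_qstring (i : Fin n) : ZXZop i = qstring (cluster i) := by
  have h1 : (if h : 0 < (i : ℕ) then Zop (n := n) ⟨(i : ℕ) - 1, by have := i.isLt; omega⟩ else 1)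
      = qstring (fun p : Fin n => if (p : ℕ) + 1 = i then pauliZ else 1) := by
    split_ifs with h
    · rw [Zop, op1_eq_qstring]
      congr 1
      ext1 p
      refine if_congr ?_ rfl rfl
      rw [Fin.ext_iff]
      simp only
      omega
    · rw [← qstring_one]
      congr 1
      ext1 p
      rw [if_neg (by omega)]
  have h2 : (if h : (i : ℕ) + 1 < n then Zop (n := n) ⟨(i : ℕ) + 1, h⟩ else 1)
      = qstring (fun p : Fin n => if (i : ℕ) + 1 = p then pauliZ else 1) := by
    split_ifs with h
    · rw [Zop, op1_eq_qstring]
      congr 1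
      ext1 p
      refine if_congr ?_ rfl rfl
      rw [Fin.ext_iff]
      simp only
      omega
    · rw [← qstring_one]
      congr 1
      ext1 p
      rw [if_neg (by omega)]
  rw [ZXZop, h1, h2, Xop, op1_eq_qstring, qstring_mul, qstring_mul]
  congr 1
  ext1 p
  simp only [cluster, Fin.ext_iff]
  by_cases hp : (p : ℕ) = i
  · rw [if_pos hp, if_pos hp, if_neg (by omega), if_neg (by omega), one_mul, mul_one]
  · by_cases hp' : (p : ℕ) + 1 = i
    · rw [if_neg hp, if_neg hp, if_pos hp', if_neg (by omega), if_pos (Or.inl hp'), mul_one,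
        mul_one]
    · simp [hp, hp']

/-- The local term attached to a string. -/
def localTerm {κ : Type*} [Fintype κ] [DecidableEq κ] (a : κ → Matrix (Fin 2) (Fin 2) ℂ) :
    Matrix (κ → Site) (κ → Site) ℂ := 1 - twirl a

theorem reindex_Hham (n : ℕ) :
    Matrix.reindexAlgEquiv ℂ ℂ (siteEquiv n) (Hham n)
      = (∑ i : Fin n, localTerm (oneSite i pauliX)) + (∑ i : Fin n, localTerm (oneSite i pauliZ))
        + ∑ i : Fin n, localTerm (cluster i) := by
  have key : ∀ a : Fin n → Matrix (Fin 2) (Fin 2) ℂ, (∀ p, IsPauli (a p)) →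
      Matrix.reindexAlgEquiv ℂ ℂ (siteEquiv n) (1 - Pproj (qstring a)) = localTerm a := by
    intro a ha
    rw [map_sub, map_one, Matrix.coe_reindexAlgEquiv, reindex_Pproj a
      (fun p => (ha p).mul_self) (fun p => (ha p).conj_apply), localTerm]
  have hX : ∀ i : Fin n, Xop i = qstring (oneSite i pauliX) := fun i => op1_eq_qstring i _
  have hZ : ∀ i : Fin n, Zop i = qstring (oneSite i pauliZ) := fun i => op1_eq_qstring i _
  simp only [Hham, map_add, map_sum, hX, hZ, ZXZop_eq_qstring,
    fun i : Fin n => key _ (isPauli_oneSite i isPauli_pauliX),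
    fun i : Fin n => key _ (isPauli_oneSite i isPauli_pauliZ),
    fun i : Fin n => key _ (isPauli_cluster i)]

/-- The bulk Hamiltonian of the seven sites `f 0, …, f 6`. -/
def windowHam (f : Fin 7 → Fin n) : Matrix (Fin n → Site) (Fin n → Site) ℂ :=
  ∑ q, (localTerm (oneSite (f q) pauliX) + localTerm (oneSite (f q) pauliZ))
    + ∑ q ∈ {1, 2, 3, 4, 5}, localTerm (cluster (f q))

theorem reindex_HhamB (h : 0 < 7) :
    Matrix.reindexAlgEquiv ℂ ℂ (siteEquiv 7) (HhamB 7 h) = windowHam id := by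
  have key : ∀ i : Fin 7, Matrix.reindexAlgEquiv ℂ ℂ (siteEquiv 7) (1 - Pproj (ZXZop i))
      = localTerm (cluster i) := by
    intro i
    rw [map_sub, map_one, ZXZop_eq_qstring, Matrix.coe_reindexAlgEquiv, reindex_Pproj _
      (fun p => (isPauli_cluster i p).mul_self) (fun p => (isPauli_cluster i p).conj_apply),
      localTerm]
  rw [HhamB, HhamL, map_sub, map_sub, reindex_Hham, key, key, windowHam,
    Finset.sum_add_distrib]
  simp only [id]
  have h6 : (⟨7 - 1, by omega⟩ : Fin 7) = 6 := rfl
  have h0 : (⟨0, h⟩ : Fin 7) = 0 := rfl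
  rw [h6, h0, add_sub_assoc, add_sub_assoc]
  congr 1
  simp [Fin.sum_univ_seven]
  abel

end Strings

section Slices

variable {κ κ₂ : Type*} [Fintype κ] [Fintype κ₂] [DecidableEq κ] [DecidableEq κ₂]

/-- The slice of a vector through `y` along the sites in the range of `f`. -/
def sliceAt (f : κ₂ → κ) (y : κ → Site) (v : (κ → Site) → ℂ) (z : κ₂ → Site) : ℂ :=
  v (Function.extend f z y)

theorem sliceAt_ten_mulVec {f : κ₂ → κ} (hf : f.Injective) {M : κ → Matrix Site Site ℂ}
    (hM : ∀ p, p ∉ Set.range f → M p = 1) (y : κ → Site) (v : (κ → Site) → ℂ) :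
    sliceAt f y (ten M *ᵥ v) = ten (M ∘ f) *ᵥ sliceAt f y v := by
  have hinj : Function.Injective fun z : κ₂ → Site => Function.extend f z y := by
    intro z z' h
    ext1 q
    simpa [hf.extend_apply] using congrFun h (f q)
  ext1 z
  symm
  refine Fintype.sum_of_injective _ hinj _ _ ?_ ?_
  · intro w hw
    have : ∃ p, p ∉ Set.range f ∧ w p ≠ y p := by
      by_contra! hc
      refine hw ⟨w ∘ f, ?_⟩
      ext1 p
      by_cases hp : p ∈ Set.range f
      · obtain ⟨q, rfl⟩ := hp
        simp [hf.extend_apply]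
      · simp [Function.extend_apply' _ _ _ hp, hc p hp]
    obtain ⟨p, hp, hwp⟩ := this
    have : ten M (Function.extend f z y) w = 0 := by
      refine Finset.prod_eq_zero (Finset.mem_univ p) ?_
      rw [hM p hp, Function.extend_apply' _ _ _ hp, Matrix.one_apply_ne hwp.symm]
    exact mul_eq_zero_of_left this _
  · intro z'
    congr 1
    refine Fintype.prod_of_injective f hf _ _ (fun p hp => ?_) fun q => ?_
    · rw [hM p hp, Function.extend_apply' _ _ _ hp, Function.extend_apply' _ _ _ hp,
        Matrix.one_apply_eq]
    · simp [hf.extend_apply]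

theorem sliceAt_twirl_mulVec {f : κ₂ → κ} (hf : f.Injective)
    {a : κ → Matrix (Fin 2) (Fin 2) ℂ} (ha : ∀ p, p ∉ Set.range f → a p = 1) (y : κ → Site)
    (v : (κ → Site) → ℂ) :
    sliceAt f y (twirl a *ᵥ v) = twirl (a ∘ f) *ᵥ sliceAt f y v := by
  have hadd : ∀ v w : (κ → Site) → ℂ, sliceAt f y (v + w) = sliceAt f y v + sliceAt f y w :=
    fun _ _ => rfl
  have hsub : ∀ v w : (κ → Site) → ℂ, sliceAt f y (v - w) = sliceAt f y v - sliceAt f y w :=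
    fun _ _ => rfl
  have hsmul : ∀ (c : ℂ) (v : (κ → Site) → ℂ), sliceAt f y (c • v) = c • sliceAt f y v :=
    fun _ _ => rfl
  simp only [twirl, Matrix.smul_mulVec, Matrix.add_mulVec, Matrix.sub_mulVec, Matrix.one_mulVec,
    hadd, hsub, hsmul]
  rw [sliceAt_ten_mulVec hf, sliceAt_ten_mulVec hf, sliceAt_ten_mulVec hf, sliceAt_ten_mulVec hf,
    sliceAt_ten_mulVec hf, sliceAt_ten_mulVec hf, sliceAt_ten_mulVec hf]
  · rfl
  all_goals
    intro p hp
    simp only [ha p hp, tau_one]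

theorem sliceAt_localTerm_mulVec {f : κ₂ → κ} (hf : f.Injective)
    {a : κ → Matrix (Fin 2) (Fin 2) ℂ} {b : κ₂ → Matrix (Fin 2) (Fin 2) ℂ}
    (ha : ∀ p, p ∉ Set.range f → a p = 1) (hab : a ∘ f = b) (y : κ → Site)
    (v : (κ → Site) → ℂ) :
    sliceAt f y (localTerm a *ᵥ v) = localTerm b *ᵥ sliceAt f y v := by
  rw [localTerm, localTerm, Matrix.sub_mulVec, Matrix.sub_mulVec, Matrix.one_mulVec,
    Matrix.one_mulVec, ← hab, ← sliceAt_twirl_mulVec hf ha]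
  rfl

/-- The inclusion of `m` consecutive sites starting at `a`. -/
def shift {m n : ℕ} (a : ℕ) (h : a + m ≤ n) (q : Fin m) : Fin n := ⟨a + q, by omega⟩

theorem shift_injective {m n : ℕ} (a : ℕ) (h : a + m ≤ n) : (shift a h).Injective := by
  intro q q' hq
  simpa [shift, Fin.ext_iff] using hq

theorem oneSite_comp {m n : ℕ} {f : Fin m → Fin n} (hf : f.Injective) (q : Fin m)
    (b : Matrix (Fin 2) (Fin 2) ℂ) : oneSite (f q) b ∘ f = oneSite q b := by
  ext1 p
  simp [oneSite, hf.eq_iff]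

theorem oneSite_of_notMem_range {m n : ℕ} {f : Fin m → Fin n} (q : Fin m)
    (b : Matrix (Fin 2) (Fin 2) ℂ) (p : Fin n) (hp : p ∉ Set.range f) :
    oneSite (f q) b p = 1 :=
  if_neg fun h => hp ⟨q, h.symm⟩

theorem cluster_comp_shift {m n : ℕ} (a : ℕ) (h : a + m ≤ n) (q : Fin m) :
    cluster (shift a h q) ∘ shift a h = cluster q := by
  ext1 p
  simp only [cluster, shift, Function.comp_apply, Fin.ext_iff, add_assoc, add_right_inj]

theorem cluster_of_notMem_range {m n : ℕ} (a : ℕ) (h : a + m ≤ n) (q : Fin m) (hq : 0 < (q : ℕ))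
    (hq' : (q : ℕ) + 1 < m) (p : Fin n) (hp : p ∉ Set.range (shift a h)) :
    cluster (shift a h q) p = 1 := by
  have key : ∀ k (hk : k < m), (p : ℕ) ≠ a + k := fun k hk hpk =>
    hp ⟨⟨k, hk⟩, Fin.ext hpk.symm⟩
  have h1 := key q q.2
  have h2 := key (q + 1) hq'
  have h3 := key (q - 1) (by omega)
  have hv : (shift a h q : ℕ) = a + q := rfl
  rw [cluster, if_neg fun hc => h1 (by rw [hc, hv]), if_neg (by rw [hv]; omega)]

theorem sliceAt_windowHam_mulVec {n : ℕ} (a : ℕ) (h : a + 7 ≤ n) (y : Fin n → Site)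
    (v : (Fin n → Site) → ℂ) :
    sliceAt (shift a h) y (windowHam (shift a h) *ᵥ v)
      = windowHam id *ᵥ sliceAt (shift a h) y v := by
  have hf := shift_injective a h
  have hadd : ∀ v w : (Fin n → Site) → ℂ, sliceAt (shift a h) y (v + w)
      = sliceAt (shift a h) y v + sliceAt (shift a h) y w := fun _ _ => rfl
  have hsum : ∀ (s : Finset (Fin 7)) (v : Fin 7 → (Fin n → Site) → ℂ),
      sliceAt (shift a h) y (∑ q ∈ s, v q) = ∑ q ∈ s, sliceAt (shift a h) y (v q) := by
    intro s v
    ext1 z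
    simp [sliceAt, Finset.sum_apply]
  simp only [windowHam, Matrix.add_mulVec, Matrix.sum_mulVec, hadd, hsum]
  congr 1
  · refine Finset.sum_congr rfl fun q _ => ?_
    rw [sliceAt_localTerm_mulVec hf (oneSite_of_notMem_range q _) (oneSite_comp hf q _),
      sliceAt_localTerm_mulVec hf (oneSite_of_notMem_range q _) (oneSite_comp hf q _)]
    rfl
  · refine Finset.sum_congr rfl fun q hq => ?_
    have : 0 < (q : ℕ) ∧ (q : ℕ) + 1 < 7 := by
      revert q
      decide
    rw [sliceAt_localTerm_mulVec hf (cluster_of_notMem_range a h q this.1 this.2)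
      (cluster_comp_shift a h q)]
    rfl

end Slices

theorem exists_sliceAt_ne_zero {κ κ₂ : Type*} (f : κ₂ → κ) {v : (κ → Site) → ℂ} (hv : v ≠ 0) :
    ∃ y, sliceAt f y v ≠ 0 := by
  obtain ⟨y, hy⟩ := Function.ne_iff.1 hv
  refine ⟨y, Function.ne_iff.2 ⟨y ∘ f, ?_⟩⟩
  have : Function.extend f (y ∘ f) y = y := by
    ext1 p
    by_cases hp : ∃ q, f q = p
    · classical
      rw [Function.extend_def, dif_pos hp]
      simp [Classical.choose_spec hp]
    · rw [Function.extend_apply' _ _ _ hp]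
  simpa [sliceAt, this] using hy

section Gap

theorem mem_spectrum_iff_exists_mulVec {ι : Type*} [Fintype ι] [DecidableEq ι]
    {A : Matrix ι ι ℂ} {c : ℂ} : c ∈ spectrum ℂ A ↔ ∃ v, v ≠ 0 ∧ A *ᵥ v = c • v := by
  rw [← Matrix.spectrum_toLin', ← Module.End.hasEigenvalue_iff_mem_spectrum]
  constructor
  · intro h
    obtain ⟨v, hv⟩ := h.exists_hasEigenvector
    exact ⟨v, hv.2, by simpa using hv.apply_eq_smul⟩
  · rintro ⟨v, hv, h⟩
    exact Module.End.hasEigenvalue_of_hasEigenvector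
      (Module.End.hasEigenvector_iff.2 ⟨Module.End.mem_eigenspace_iff.2 (by simpa using h), hv⟩)

theorem specGap_reindex {ι ι' : Type*} [Fintype ι] [DecidableEq ι] [Fintype ι'] [DecidableEq ι']
    (e : ι ≃ ι') (A : Matrix ι ι ℂ) :
    specGap (Matrix.reindexAlgEquiv ℂ ℂ e A) = specGap A := by
  rw [specGap, specGap, AlgEquiv.spectrum_eq]

theorem specGap_le {ι : Type*} [Fintype ι] [DecidableEq ι] {A : Matrix ι ι ℂ} {μ : ℝ}
    (hμ : 0 < μ) {v : ι → ℂ} (hv : v ≠ 0) (h : A *ᵥ v = (μ : ℂ) • v) : specGap A ≤ μ :=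
  csInf_le ⟨0, fun _ hc => hc.1.le⟩ ⟨hμ, mem_spectrum_iff_exists_mulVec.2 ⟨v, hv, h⟩⟩

theorem specGap_le_of_windowHam_mulVec {n : ℕ} (a : ℕ) (h : a + 7 ≤ n) {μ : ℝ} (hμ : 0 < μ)
    {v : (Fin n → Site) → ℂ} (hv : v ≠ 0)
    (hw : windowHam (shift a h) *ᵥ v = (μ : ℂ) • v) :
    specGap (windowHam (id : Fin 7 → Fin 7)) ≤ μ := by
  obtain ⟨y, hy⟩ := exists_sliceAt_ne_zero (shift a h) hv
  refine specGap_le hμ hy ?_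
  rw [← sliceAt_windowHam_mulVec, hw]
  rfl

end Gap

section Kernels

variable {κ : Type*} [Fintype κ] [DecidableEq κ]

theorem twirl_mulVec_apply {a : κ → Matrix (Fin 2) (Fin 2) ℂ} {f : κ → Fin 2 → Fin 2}
    {φ : κ → Fin 2 → ℂ} (ha : ∀ p, IsMono (a p) (f p) (φ p)) (v : (κ → Site) → ℂ)
    (x : κ → Site) :
    8 * (twirl a *ᵥ v) x = 3 * v x
      + (∏ p, φ p (x p).1 * φ p (x p).2.2.1)
        * v (fun p => (f p (x p).1, (x p).2.1, f p (x p).2.2.1, (x p).2.2.2))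
      + (∏ p, φ p (x p).1 * φ p (x p).2.2.2)
        * v (fun p => (f p (x p).1, (x p).2.1, (x p).2.2.1, f p (x p).2.2.2))
      + (∏ p, φ p (x p).2.1 * φ p (x p).2.2.1)
        * v (fun p => ((x p).1, f p (x p).2.1, f p (x p).2.2.1, (x p).2.2.2))
      + (∏ p, φ p (x p).2.1 * φ p (x p).2.2.2)
        * v (fun p => ((x p).1, f p (x p).2.1, (x p).2.2.1, f p (x p).2.2.2))
      - (∏ p, φ p (x p).1 * φ p (x p).2.1)
        * v (fun p => (f p (x p).1, f p (x p).2.1, (x p).2.2.1, (x p).2.2.2))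
      - (∏ p, φ p (x p).2.2.1 * φ p (x p).2.2.2)
        * v (fun p => ((x p).1, (x p).2.1, f p (x p).2.2.1, f p (x p).2.2.2))
      + 3 * ((∏ p, φ p (x p).1 * φ p (x p).2.1 * φ p (x p).2.2.1 * φ p (x p).2.2.2)
        * v (fun p => (f p (x p).1, f p (x p).2.1, f p (x p).2.2.1, f p (x p).2.2.2))) := by
  have h1 := isMono_one
  simp only [twirl, Matrix.smul_mulVec, Matrix.add_mulVec, Matrix.sub_mulVec, Matrix.one_mulVec,
    Pi.smul_apply, Pi.add_apply, Pi.sub_apply, smul_eq_mul,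
    (IsMono.ten fun p => (ha p).tau h1 (ha p) h1).mulVec v x,
    (IsMono.ten fun p => (ha p).tau h1 h1 (ha p)).mulVec v x,
    (IsMono.ten fun p => h1.tau (ha p) (ha p) h1).mulVec v x,
    (IsMono.ten fun p => h1.tau (ha p) h1 (ha p)).mulVec v x,
    (IsMono.ten fun p => (ha p).tau (ha p) h1 h1).mulVec v x,
    (IsMono.ten fun p => h1.tau h1 (ha p) (ha p)).mulVec v x,
    (IsMono.ten fun p => (ha p).tau (ha p) (ha p) (ha p)).mulVec v x,
    id, Pi.one_apply, mul_one, one_mul]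
  ring

/-- A single-site configuration constant on the first pairing only. -/
def siteI : Site := (0, 1, 0, 1)

/-- A single-site configuration constant on the second pairing only. -/
def siteF : Site := (0, 1, 1, 0)

theorem eq_of_twirl_unit {g : (Unit → Site) → ℂ}
    (hX : twirl (fun _ : Unit => pauliX) *ᵥ g = g) (hZ : twirl (fun _ : Unit => pauliZ) *ᵥ g = g)
    (s : Site) :
    g (fun _ => s) = 2 * g (fun _ => siteI) * groundVec 0 s
      + 2 * g (fun _ => siteF) * groundVec 1 s := by
  have hZ' := fun s : Site => twirl_mulVec_apply (fun _ : Unit => isMono_pauliZ) g fun _ => s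
  have hX' := fun s : Site => twirl_mulVec_apply (fun _ : Unit => isMono_pauliX) g fun _ => s
  simp only [hX, hZ, Finset.univ_unique, Finset.prod_singleton, id, Pi.one_apply, mul_one,
    one_mul] at hZ' hX'
  obtain ⟨G, hG⟩ : ∃ G : Site → ℂ, ∀ s, g (fun _ => s) = G s := ⟨_, fun _ => rfl⟩
  simp only [hG] at hZ' hX' ⊢
  have hz : ∀ s : Site, (s.1 + s.2.1 ≠ s.2.2.1 + s.2.2.2) ∨ s.1 = s.2.1 ∧ s.2.2.1 = s.2.2.2
      ∧ s.1 ≠ s.2.2.1 → G s = 0 := by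
    rintro ⟨a, b, c, d⟩ h
    have z := hZ' (a, b, c, d)
    clear hZ' hX'
    fin_cases a <;> fin_cases b <;> fin_cases c <;> fin_cases d <;>
      simp at h z ⊢ <;> first | exact z | linear_combination (1 / 8) * z
  have e0 := hX' (0, 0, 0, 0)
  have e1 := hX' (1, 1, 1, 1)
  have e2 := hX' (0, 1, 0, 1)
  have e3 := hX' (0, 1, 1, 0)
  have e4 := hX' (1, 0, 1, 0)
  have e5 := hX' (1, 0, 0, 1)
  have z1 := hz (0, 0, 1, 1) (by decide)
  have z2 := hz (1, 1, 0, 0) (by decide)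
  clear hZ' hX'
  simp [z1, z2] at e0 e1 e2 e3 e4 e5
  have hA : G (0, 0, 0, 0) = G (0, 1, 0, 1) + G (0, 1, 1, 0) := by grind
  have hB : G (1, 1, 1, 1) = G (0, 1, 0, 1) + G (0, 1, 1, 0) := by grind
  have hc : G (1, 0, 1, 0) = G (0, 1, 0, 1) := by grind
  have hd : G (1, 0, 0, 1) = G (0, 1, 1, 0) := by grind
  clear e0 e1 e2 e3 e4 e5
  obtain ⟨a, b, c, d⟩ := s
  fin_cases a <;> fin_cases b <;> fin_cases c <;> fin_cases d <;>
    simp [siteI, siteF, groundVec, hA, hB, hc, hd] <;>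
    first | (refine hz _ ?_; decide) | ring

theorem eq_of_twirl_oneSite {n : ℕ} (i : Fin n) {v : (Fin n → Site) → ℂ}
    (hX : twirl (oneSite i pauliX) *ᵥ v = v) (hZ : twirl (oneSite i pauliZ) *ᵥ v = v)
    (x : Fin n → Site) :
    v x = 2 * v (Function.update x i siteI) * groundVec 0 (x i)
      + 2 * v (Function.update x i siteF) * groundVec 1 (x i) := by
  have hf : Function.Injective fun _ : Unit => i := fun _ _ _ => rfl
  have hext : ∀ s : Site, Function.extend (fun _ : Unit => i) (fun _ => s) x
      = Function.update x i s := by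
    intro s
    ext1 p
    by_cases hp : p = i
    · subst hp
      rw [Function.update_self]
      exact hf.extend_apply _ _ ()
    · rw [Function.update_of_ne hp, Function.extend_apply']
      rintro ⟨_, h⟩
      exact hp h.symm
  have hcomp : ∀ b, (oneSite i b) ∘ (fun _ : Unit => i) = fun _ => b := by
    intro b
    ext1 p
    simp [oneSite]
  have key : ∀ b, twirl (oneSite i b) *ᵥ v = v → twirl (fun _ : Unit => b)
      *ᵥ sliceAt (fun _ => i) x v = sliceAt (fun _ => i) x v := by
    intro b hb
    rw [← hcomp b, ← sliceAt_twirl_mulVec hf, hb]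
    intro p hp
    exact if_neg fun h => hp ⟨(), h.symm⟩
  have := eq_of_twirl_unit (key _ hX) (key _ hZ) (x i)
  simpa only [sliceAt, hext, Function.update_eq_self] using this

/-- The components of a three-site ground state along the three product ground states. -/
def tripleCoeff (u : (Fin 3 → Site) → ℂ) : Fin 3 → ℂ :=
  ![8 * (u ![siteI, siteI, siteI] + u ![siteI, siteI, siteF]),
    8 * (u ![siteF, siteF, siteF] - u ![siteI, siteI, siteF]), -8 * u ![siteI, siteI, siteF]]

theorem eq_sum_tripleCoeff {u : (Fin 3 → Site) → ℂ}
    (hX : ∀ q, twirl (oneSite q pauliX) *ᵥ u = u) (hZ : ∀ q, twirl (oneSite q pauliZ) *ᵥ u = u)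
    (hC : twirl (cluster (1 : Fin 3)) *ᵥ u = u) (z : Fin 3 → Site) :
    u z = ∑ i, tripleCoeff u i * ∏ q, groundVec i (z q) := by
  obtain ⟨ρ, hρ⟩ : ∃ ρ : Site → Site → Site → ℂ, ∀ z, u z = ρ (z 0) (z 1) (z 2) := by
    refine ⟨fun a b c => u ![a, b, c], fun z => congrArg u ?_⟩
    ext1 q
    fin_cases q <;> rfl
  have h0 : ∀ s t r, ρ s t r
      = 2 * ρ siteI t r * groundVec 0 s + 2 * ρ siteF t r * groundVec 1 s := by
    intro s t r
    simpa [hρ] using eq_of_twirl_oneSite 0 (hX 0) (hZ 0) ![s, t, r]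
  have h1 : ∀ s t r, ρ s t r
      = 2 * ρ s siteI r * groundVec 0 t + 2 * ρ s siteF r * groundVec 1 t := by
    intro s t r
    simpa [hρ] using eq_of_twirl_oneSite 1 (hX 1) (hZ 1) ![s, t, r]
  have h2 : ∀ s t r, ρ s t r
      = 2 * ρ s t siteI * groundVec 0 r + 2 * ρ s t siteF * groundVec 1 r := by
    intro s t r
    simpa [hρ] using eq_of_twirl_oneSite 2 (hX 2) (hZ 2) ![s, t, r]
  have hmono : ∀ p : Fin 3, IsMono (cluster (1 : Fin 3) p) (![id, fun i => 1 - i, id] p)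
      (![![1, -1], 1, ![1, -1]] p) := by
    intro p
    fin_cases p
    exacts [isMono_pauliZ, isMono_pauliX, isMono_pauliZ]
  have hC' := fun s t r : Site => twirl_mulVec_apply hmono u ![s, t, r]
  simp only [hC, hρ, Fin.prod_univ_three] at hC'
  have c1 := hC' siteI siteI siteF
  have c2 := hC' siteF siteI siteI
  have c3 := hC' (0, 0, 0, 0) siteI siteI
  have c4 := hC' (0, 0, 0, 0) siteI siteF
  have c5 := hC' siteI siteI (0, 0, 0, 0)
  have c6 := hC' siteF siteI (0, 0, 0, 0)
  clear hC'
  simp [siteI, siteF] at c1 c2 c3 c4 c5 c6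
  have m1 : ∀ s r, ρ s (1, 1, 1, 1) r = ρ s (0, 1, 0, 1) r + ρ s (0, 1, 1, 0) r := by
    intro s r; rw [h1]; simp [groundVec, siteI, siteF]; ring
  have m2 : ∀ s r, ρ s (0, 0, 0, 0) r = ρ s (0, 1, 0, 1) r + ρ s (0, 1, 1, 0) r := by
    intro s r; rw [h1]; simp [groundVec, siteI, siteF]; ring
  have m3 : ∀ s r, ρ s (1, 1, 0, 0) r = 0 := by
    intro s r; rw [h1]; simp [groundVec]
  have m4 : ∀ s r, ρ s (0, 0, 1, 1) r = 0 := by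
    intro s r; rw [h1]; simp [groundVec]
  have m5 : ∀ s r, ρ s (1, 0, 0, 1) r = ρ s (0, 1, 1, 0) r := by
    intro s r; rw [h1]; simp [groundVec, siteF]; ring
  have m6 : ∀ s r, ρ s (1, 0, 1, 0) r = ρ s (0, 1, 0, 1) r := by
    intro s r; rw [h1]; simp [groundVec, siteI]; ring
  have l0 : ∀ t r, ρ (0, 0, 0, 0) t r = ρ (0, 1, 0, 1) t r + ρ (0, 1, 1, 0) t r := by
    intro t r; rw [h0]; simp [groundVec, siteI, siteF]; ring
  have r0 : ∀ s t, ρ s t (0, 0, 0, 0) = ρ s t (0, 1, 0, 1) + ρ s t (0, 1, 1, 0) := by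
    intro s t; rw [h2]; simp [groundVec, siteI, siteF]; ring
  have eI : ((0, 1, 0, 1) : Site) = siteI := rfl
  have eF : ((0, 1, 1, 0) : Site) = siteF := rfl
  simp only [m1, m2, m3, m4, m5, m6, l0, r0, eI, eF] at c1 c2 c3 c4 c5 c6
  have k1 : ρ siteI siteF siteF = -ρ siteI siteI siteF := by
    linear_combination (1 / 4) * c1
  have k2 : ρ siteF siteF siteI = -ρ siteI siteI siteF := by
    linear_combination (1 / 4) * (c2 - c6 + c4)
  have k3 : ρ siteF siteI siteI = ρ siteI siteI siteF := by
    linear_combination (1 / 4) * (c6 - c4)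
  have k4 : ρ siteI siteF siteI = ρ siteI siteI siteF := by
    linear_combination -(1 / 4) * (c5 + c1)
  have k5 : ρ siteF siteI siteF = -ρ siteI siteI siteF := by
    linear_combination (1 / 4) * c4
  have g2 : ∀ s, groundVec 2 s = groundVec 0 s - groundVec 1 s := fun _ => rfl
  rw [hρ, h0, h1 siteI, h1 siteF, h2 siteI siteI, h2 siteI siteF, h2 siteF siteI, h2 siteF siteF,
    k1, k2, k3, k4, k5]
  simp only [Fin.sum_univ_three, Fin.prod_univ_three, g2, tripleCoeff, hρ]
  simp
  ring

end Kernels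

section Lift

theorem ten_mulVec_prod {κ : Type*} [Fintype κ] [DecidableEq κ] (M : κ → Matrix Site Site ℂ)
    (w : κ → Site → ℂ) :
    ten M *ᵥ (fun z => ∏ q, w q (z q)) = fun z => ∏ q, (M q *ᵥ w q) (z q) := by
  ext1 z
  simp only [Matrix.mulVec, dotProduct, ten, Matrix.of_apply, ← Finset.prod_mul_distrib,
    Finset.prod_univ_sum, Fintype.piFinset_univ]

theorem groundProj_mulVec_self (i : Fin 3) : groundProj i *ᵥ groundVec i = groundVec i := by
  rw [groundProj, Matrix.vecMulVec_mulVec, groundVec_dotProduct_self]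
  simp

theorem extend_comp_self {κ κ₂ α : Type*} {f : κ₂ → κ} (hf : f.Injective) (x : κ → α) :
    Function.extend f (x ∘ f) x = x := by
  ext1 p
  by_cases hp : ∃ q, f q = p
  · obtain ⟨q, rfl⟩ := hp
    rw [hf.extend_apply]
    rfl
  · rw [Function.extend_apply' _ _ _ hp]

theorem sliceAt_extend {κ κ₂ : Type*} {f : κ₂ → κ} (hf : f.Injective) (v : (κ → Site) → ℂ)
    (y : κ → Site) (z : κ₂ → Site) : sliceAt f (Function.extend f z y) v = sliceAt f y v := by
  ext1 w
  rw [sliceAt, sliceAt]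
  congr 1
  ext1 p
  by_cases hp : ∃ q, f q = p
  · obtain ⟨q, rfl⟩ := hp
    rw [hf.extend_apply, hf.extend_apply]
  · rw [Function.extend_apply' _ _ _ hp, Function.extend_apply' _ _ _ hp,
      Function.extend_apply' _ _ _ hp]

theorem apply_eq_of_forall_sliceAt {κ κ₂ : Type*} {f : κ₂ → κ} (hf : f.Injective)
    {v w : (κ → Site) → ℂ}
    (h : ∀ y, sliceAt f y v = sliceAt f y w) : v = w := by
  ext1 x
  have hx := congrFun (h x) (x ∘ f)
  simpa only [sliceAt, extend_comp_self hf] using hx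

theorem blockProj_image_mulVec_eq {κ κ₂ : Type*} [Fintype κ] [DecidableEq κ] [Fintype κ₂]
    [DecidableEq κ₂] {f : κ₂ → κ} (hf : f.Injective) (i : Fin 3) (c : (κ → Site) → ℂ)
    (hc : ∀ y z, c (Function.extend f z y) = c y) :
    blockProj i (univ.image f) *ᵥ (fun x => c x * ∏ q, groundVec i (x (f q)))
      = fun x => c x * ∏ q, groundVec i (x (f q)) := by
  refine apply_eq_of_forall_sliceAt hf fun y => ?_
  have hs : sliceAt f y (fun x => c x * ∏ q, groundVec i (x (f q)))
      = c y • fun z => ∏ q, groundVec i (z q) := by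
    ext1 z
    simp [sliceAt, hc, hf.extend_apply]
  rw [blockProj, sliceAt_ten_mulVec hf, hs, Matrix.mulVec_smul]
  · congr 1
    refine (ten_mulVec_prod _ _).trans ?_
    simp [Function.comp_apply, groundProj_mulVec_self]
  · intro p hp
    refine if_neg fun hp' => hp ?_
    simpa using hp'

end Lift

section Chain

variable {n : ℕ}

theorem half_pow_le {m k : ℕ} (h : m ≤ k) : (1 / 2 : ℝ) ^ k ≤ (1 / 2) ^ m :=
  pow_le_pow_of_le_one (by norm_num) (by norm_num) h

/-- The sites `a, …, b - 1`. -/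
def block (n a b : ℕ) : Finset (Fin n) := univ.filter fun p => a ≤ (p : ℕ) ∧ (p : ℕ) < b

theorem mem_block {a b : ℕ} {p : Fin n} : p ∈ block n a b ↔ a ≤ (p : ℕ) ∧ (p : ℕ) < b := by
  simp [block]

theorem image_shift {m : ℕ} (a : ℕ) (h : a + m ≤ n) :
    univ.image (shift a h) = block n a (a + m) := by
  ext p
  simp only [mem_image, mem_univ, true_and, mem_block]
  constructor
  · rintro ⟨q, rfl⟩
    simp [shift]
  · rintro ⟨h1, h2⟩
    exact ⟨⟨p - a, by omega⟩, Fin.ext (by simp only [shift]; omega)⟩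

theorem card_block {a b : ℕ} (hb : b ≤ n) : (block n a b).card = b - a := by
  rcases le_total b a with h | h
  · rw [Nat.sub_eq_zero_of_le h, Finset.card_eq_zero]
    ext p
    simp only [mem_block, Finset.notMem_empty, iff_false]
    omega
  · obtain ⟨m, rfl⟩ := Nat.exists_eq_add_of_le h
    rw [← image_shift a hb, Finset.card_image_of_injective _ (shift_injective a hb)]
    simp

theorem block_union {a b c : ℕ} (hab : a ≤ b) (hbc : b ≤ c) :
    block n a b ∪ block n b c = block n a c := by
  ext p
  simp only [mem_union, mem_block]
  omega

theorem disjoint_block {a b c d : ℕ} (h : b ≤ c) : Disjoint (block n a b) (block n c d) := by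
  rw [Finset.disjoint_left]
  intro p hp hp'
  rw [mem_block] at hp hp'
  omega

/-- The space of an `n`-site chain with four copies of each qubit. -/
abbrev ChainSpace (n : ℕ) := EuclideanSpace ℂ (Fin n → Site)

/-- The common ground space of the sites `a, …, b - 1`. -/
def blockSpace (n a b : ℕ) : Submodule ℂ (ChainSpace n) := groundSpace blockOp (block n a b)

theorem blockSpace_anti {a b c d : ℕ} (h1 : a ≤ c) (h2 : d ≤ b) :
    blockSpace n a b ≤ blockSpace n c d := by
  refine projFamily_blockOp.groundSpace_anti fun p hp => ?_
  rw [mem_block] at hp ⊢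
  omega

theorem angleLE_blockSpace {a b c d : ℕ} (hab : a ≤ b) (hbc : b ≤ c) (hcd : c ≤ d) (hd : d ≤ n)
    {p q r ε : ℝ} (hX : (1 / 2) ^ (b - a) ≤ p) (hZ : (1 / 2) ^ (d - c) ≤ p)
    (hY : (1 / 2) ^ (c - b) ≤ q) (hr₁ : (1 / 2) ^ (c - a) ≤ r) (hr₂ : (1 / 2) ^ (d - b) ≤ r)
    (hε : (q + 2 * r ^ 2) * (1 + 2 * p) ≤ ε * (1 - 2 * r)) (hr : 0 < 1 - 2 * r) :
    AngleLE (blockSpace n a c) (blockSpace n b d) (blockSpace n a d) ε := by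
  have := projFamily_blockOp.angleLE (disjoint_block (n := n) (a := a) (d := c) le_rfl)
    (disjoint_block (a := a) (d := d) hbc) (disjoint_block (a := b) (d := d) le_rfl) (p := p)
    (q := q) (r := r) (ε := ε)
  rw [block_union hab hbc, block_union hbc hcd, block_union (hab.trans hbc) hcd,
    card_block (by omega), card_block (by omega), card_block (by omega), card_block (by omega),
    card_block (by omega)] at this
  exact this hX hZ hY hr₁ hr₂ hε hr

theorem mem_blockSpace_three {a : ℕ} (h : a + 3 ≤ n) {v : ChainSpace n}
    (hX : ∀ q, twirl (oneSite (shift a h q) pauliX) *ᵥ v.ofLp = v.ofLp)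
    (hZ : ∀ q, twirl (oneSite (shift a h q) pauliZ) *ᵥ v.ofLp = v.ofLp)
    (hC : twirl (cluster (shift a h 1)) *ᵥ v.ofLp = v.ofLp) :
    v ∈ blockSpace n a (a + 3) := by
  have hf := shift_injective a h
  have hdec : ∀ x, v x = ∑ i, tripleCoeff (sliceAt (shift a h) x v.ofLp) i
      * ∏ q, groundVec i (x (shift a h q)) := by
    intro x
    have hs : ∀ (b : Matrix (Fin 2) (Fin 2) ℂ) (q : Fin 3),
        twirl (oneSite (shift a h q) b) *ᵥ v.ofLp = v.ofLp →
        twirl (oneSite q b) *ᵥ sliceAt (shift a h) x v.ofLp = sliceAt (shift a h) x v.ofLp := by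
      intro b q hb
      rw [← oneSite_comp hf, ← sliceAt_twirl_mulVec hf (oneSite_of_notMem_range q b), hb]
    have hc : twirl (cluster 1) *ᵥ sliceAt (shift a h) x v.ofLp
        = sliceAt (shift a h) x v.ofLp := by
      rw [← cluster_comp_shift a h 1, ← sliceAt_twirl_mulVec hf
        (cluster_of_notMem_range a h 1 (by decide) (by decide)), hC]
    have := eq_sum_tripleCoeff (fun q => hs _ q (hX q)) (fun q => hs _ q (hZ q)) hc
      (x ∘ shift a h)
    rwa [sliceAt, extend_comp_self hf] at this
  refine ⟨fun i => WithLp.toLp 2 fun x => tripleCoeff (sliceAt (shift a h) x v.ofLp) i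
    * ∏ q, groundVec i (x (shift a h q)), fun i => ?_, ?_⟩
  · have := blockProj_image_mulVec_eq hf i
      (fun x => tripleCoeff (sliceAt (shift a h) x v.ofLp) i) ?_
    · rw [image_shift] at this
      refine WithLp.ofLp_injective 2 ?_
      rw [blockOp, Matrix.ofLp_toEuclideanCLM]
      exact this
    · intro y z
      simp only [sliceAt_extend hf]
  · ext x
    rw [hdec x]
    simp

theorem mem_blockSpace {a b : ℕ} (hab : a + 3 ≤ b) (hb : b ≤ n) {v : ChainSpace n}
    (hX : ∀ p ∈ block n a b, twirl (oneSite p pauliX) *ᵥ v.ofLp = v.ofLp)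
    (hZ : ∀ p ∈ block n a b, twirl (oneSite p pauliZ) *ᵥ v.ofLp = v.ofLp)
    (hC : ∀ p ∈ block n (a + 1) (b - 1), twirl (cluster p) *ᵥ v.ofLp = v.ofLp) :
    v ∈ blockSpace n a b := by
  have three : ∀ c, a ≤ c → c + 3 ≤ b → v ∈ blockSpace n c (c + 3) := by
    intro c hac hcb
    refine mem_blockSpace_three (by omega) (fun q => hX _ ?_) (fun q => hZ _ ?_) (hC _ ?_)
    all_goals
      simp only [mem_block, shift, Fin.val_one]
      omega
  have key : ∀ m, a + 3 ≤ m → m ≤ b → v ∈ blockSpace n a m := by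
    intro m hm
    induction m, hm using Nat.le_induction with
    | base => exact three a le_rfl
    | succ m hm ih =>
      intro hmb
      obtain ⟨c, rfl⟩ : ∃ c, m = c + 2 := ⟨m - 2, by omega⟩
      have h := angleLE_blockSpace (n := n) (a := a) (b := c) (c := c + 2) (d := c + 3) (by omega)
        (by omega) (by omega) (by omega) (p := 1 / 2) (q := 1 / 4) (r := 1 / 8) (ε := 3 / 4)
        ((half_pow_le (m := 1) (by omega)).trans (by norm_num))
        ((half_pow_le (m := 1) (by omega)).trans (by norm_num))
        ((half_pow_le (m := 2) (by omega)).trans (by norm_num))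
        ((half_pow_le (m := 3) (by omega)).trans (by norm_num))
        ((half_pow_le (m := 3) (by omega)).trans (by norm_num))
        (by norm_num) (by norm_num)
      exact h.inf_le (blockSpace_anti le_rfl (by omega)) (blockSpace_anti (by omega) le_rfl)
        (by norm_num) (by norm_num) ⟨ih (by omega), three c (by omega) (by omega)⟩
  exact key b hab le_rfl

end Chain

section LocalOperators

variable {κ : Type*} [Fintype κ] [DecidableEq κ]

/-- A local term as an operator on the Euclidean space. -/
def localOp (a : κ → Matrix (Fin 2) (Fin 2) ℂ) :
    EuclideanSpace ℂ (κ → Site) →L[ℂ] EuclideanSpace ℂ (κ → Site) :=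
  Matrix.toEuclideanCLM (𝕜 := ℂ) (localTerm a)

theorem localTerm_mul_self {a : κ → Matrix (Fin 2) (Fin 2) ℂ} (ha : ∀ p, IsPauli (a p)) :
    localTerm a * localTerm a = localTerm a := by
  rw [localTerm, sub_mul, mul_sub, mul_sub, twirl_mul_self fun p => (ha p).mul_self]
  simp

theorem localTerm_conjTranspose {a : κ → Matrix (Fin 2) (Fin 2) ℂ} (ha : ∀ p, IsPauli (a p)) :
    (localTerm a)ᴴ = localTerm a := by
  rw [localTerm, Matrix.conjTranspose_sub, Matrix.conjTranspose_one,
    twirl_conjTranspose fun p => (ha p).conjTranspose]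

theorem localOp_symm {a : κ → Matrix (Fin 2) (Fin 2) ℂ} (ha : ∀ p, IsPauli (a p))
    (x y : EuclideanSpace ℂ (κ → Site)) : inner ℂ (localOp a x) y = inner ℂ x (localOp a y) :=
  inner_toEuclideanCLM (localTerm_conjTranspose ha) x y

theorem re_inner_localOp {a : κ → Matrix (Fin 2) (Fin 2) ℂ} (ha : ∀ p, IsPauli (a p))
    (v : EuclideanSpace ℂ (κ → Site)) : (inner ℂ (localOp a v) v).re = ‖localOp a v‖ ^ 2 := by
  have h : localOp a v = localOp a (localOp a v) := by
    rw [localOp, toEuclideanCLM_mul_apply, localTerm_mul_self ha]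
  rw [← re_inner_self]
  conv_lhs => rw [h]
  rw [localOp_symm ha]

theorem norm_localOp_le {a : κ → Matrix (Fin 2) (Fin 2) ℂ} (ha : ∀ p, IsPauli (a p))
    (v : EuclideanSpace ℂ (κ → Site)) : ‖localOp a v‖ ≤ ‖v‖ := by
  have h1 := re_inner_localOp ha v
  have h2 := re_inner_le_norm' (localOp a v) v
  by_contra! h
  nlinarith [norm_nonneg v, norm_nonneg (localOp a v)]

theorem localOp_eq_zero_iff {a : κ → Matrix (Fin 2) (Fin 2) ℂ}
    {v : EuclideanSpace ℂ (κ → Site)} : localOp a v = 0 ↔ twirl a *ᵥ v.ofLp = v.ofLp := by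
  rw [← (WithLp.ofLp_injective 2).eq_iff, localOp, Matrix.ofLp_toEuclideanCLM, localTerm,
    Matrix.sub_mulVec, Matrix.one_mulVec, WithLp.ofLp_zero, sub_eq_zero, eq_comm]

theorem localOp_blockOp_eq_zero {a : κ → Matrix (Fin 2) (Fin 2) ℂ} (ha : ∀ p, IsPauli (a p))
    {W : Finset κ} (hW : ∀ p ∉ W, a p = 1) {i : Fin 3} (hi : i = 2 → ∏ p, (a p).det = -1)
    (v : EuclideanSpace ℂ (κ → Site)) : localOp a (blockOp i W v) = 0 := by
  rw [localOp, blockOp, toEuclideanCLM_mul_apply, localTerm, sub_mul, one_mul,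
    twirl_mul_blockProj ha hW hi, sub_self, map_zero]
  rfl

theorem localOp_eq_zero_of_mem_groundSpace {a : κ → Matrix (Fin 2) (Fin 2) ℂ}
    (ha : ∀ p, IsPauli (a p)) {W : Finset κ} (hW : ∀ p ∉ W, a p = 1)
    (hdet : ∏ p, (a p).det = -1) {v : EuclideanSpace ℂ (κ → Site)}
    (hv : v ∈ groundSpace blockOp W) : localOp a v = 0 := by
  obtain ⟨f, hf, rfl⟩ := hv
  rw [map_sum]
  refine Finset.sum_eq_zero fun i _ => ?_
  rw [← hf i]
  exact localOp_blockOp_eq_zero ha hW (fun _ => hdet) _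

theorem norm_localOp_sq_of_blockOp {a : κ → Matrix (Fin 2) (Fin 2) ℂ} (ha : ∀ p, IsPauli (a p))
    {W : Finset κ} (hW : ∀ p ∉ W, a p = 1) (hdet : ∏ p, (a p).det = 1) {q : κ} (hq : q ∈ W)
    (haq : a q = pauliX ∨ a q = pauliZ) {v : EuclideanSpace ℂ (κ → Site)}
    (hv : blockOp 2 W v = v) : ‖localOp a v‖ ^ 2 = 1 / 2 * ‖v‖ ^ 2 := by
  have h : blockOp 2 W (localOp a (blockOp 2 W v)) = (1 / 2 : ℂ) • v := by
    conv_rhs => rw [← hv]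
    rw [blockOp, localOp, toEuclideanCLM_mul_apply, toEuclideanCLM_mul_apply, localTerm, mul_assoc,
      sub_mul, one_mul, mul_sub, blockProj_mul_self, blockProj_mul_twirl_mul ha hW hdet hq haq]
    rw [show blockProj 2 W - (1 / 2 : ℂ) • blockProj 2 W = (1 / 2 : ℂ) • blockProj 2 W by module,
      map_smul]
    rfl
  have h2 := projFamily_blockOp.symm 2 W (localOp a v) v
  rw [← re_inner_localOp ha, ← hv]
  conv_lhs => rw [← projFamily_blockOp.symm]
  rw [h, hv, inner_smul_left, ← re_inner_self]
  simp

end LocalOperators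

section ChainDet

variable {n : ℕ}

theorem prod_det_oneSite (i : Fin n) (b : Matrix (Fin 2) (Fin 2) ℂ) :
    ∏ p, (oneSite i b p).det = b.det := by
  have : ∀ p, (oneSite i b p).det = if p = i then b.det else 1 := by
    intro p
    unfold oneSite
    split_ifs
    exacts [rfl, Matrix.det_one]
  simp [this]

theorem prod_det_cluster {i j k : Fin n} (hj : (j : ℕ) + 1 = i) (hk : (i : ℕ) + 1 = k) :
    ∏ p, (cluster i p).det = -1 := by
  have : ∀ p, (cluster i p).det = (if p = i then -1 else 1) *
      ((if p = j then -1 else 1) * if p = k then -1 else 1) := by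
    intro p
    unfold cluster
    split_ifs
    all_goals simp only [Fin.ext_iff] at *
    all_goals first | omega | simp [det_pauliX, det_pauliZ]
  simp only [this, Finset.prod_mul_distrib, Finset.prod_ite_eq', mem_univ, if_true]
  norm_num

theorem prod_det_cluster_zero {i k : Fin n} (hi : (i : ℕ) = 0) (hk : (i : ℕ) + 1 = k) :
    ∏ p, (cluster i p).det = 1 := by
  have : ∀ p, (cluster i p).det = (if p = i then -1 else 1) * if p = k then -1 else 1 := by
    intro p
    unfold cluster
    split_ifs
    all_goals simp only [Fin.ext_iff] at *
    all_goals first | omega | simp [det_pauliX, det_pauliZ]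
  simp only [this, Finset.prod_mul_distrib, Finset.prod_ite_eq', mem_univ, if_true]
  norm_num

theorem localOp_oneSite_eq_zero {a b : ℕ} {i : Fin n} (hi : i ∈ block n a b)
    {c : Matrix (Fin 2) (Fin 2) ℂ} (hc : c = pauliX ∨ c = pauliZ) {v : ChainSpace n}
    (hv : v ∈ blockSpace n a b) : localOp (oneSite i c) v = 0 := by
  refine localOp_eq_zero_of_mem_groundSpace (isPauli_oneSite i (Or.inr hc))
    (W := block n a b) (fun p hp => if_neg ?_) ?_ hv
  · rintro rfl
    exact hp hi
  · rw [prod_det_oneSite]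
    rcases hc with rfl | rfl
    exacts [det_pauliX, det_pauliZ]

theorem localOp_cluster_eq_zero {a b : ℕ} (hb : b ≤ n) {i : Fin n}
    (hi : i ∈ block n (a + 1) (b - 1)) {v : ChainSpace n} (hv : v ∈ blockSpace n a b) :
    localOp (cluster i) v = 0 := by
  rw [mem_block] at hi
  refine localOp_eq_zero_of_mem_groundSpace (isPauli_cluster i)
    (W := block n a b) (fun p hp => ?_) ?_ hv
  · rw [mem_block] at hp
    rw [cluster, if_neg (fun h => by rw [Fin.ext_iff] at h; omega), if_neg (by omega)]
  · exact prod_det_cluster (j := ⟨i - 1, by omega⟩) (k := ⟨i + 1, by omega⟩)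
      (by simp only; omega) rfl

end ChainDet

section Energy

variable {n : ℕ}

/-- The bulk energy at site `k`: the single-site terms, and the cluster term unless `k` is the
left end of the chain. -/
def bulkEnergy (v : ChainSpace n) (k : ℕ) : ℝ :=
  if h : k < n then
    ‖localOp (oneSite ⟨k, h⟩ pauliX) v‖ ^ 2 + ‖localOp (oneSite ⟨k, h⟩ pauliZ) v‖ ^ 2
      + if 0 < k then ‖localOp (cluster ⟨k, h⟩) v‖ ^ 2 else 0
  else 0

theorem bulkEnergy_nonneg (v : ChainSpace n) (k : ℕ) : 0 ≤ bulkEnergy v k := by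
  unfold bulkEnergy
  split_ifs <;> positivity

/-- The bulk Hamiltonian of the seven sites starting at `a`, as an operator. -/
def windowOp (a : ℕ) (h : a + 7 ≤ n) : ChainSpace n →L[ℂ] ChainSpace n :=
  Matrix.toEuclideanCLM (𝕜 := ℂ) (windowHam (shift a h))

theorem windowOp_eq (a : ℕ) (h : a + 7 ≤ n) :
    windowOp a h = ∑ q : Fin 7, (localOp (oneSite (shift a h q) pauliX)
      + localOp (oneSite (shift a h q) pauliZ))
      + ∑ q ∈ ({1, 2, 3, 4, 5} : Finset (Fin 7)), localOp (cluster (shift a h q)) := by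
  simp only [windowOp, windowHam, localOp, map_add, map_sum]

theorem windowOp_symm (a : ℕ) (h : a + 7 ≤ n) (x y : ChainSpace n) :
    inner ℂ (windowOp a h x) y = inner ℂ x (windowOp a h y) := by
  simp only [windowOp_eq, _root_.add_apply, _root_.sum_apply, inner_add_left,
    inner_add_right, sum_inner, inner_sum, localOp_symm (isPauli_oneSite _ isPauli_pauliX),
    localOp_symm (isPauli_oneSite _ isPauli_pauliZ), localOp_symm (isPauli_cluster _)]

theorem re_inner_windowOp (a : ℕ) (h : a + 7 ≤ n) (v : ChainSpace n) :
    (inner ℂ (windowOp a h v) v).re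
      = ∑ q : Fin 7, (‖localOp (oneSite (shift a h q) pauliX) v‖ ^ 2
        + ‖localOp (oneSite (shift a h q) pauliZ) v‖ ^ 2)
      + ∑ q ∈ ({1, 2, 3, 4, 5} : Finset (Fin 7)), ‖localOp (cluster (shift a h q)) v‖ ^ 2 := by
  simp only [windowOp_eq, _root_.add_apply, _root_.sum_apply, inner_add_left,
    sum_inner, Complex.add_re, Complex.re_sum, re_inner_localOp (isPauli_oneSite _ isPauli_pauliX),
    re_inner_localOp (isPauli_oneSite _ isPauli_pauliZ), re_inner_localOp (isPauli_cluster _)]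

theorem re_inner_windowOp_nonneg (a : ℕ) (h : a + 7 ≤ n) (v : ChainSpace n) :
    0 ≤ (inner ℂ (windowOp a h v) v).re := by
  rw [re_inner_windowOp]
  positivity

theorem re_inner_windowOp_le (a : ℕ) (h : a + 7 ≤ n) (v : ChainSpace n) :
    (inner ℂ (windowOp a h v) v).re ≤ ∑ k ∈ range 7, bulkEnergy v (a + k) := by
  have key : ∀ q : Fin 7, bulkEnergy v (a + (q : ℕ))
      = ‖localOp (oneSite (shift a h q) pauliX) v‖ ^ 2
        + ‖localOp (oneSite (shift a h q) pauliZ) v‖ ^ 2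
        + if 0 < a + (q : ℕ) then ‖localOp (cluster (shift a h q)) v‖ ^ 2 else 0 :=
    fun q => dif_pos (by omega)
  rw [re_inner_windowOp, ← Fin.sum_univ_eq_sum_range (fun k => bulkEnergy v (a + k))]
  simp only [key]
  rw [Finset.sum_add_distrib (f := fun q : Fin 7 => ‖localOp (oneSite (shift a h q) pauliX) v‖ ^ 2
    + ‖localOp (oneSite (shift a h q) pauliZ) v‖ ^ 2)]
  refine add_le_add le_rfl ?_
  refine le_trans (le_of_eq ?_) (Finset.sum_le_sum_of_subset_of_nonneg
    (subset_univ ({1, 2, 3, 4, 5} : Finset (Fin 7))) fun q _ _ => ?_)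
  · refine Finset.sum_congr rfl fun q hq => (if_pos ?_).symm
    have : (q : ℕ) ≠ 0 := by
      intro h0
      obtain rfl : q = 0 := Fin.ext h0
      exact absurd hq (by decide)
    omega
  · split_ifs <;> positivity

theorem ker_windowOp (a : ℕ) (h : a + 7 ≤ n) :
    LinearMap.ker (windowOp a h).toLinearMap = blockSpace n a (a + 7) := by
  have hblock : ∀ p : Fin n, p ∈ block n a (a + 7) → ∃ q, shift a h q = p := by
    intro p hp
    rw [← image_shift a h] at hp
    simpa using hp
  have hcl : ∀ q ∈ ({1, 2, 3, 4, 5} : Finset (Fin 7)),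
      shift a h q ∈ block n (a + 1) (a + 7 - 1) := by
    intro q hq
    have : 1 ≤ (q : ℕ) ∧ (q : ℕ) ≤ 5 := by revert hq; revert q; decide
    simp only [mem_block, shift]
    omega
  ext v
  rw [LinearMap.mem_ker, ContinuousLinearMap.coe_coe]
  constructor
  · intro hv
    have h0 := re_inner_windowOp a h v
    rw [hv, inner_zero_left, Complex.zero_re, eq_comm, add_eq_zero_iff_of_nonneg (by positivity)
      (by positivity), Finset.sum_eq_zero_iff_of_nonneg (fun _ _ => by positivity),
      Finset.sum_eq_zero_iff_of_nonneg (fun _ _ => by positivity)] at h0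
    have h1 : ∀ q, localOp (oneSite (shift a h q) pauliX) v = 0
        ∧ localOp (oneSite (shift a h q) pauliZ) v = 0 := by
      intro q
      have := h0.1 q (mem_univ q)
      rw [add_eq_zero_iff_of_nonneg (by positivity) (by positivity)] at this
      simpa using this
    refine mem_blockSpace (by omega) h (fun p hp => ?_) (fun p hp => ?_) fun p hp => ?_
    · obtain ⟨q, rfl⟩ := hblock p hp
      exact localOp_eq_zero_iff.1 (h1 q).1
    · obtain ⟨q, rfl⟩ := hblock p hp
      exact localOp_eq_zero_iff.1 (h1 q).2
    · rw [mem_block] at hp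
      obtain ⟨q, rfl⟩ := hblock p (mem_block.2 (by omega))
      have hq : q ∈ ({1, 2, 3, 4, 5} : Finset (Fin 7)) := by
        have : 1 ≤ (q : ℕ) ∧ (q : ℕ) ≤ 5 := by
          simp only [shift] at hp
          omega
        clear hp; revert this; revert q; decide
      simpa [localOp_eq_zero_iff] using h0.2 q hq
  · intro hv
    have hb : ∀ q, shift a h q ∈ block n a (a + 7) := by
      intro q
      rw [← image_shift a h]
      exact Finset.mem_image_of_mem _ (mem_univ q)
    rw [windowOp_eq, _root_.add_apply, _root_.sum_apply,
      _root_.sum_apply, Finset.sum_eq_zero, Finset.sum_eq_zero, add_zero]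
    · exact fun q hq => localOp_cluster_eq_zero h (hcl q hq) hv
    · intro q _
      rw [_root_.add_apply, localOp_oneSite_eq_zero (hb q) (Or.inl rfl) hv,
        localOp_oneSite_eq_zero (hb q) (Or.inr rfl) hv, add_zero]

theorem specGap_mul_perp_sq_le (a : ℕ) (h : a + 7 ≤ n) (v : ChainSpace n) :
    specGap (windowHam (id : Fin 7 → Fin 7)) * ‖perp (blockSpace n a (a + 7)) v‖ ^ 2
      ≤ ∑ k ∈ range 7, bulkEnergy v (a + k) := by
  refine le_trans ?_ (re_inner_windowOp_le a h v)
  rw [← ker_windowOp a h]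
  refine gap_le_re_inner (T := (windowOp a h).toLinearMap) (windowOp_symm a h)
    (re_inner_windowOp_nonneg a h) (fun μ w hμ hw hTw => ?_) v
  refine specGap_le_of_windowHam_mulVec a h hμ (v := w.ofLp)
    (fun h0 => hw (WithLp.ofLp_injective 2 h0)) ?_
  have := congrArg WithLp.ofLp hTw
  rwa [ContinuousLinearMap.coe_coe, windowOp, Matrix.ofLp_toEuclideanCLM] at this

/-- Windows of length seven with stride four cover every site at most twice. -/
theorem sum_windows_le {G : ℕ → ℝ} (hG : ∀ k, 0 ≤ G k) (r q : ℕ) :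
    ∑ j ∈ range (q + 1), ∑ k ∈ range 7, G (r + 4 * j + k)
      ≤ ∑ k ∈ range (r + 4 * q + 4), G k + ∑ k ∈ range (r + 4 * q + 7), G k := by
  have hwin : ∀ a, ∑ k ∈ range 7, G (a + k) = ∑ k ∈ range (a + 7), G k - ∑ k ∈ range a, G k := by
    intro a
    rw [Finset.sum_range_add]
    ring
  have hmono : ∀ a b, a ≤ b → ∑ k ∈ range a, G k ≤ ∑ k ∈ range b, G k := fun a b h =>
    Finset.sum_le_sum_of_subset_of_nonneg (Finset.range_subset_range.2 h) fun k _ _ => hG k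
  induction q with
  | zero =>
    have h1 := hwin r
    have h2 := hmono 0 r (Nat.zero_le r)
    have h3 := hmono 0 (r + 4) (Nat.zero_le _)
    simp only [range_zero, Finset.sum_empty] at h2 h3
    simp only [zero_add, Finset.sum_range_one, mul_zero, add_zero]
    linarith
  | succ q ih =>
    rw [Finset.sum_range_succ, hwin]
    have h := hmono (r + 4 * q + 7) (r + 4 * (q + 1) + 4) (by omega)
    rw [show r + 4 * (q + 1) = r + 4 * q + 4 by ring] at h ⊢
    linarith

end Energy

section Bulk

variable {n : ℕ}

theorem angleLE_first_pair {r : ℕ} (hr : 1 ≤ r) (hr' : r ≤ 3) (hn : r + 7 ≤ n) :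
    AngleLE (blockSpace n 0 7) (blockSpace n r (r + 7)) (blockSpace n 0 (r + 7)) (3 / 20) :=
  angleLE_blockSpace (p := 1 / 2) (q := 1 / 16) (r := 1 / 128) (by omega) (by omega) (by omega) hn
    ((half_pow_le (m := 1) (by omega)).trans (by norm_num))
    ((half_pow_le (m := 1) (by omega)).trans (by norm_num))
    ((half_pow_le (m := 4) (by omega)).trans (by norm_num))
    ((half_pow_le (m := 7) (by omega)).trans (by norm_num))
    ((half_pow_le (m := 7) (by omega)).trans (by norm_num)) (by norm_num) (by norm_num)

theorem angleLE_stride_four {a c : ℕ} (ha : a ≤ c) (hn : c + 11 ≤ n) :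
    AngleLE (blockSpace n a (c + 7)) (blockSpace n (c + 4) (c + 11)) (blockSpace n a (c + 11))
      (3 / 20) :=
  angleLE_blockSpace (p := 1 / 16) (q := 1 / 8) (r := 1 / 128) (by omega) (by omega) (by omega) hn
    ((half_pow_le (m := 4) (by omega)).trans (by norm_num))
    ((half_pow_le (m := 4) (by omega)).trans (by norm_num))
    ((half_pow_le (m := 3) (by omega)).trans (by norm_num))
    ((half_pow_le (m := 7) (by omega)).trans (by norm_num))
    ((half_pow_le (m := 7) (by omega)).trans (by norm_num)) (by norm_num) (by norm_num)

theorem perp_sq_le_first_pair {r : ℕ} (hr : r ≤ 3) (hn : r + 7 ≤ n) (v : ChainSpace n) :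
    17 / 20 * ‖perp (blockSpace n 0 (r + 7)) v‖ ^ 2
      ≤ ‖perp (blockSpace n 0 7) v‖ ^ 2 + ‖perp (blockSpace n r (r + 7)) v‖ ^ 2 := by
  rcases Nat.eq_zero_or_pos r with rfl | hpos
  · rw [zero_add]
    nlinarith [sq_nonneg ‖perp (blockSpace n 0 7) v‖]
  · have := (angleLE_first_pair hpos hr hn).perp_sq_le (blockSpace_anti le_rfl (by omega))
      (blockSpace_anti (by omega) le_rfl) (by norm_num) v
    linarith

/-- The windows of length seven with stride four, the first one being extended to the left end
of the chain. -/
def coverSpace (n r j : ℕ) : Submodule ℂ (ChainSpace n) :=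
  blockSpace n (if j = 0 then 0 else r + 4 * j) (r + 4 * j + 7)

theorem perp_sq_le_sum_coverSpace {r q : ℕ} (hn : r + 4 * q + 7 = n) (v : ChainSpace n) :
    7 / 10 * ‖perp (blockSpace n 0 n) v‖ ^ 2
      ≤ ∑ j ∈ range (q + 1), ‖perp (coverSpace n r j) v‖ ^ 2 := by
  have hstart : ∀ j, (if j = 0 then 0 else r + 4 * j) ≤ r + 4 * j := by
    intro j
    split_ifs <;> omega
  have hsucc : ∀ j, coverSpace n r (j + 1) = blockSpace n (r + 4 * j + 4) (r + 4 * j + 11) := by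
    intro j
    rw [coverSpace, if_neg (by omega)]
    congr 1
  refine perp_sq_le_sum _ _ (by norm_num) _ (fun x hx => ?_) (fun x => ?_) v
  · have key : ∀ m ≤ q, x ∈ blockSpace n 0 (r + 4 * m + 7) := by
      intro m
      induction m with
      | zero => exact fun _ => hx 0 (by simp)
      | succ m ih =>
        intro hm
        exact (angleLE_stride_four (c := r + 4 * m) (Nat.zero_le _) (by omega)).inf_le
          (blockSpace_anti le_rfl (by omega)) (blockSpace_anti (by omega) le_rfl) (by norm_num)
          (by norm_num) ⟨ih (by omega), hsucc m ▸ hx (m + 1) (Finset.mem_range.2 (by omega))⟩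
    simpa only [hn] using key q le_rfl
  · have h := knabe_chain (coverSpace n r) (ε := 3 / 20) x q (fun j hj => ?_)
      (fun i j hij hj => ?_) (by norm_num)
    · have := sq_nonneg ‖perp (coverSpace n r q) x‖
      linarith
    · rw [hsucc]
      exact (angleLE_stride_four (hstart j) (by omega)).neg_le_re_inner
        (blockSpace_anti le_rfl (by omega)) (blockSpace_anti (by have := hstart j; omega) le_rfl)
        (by norm_num) (by norm_num) x
    · refine projFamily_blockOp.re_inner_perp_nonneg (disjoint_block ?_) x
      rw [if_neg (by omega)]
      omega

theorem specGap_nonneg {ι : Type*} [Fintype ι] [DecidableEq ι] (A : Matrix ι ι ℂ) :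
    0 ≤ specGap A :=
  Real.sInf_nonneg fun _ hc => hc.1.le

theorem specGap_mul_perp_sq_le_bulkEnergy (hn : 7 ≤ n) (v : ChainSpace n) :
    119 / 600 * specGap (windowHam (id : Fin 7 → Fin 7)) * ‖perp (blockSpace n 0 n) v‖ ^ 2
      ≤ ∑ k ∈ range n, bulkEnergy v k := by
  obtain ⟨r, q, hr, hrq⟩ : ∃ r q, r ≤ 3 ∧ r + 4 * q + 7 = n :=
    ⟨(n - 7) % 4, (n - 7) / 4, by omega, by omega⟩
  set D := specGap (windowHam (id : Fin 7 → Fin 7)) with hD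
  have hD0 : 0 ≤ D := specGap_nonneg _
  have hmono : ∀ m ≤ n, ∑ k ∈ range m, bulkEnergy v k ≤ ∑ k ∈ range n, bulkEnergy v k :=
    fun m h => Finset.sum_le_sum_of_subset_of_nonneg (Finset.range_subset_range.2 h)
      fun k _ _ => bulkEnergy_nonneg v k
  have hcover := perp_sq_le_sum_coverSpace hrq v
  have hpair := perp_sq_le_first_pair hr (by omega) v
  have hwin : D * ∑ j ∈ range (q + 1), ‖perp (blockSpace n (r + 4 * j) (r + 4 * j + 7)) v‖ ^ 2
      ≤ ∑ k ∈ range (r + 4 * q + 4), bulkEnergy v k + ∑ k ∈ range (r + 4 * q + 7),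
        bulkEnergy v k := by
    refine le_trans ?_ (sum_windows_le (bulkEnergy_nonneg v) r q)
    rw [Finset.mul_sum]
    refine Finset.sum_le_sum fun j hj => specGap_mul_perp_sq_le _ ?_ v
    rw [Finset.mem_range] at hj
    omega
  have hfirst := specGap_mul_perp_sq_le 0 hn v
  simp only [zero_add] at hfirst
  rw [Finset.sum_range_succ'] at hcover hwin
  have hrest : ∑ j ∈ range q, ‖perp (coverSpace n r (j + 1)) v‖ ^ 2
      = ∑ j ∈ range q, ‖perp (blockSpace n (r + 4 * (j + 1)) (r + 4 * (j + 1) + 7)) v‖ ^ 2 :=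
    Finset.sum_congr rfl fun j _ => by rw [coverSpace, if_neg (by omega)]
  rw [hrest] at hcover
  have hzero : coverSpace n r 0 = blockSpace n 0 (r + 7) := by simp [coverSpace]
  rw [hzero] at hcover
  simp only [mul_zero, add_zero] at hwin
  set R := ∑ j ∈ range q, ‖perp (blockSpace n (r + 4 * (j + 1)) (r + 4 * (j + 1) + 7)) v‖ ^ 2
  have hR : 0 ≤ R := by positivity
  have h1 := hmono 7 hn
  have h2 := hmono (r + 4 * q + 4) (by omega)
  have h3 := hmono (r + 4 * q + 7) (by omega)
  have h4 := mul_le_mul_of_nonneg_left hcover hD0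
  have h5 := mul_le_mul_of_nonneg_left hpair hD0
  have h6 := mul_nonneg hD0 hR
  linarith

end Bulk

section TestVector

variable {κ : Type*} [Fintype κ] [DecidableEq κ]

/-- A configuration of the four copies of a qubit on which every ground vector vanishes. -/
def siteN : Site := (0, 0, 1, 1)

theorem groundVec_siteN (i : Fin 3) : groundVec i siteN = 0 := by
  fin_cases i <;> simp [groundVec, siteN]

/-- The factors of the product vector `testVec`. -/
def testFactor (q₀ p : κ) : Site → ℂ := if p = q₀ then Pi.single siteN 1 else groundVec 0

/-- The product vector which is the first ground vector away from `q₀` and orthogonal to every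
ground vector at `q₀`. -/
def testVec (q₀ : κ) : EuclideanSpace ℂ (κ → Site) :=
  WithLp.toLp 2 fun z => ∏ p, testFactor q₀ p (z p)

theorem blockOp_testVec_of_mem {q₀ : κ} {W : Finset κ} (hq : q₀ ∈ W) (i : Fin 3) :
    blockOp i W (testVec q₀) = 0 := by
  refine WithLp.ofLp_injective 2 ?_
  rw [blockOp, Matrix.ofLp_toEuclideanCLM, blockProj, testVec, WithLp.ofLp_toLp, ten_mulVec_prod]
  ext1 z
  refine Finset.prod_eq_zero (mem_univ q₀) ?_
  rw [if_pos hq, testFactor, if_pos rfl, groundProj, Matrix.vecMulVec_mulVec]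
  simp [groundVec_siteN]

theorem blockOp_zero_testVec {q₀ : κ} {W : Finset κ} (hq : q₀ ∉ W) :
    blockOp 0 W (testVec q₀) = testVec q₀ := by
  refine WithLp.ofLp_injective 2 ?_
  rw [blockOp, Matrix.ofLp_toEuclideanCLM, blockProj, testVec, WithLp.ofLp_toLp, ten_mulVec_prod]
  ext1 z
  refine Finset.prod_congr rfl fun p _ => congrFun ?_ (z p)
  split_ifs with hp
  · have hpq : p ≠ q₀ := by
      rintro rfl
      exact hq hp
    rw [testFactor, if_neg hpq, groundProj_mulVec_self]
  · rw [Matrix.one_mulVec]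

theorem testVec_ne_zero (q₀ : κ) : testVec q₀ ≠ 0 := by
  intro h
  have h1 : ∏ p, testFactor q₀ p (if p = q₀ then siteN else siteI) = 0 :=
    congrFun (congrArg WithLp.ofLp h) fun p => if p = q₀ then siteN else siteI
  rw [Finset.prod_eq_zero_iff] at h1
  obtain ⟨p, -, hp⟩ := h1
  by_cases hpq : p = q₀
  · simp [testFactor, hpq] at hp
  · simp [testFactor, hpq, groundVec, siteI] at hp

theorem perp_testVec {q₀ : κ} {W : Finset κ} (hq : q₀ ∈ W) :
    perp (groundSpace blockOp W) (testVec q₀) = testVec q₀ :=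
  perp_of_mem_orthogonal (projFamily_blockOp.mem_orthogonal_of_apply_eq_zero
    fun i => blockOp_testVec_of_mem hq i)

end TestVector

section GapExistence

theorem exists_pos_eigenvector {E : Type*} [NormedAddCommGroup E] [InnerProductSpace ℂ E]
    [FiniteDimensional ℂ E] {T : E →ₗ[ℂ] E} (hT : T.IsSymmetric)
    (hpos : ∀ v, 0 ≤ (inner ℂ (T v) v).re) {v : E} (hv : T v ≠ 0) :
    ∃ μ : ℝ, 0 < μ ∧ ∃ w, w ≠ 0 ∧ T w = (μ : ℂ) • w := by
  by_contra! hne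
  have hperp : 0 < ‖perp (LinearMap.ker T) v‖ ^ 2 := by
    have : perp (LinearMap.ker T) v ≠ 0 := fun h => hv (perp_eq_zero_iff.1 h)
    positivity
  have h := gap_le_re_inner hT hpos
    (c := ((inner ℂ (T v) v).re + 1) / ‖perp (LinearMap.ker T) v‖ ^ 2)
    (fun μ w hμ hw hTw => absurd hTw (hne μ hμ w hw)) v
  rw [div_mul_cancel₀ _ hperp.ne'] at h
  linarith

theorem specGap_mem {ι : Type*} [Fintype ι] [DecidableEq ι] {A : Matrix ι ι ℂ} {μ : ℝ}
    (hμ : 0 < μ) {v : ι → ℂ} (hv : v ≠ 0) (h : A *ᵥ v = (μ : ℂ) • v) :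
    0 < specGap A ∧ (specGap A : ℂ) ∈ spectrum ℂ A := by
  have hfin : {c : ℝ | 0 < c ∧ (c : ℂ) ∈ spectrum ℂ A}.Finite :=
    (A.finite_spectrum.preimage (Complex.ofReal_injective.injOn)).subset fun c hc => hc.2
  have hne : {c : ℝ | 0 < c ∧ (c : ℂ) ∈ spectrum ℂ A}.Nonempty :=
    ⟨μ, hμ, mem_spectrum_iff_exists_mulVec.2 ⟨v, hv, h⟩⟩
  exact hne.csInf_mem hfin

theorem windowHam_shift_zero : windowHam (shift 0 le_rfl) = windowHam (id : Fin 7 → Fin 7) := by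
  congr 1
  ext q
  simp [shift]

theorem specGap_windowHam_shift_pos {n : ℕ} (a : ℕ) (h : a + 7 ≤ n) :
    0 < specGap (windowHam (shift a h)) := by
  have hq : shift a h 0 ∈ block n a (a + 7) := by simp [mem_block, shift]
  have hv : windowOp a h (testVec (shift a h 0)) ≠ 0 := by
    intro h0
    have hmem : testVec (shift a h 0) ∈ blockSpace n a (a + 7) := by
      rw [← ker_windowOp a h]
      exact h0
    exact testVec_ne_zero _ ((perp_testVec hq).symm.trans (perp_eq_zero_iff.2 hmem))
  obtain ⟨μ, hμ, w, hw, hTw⟩ := exists_pos_eigenvector (T := (windowOp a h).toLinearMap)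
    (windowOp_symm a h) (re_inner_windowOp_nonneg a h) hv
  refine (specGap_mem hμ (v := w.ofLp) (fun h0 => hw (WithLp.ofLp_injective 2 h0)) ?_).1
  have := congrArg WithLp.ofLp hTw
  rwa [ContinuousLinearMap.coe_coe, windowOp, Matrix.ofLp_toEuclideanCLM] at this

theorem specGap_windowHam_pos : 0 < specGap (windowHam (id : Fin 7 → Fin 7)) :=
  windowHam_shift_zero ▸ specGap_windowHam_shift_pos 0 le_rfl

theorem bulkEnergy_testVec_eq_zero {k : ℕ} (hk : k < 5) :
    bulkEnergy (testVec (6 : Fin 7)) k = 0 := by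
  have h6 : (6 : Fin 7) ∉ block 7 0 6 := by decide
  have hmem : testVec (6 : Fin 7) ∈ blockSpace 7 0 6 :=
    mem_groundSpace_of_eq (blockOp_zero_testVec h6)
  have hkb : (⟨k, by omega⟩ : Fin 7) ∈ block 7 0 6 := by simp only [mem_block]; omega
  rw [bulkEnergy, dif_pos (by omega), localOp_oneSite_eq_zero hkb (Or.inl rfl) hmem,
    localOp_oneSite_eq_zero hkb (Or.inr rfl) hmem]
  split_ifs with h
  · rw [localOp_cluster_eq_zero (by omega) _ hmem]
    · simp
    · simp only [mem_block]
      omega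
  · simp

theorem specGap_windowHam_le : specGap (windowHam (id : Fin 7 → Fin 7)) ≤ 4 := by
  have h := specGap_mul_perp_sq_le 0 le_rfl (testVec (6 : Fin 7))
  have h6 : (6 : Fin 7) ∉ block 7 0 6 := by decide
  have hmem : testVec (6 : Fin 7) ∈ blockSpace 7 0 6 :=
    mem_groundSpace_of_eq (blockOp_zero_testVec h6)
  have h5 : (5 : Fin 7) ∈ block 7 0 6 := by decide
  rw [blockSpace, perp_testVec (by decide)] at h
  simp only [Finset.sum_range_succ, range_zero, Finset.sum_empty, zero_add,
    bulkEnergy_testVec_eq_zero (show 0 < 5 by norm_num),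
    bulkEnergy_testVec_eq_zero (show 1 < 5 by norm_num),
    bulkEnergy_testVec_eq_zero (show 2 < 5 by norm_num),
    bulkEnergy_testVec_eq_zero (show 3 < 5 by norm_num),
    bulkEnergy_testVec_eq_zero (show 4 < 5 by norm_num)] at h
  have e5 : bulkEnergy (testVec (6 : Fin 7)) 5
      = ‖localOp (oneSite (5 : Fin 7) pauliX) (testVec 6)‖ ^ 2
        + ‖localOp (oneSite (5 : Fin 7) pauliZ) (testVec 6)‖ ^ 2
        + ‖localOp (cluster (5 : Fin 7)) (testVec 6)‖ ^ 2 := rfl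
  have e6 : bulkEnergy (testVec (6 : Fin 7)) 6
      = ‖localOp (oneSite (6 : Fin 7) pauliX) (testVec 6)‖ ^ 2
        + ‖localOp (oneSite (6 : Fin 7) pauliZ) (testVec 6)‖ ^ 2
        + ‖localOp (cluster (6 : Fin 7)) (testVec 6)‖ ^ 2 := rfl
  rw [e5, e6, localOp_oneSite_eq_zero h5 (Or.inl rfl) hmem,
    localOp_oneSite_eq_zero h5 (Or.inr rfl) hmem, norm_zero] at h
  have hsq : ∀ a : Fin 7 → Matrix (Fin 2) (Fin 2) ℂ, (∀ p, IsPauli (a p)) →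
      ‖localOp a (testVec 6)‖ ^ 2 ≤ ‖testVec (6 : Fin 7)‖ ^ 2 := fun a ha =>
    pow_le_pow_left₀ (norm_nonneg _) (norm_localOp_le ha _) 2
  have h1 := hsq _ (isPauli_cluster 5)
  have h2 := hsq _ (isPauli_cluster 6)
  have h3 := hsq _ (isPauli_oneSite 6 isPauli_pauliX)
  have h4 := hsq _ (isPauli_oneSite 6 isPauli_pauliZ)
  have hpos : 0 < ‖testVec (6 : Fin 7)‖ ^ 2 := by
    have := testVec_ne_zero (6 : Fin 7)
    positivity
  refine le_of_mul_le_mul_right ?_ hpos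
  linarith

end GapExistence

section FullChain

variable {n : ℕ}

/-- The Hamiltonian of the whole chain, with the tensor factors sorted by site. -/
def chainHam (n : ℕ) : Matrix (Fin n → Site) (Fin n → Site) ℂ :=
  (∑ i : Fin n, localTerm (oneSite i pauliX)) + (∑ i : Fin n, localTerm (oneSite i pauliZ))
    + ∑ i : Fin n, localTerm (cluster i)

/-- The Hamiltonian of the whole chain, as an operator. -/
def chainOp (n : ℕ) : ChainSpace n →L[ℂ] ChainSpace n :=
  Matrix.toEuclideanCLM (𝕜 := ℂ) (chainHam n)

theorem chainOp_apply (v : ChainSpace n) :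
    chainOp n v = (∑ i : Fin n, localOp (oneSite i pauliX) v)
      + (∑ i : Fin n, localOp (oneSite i pauliZ) v) + ∑ i : Fin n, localOp (cluster i) v := by
  simp only [chainOp, chainHam, localOp, map_add, map_sum, _root_.add_apply, _root_.sum_apply]

theorem chainOp_symm (x y : ChainSpace n) :
    inner ℂ (chainOp n x) y = inner ℂ x (chainOp n y) := by
  simp only [chainOp_apply, inner_add_left, inner_add_right, sum_inner, inner_sum,
    localOp_symm (isPauli_oneSite _ isPauli_pauliX),
    localOp_symm (isPauli_oneSite _ isPauli_pauliZ), localOp_symm (isPauli_cluster _)]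

theorem re_inner_chainOp (hn : 0 < n) (v : ChainSpace n) :
    (inner ℂ (chainOp n v) v).re
      = ∑ k ∈ range n, bulkEnergy v k + ‖localOp (cluster ⟨0, hn⟩) v‖ ^ 2 := by
  have key : ∀ i : Fin n, bulkEnergy v i = ‖localOp (oneSite i pauliX) v‖ ^ 2
      + ‖localOp (oneSite i pauliZ) v‖ ^ 2
      + (‖localOp (cluster i) v‖ ^ 2
        - if i = ⟨0, hn⟩ then ‖localOp (cluster i) v‖ ^ 2 else 0) := by
    intro i
    rw [bulkEnergy, dif_pos i.isLt]
    by_cases hi : (i : ℕ) = 0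
    · rw [if_neg (by omega), if_pos (Fin.ext hi), sub_self]
    · rw [if_pos (by omega), if_neg (fun h => hi (congrArg Fin.val h)), sub_zero]
  rw [← Fin.sum_univ_eq_sum_range (fun k => bulkEnergy v k)]
  simp only [key, chainOp_apply, inner_add_left, sum_inner, Complex.add_re, Complex.re_sum,
    re_inner_localOp (isPauli_oneSite _ isPauli_pauliX),
    re_inner_localOp (isPauli_oneSite _ isPauli_pauliZ), re_inner_localOp (isPauli_cluster _),
    Finset.sum_add_distrib, Finset.sum_sub_distrib, Finset.sum_ite_eq', mem_univ, if_true]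
  ring

theorem re_inner_chainOp_nonneg (hn : 0 < n) (v : ChainSpace n) :
    0 ≤ (inner ℂ (chainOp n v) v).re := by
  rw [re_inner_chainOp hn]
  have := Finset.sum_nonneg fun k (_ : k ∈ range n) => bulkEnergy_nonneg v k
  positivity

theorem block_zero_self : block n 0 n = univ := by
  ext p
  simp [mem_block]

theorem chainOp_blockOp {i : Fin 3} (hi : i ≠ 2) (v : ChainSpace n) :
    chainOp n (blockOp i univ v) = 0 := by
  have h : ∀ a : Fin n → Matrix (Fin 2) (Fin 2) ℂ, (∀ p, IsPauli (a p)) →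
      localOp a (blockOp i univ v) = 0 := fun a ha =>
    localOp_blockOp_eq_zero ha (fun p hp => absurd (mem_univ p) hp) (fun h => absurd h hi) v
  rw [chainOp_apply, Finset.sum_eq_zero fun k _ => h _ (isPauli_oneSite k isPauli_pauliX),
    Finset.sum_eq_zero fun k _ => h _ (isPauli_oneSite k isPauli_pauliZ),
    Finset.sum_eq_zero fun k _ => h _ (isPauli_cluster k), add_zero, add_zero]

theorem blockOp_eigenvector {i : Fin 3} (hi : i ≠ 2) {μ : ℝ} (hμ : 0 < μ) {v : ChainSpace n}
    (hv : chainOp n v = (μ : ℂ) • v) : blockOp i univ v = 0 := by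
  have h1 := chainOp_symm (blockOp i univ v) v
  rw [chainOp_blockOp hi, hv, inner_zero_left, inner_smul_right, zero_eq_mul] at h1
  have h2 : inner ℂ (blockOp i univ v) v = 0 :=
    h1.resolve_left (Complex.ofReal_ne_zero.2 hμ.ne')
  have h3 := re_inner_self (blockOp i univ v)
  rw [projFamily_blockOp.symm, projFamily_blockOp.idem, ← projFamily_blockOp.symm, h2,
    Complex.zero_re] at h3
  exact norm_eq_zero.1 (pow_eq_zero_iff two_ne_zero |>.1 h3.symm)

/-- The boundary term is bounded below on the ground states of the bulk orthogonal to the first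
two ground states. -/
theorem norm_le_norm_localOp_cluster_zero (hn : 7 ≤ n) {g : ChainSpace n}
    (hg : g ∈ blockSpace n 0 n) (h0 : blockOp 0 univ g = 0) (h1 : blockOp 1 univ g = 0) :
    69 / 100 * ‖g‖ ≤ ‖localOp (cluster (⟨0, by omega⟩ : Fin n)) g‖ := by
  obtain ⟨f, hf, rfl⟩ := hg
  rw [block_zero_self] at hf
  rw [Fin.sum_univ_three] at h0 h1 ⊢
  set e : Fin n := ⟨0, by omega⟩
  have hsmall : ∀ i j, i ≠ j → ‖blockOp i univ (f j)‖ ≤ 1 / 128 * ‖f j‖ := by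
    intro i j hij
    have h := projFamily_blockOp.small i j univ hij (f j)
    rw [hf, Finset.card_univ, Fintype.card_fin] at h
    refine h.trans (mul_le_mul_of_nonneg_right ?_ (norm_nonneg _))
    exact (half_pow_le hn).trans (by norm_num)
  have hE : ∀ i, i ≠ 2 → localOp (cluster e) (f i) = 0 := by
    intro i hi
    rw [← hf i]
    exact localOp_blockOp_eq_zero (isPauli_cluster e) (fun p hp => absurd (mem_univ p) hp)
      (fun h => absurd h hi) _
  have hhalf : ‖localOp (cluster e) (f 2)‖ ^ 2 = 1 / 2 * ‖f 2‖ ^ 2 :=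
    norm_localOp_sq_of_blockOp (isPauli_cluster e) (fun p hp => absurd (mem_univ p) hp)
      (prod_det_cluster_zero (k := ⟨1, by omega⟩) rfl rfl) (mem_univ e)
      (Or.inl (if_pos rfl)) (hf 2)
  have b0 : ‖f 0‖ ≤ 1 / 128 * ‖f 1‖ + 1 / 128 * ‖f 2‖ := by
    rw [map_add, map_add, hf 0, add_assoc] at h0
    rw [eq_neg_of_add_eq_zero_left h0, norm_neg]
    exact (norm_add_le _ _).trans (add_le_add (hsmall 0 1 (by decide)) (hsmall 0 2 (by decide)))
  have b1 : ‖f 1‖ ≤ 1 / 128 * ‖f 0‖ + 1 / 128 * ‖f 2‖ := by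
    rw [map_add, map_add, hf 1, add_comm (blockOp 1 univ (f 0)), add_assoc] at h1
    rw [eq_neg_of_add_eq_zero_left h1, norm_neg]
    exact (norm_add_le _ _).trans (add_le_add (hsmall 1 0 (by decide)) (hsmall 1 2 (by decide)))
  have hle : ‖f 0 + f 1 + f 2‖ ≤ 129 / 127 * ‖f 2‖ := by
    have h := norm_add₃_le (a := f 0) (b := f 1) (c := f 2)
    linarith
  rw [map_add, map_add, hE 0 (by decide), hE 1 (by decide), zero_add, zero_add]
  refine le_of_sq_le_sq ?_ (norm_nonneg _)
  have h := pow_le_pow_left₀ (norm_nonneg _) hle 2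
  rw [hhalf]
  nlinarith [sq_nonneg ‖f 2‖]

theorem specGap_windowHam_div_le_eigenvalue (hn : 7 ≤ n) {μ : ℝ} (hμ : 0 < μ)
    {v : ChainSpace n} (hv0 : v ≠ 0) (hv : chainOp n v = (μ : ℂ) • v) :
    specGap (windowHam (id : Fin 7 → Fin 7)) / 32 ≤ μ := by
  set D := specGap (windowHam (id : Fin 7 → Fin 7))
  have hD0 : 0 ≤ D := specGap_nonneg _
  have hD4 : D ≤ 4 := specGap_windowHam_le
  have hn0 : 0 < n := by omega
  set E := localOp (cluster (⟨0, hn0⟩ : Fin n))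
  set w := perp (blockSpace n 0 n) v with hw
  set g := (blockSpace n 0 n).starProjection v with hg
  have hgw : v = g + w := by rw [hw, perp, ← hg]; abel
  have hgE : 69 / 100 * ‖g‖ ≤ ‖E g‖ := by
    have hQ : ∀ i : Fin 3, i ≠ 2 → blockOp i univ g = 0 := by
      intro i hi
      have h1 := blockOp_eigenvector hi hμ hv
      have h2 := projFamily_blockOp.apply_eq_zero_of_orthogonal (perp_mem (blockSpace n 0 n) v) i
      rw [block_zero_self, ← hw] at h2
      rwa [hgw, map_add, h2, add_zero] at h1
    exact norm_le_norm_localOp_cluster_zero hn (Submodule.starProjection_apply_mem _ _)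
      (hQ 0 (by decide)) (hQ 1 (by decide))
  have hEv : ‖E g‖ ≤ ‖w‖ + ‖E v‖ := by
    have h1 : E g = E v - E w := by rw [hgw, map_add]; abel
    have h2 : ‖E w‖ ≤ ‖w‖ := norm_localOp_le (isPauli_cluster _) w
    rw [h1]
    linarith [norm_sub_le (E v) (E w)]
  have hpyth : ‖v‖ ^ 2 = ‖g‖ ^ 2 + ‖w‖ ^ 2 := by
    have h : inner ℂ g w = 0 :=
      perp_mem (blockSpace n 0 n) v g (Submodule.starProjection_apply_mem _ _)
    rw [hgw, norm_add_sq_re, h]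
    simp
  have henergy : 119 / 600 * D * ‖w‖ ^ 2 + ‖E v‖ ^ 2 ≤ μ * ‖v‖ ^ 2 := by
    have h1 := re_inner_chainOp hn0 v
    rw [hv, inner_smul_left, Complex.conj_ofReal, Complex.re_ofReal_mul, re_inner_self] at h1
    rw [h1]
    exact add_le_add (specGap_mul_perp_sq_le_bulkEnergy hn v) le_rfl
  have hvpos : 0 < ‖v‖ ^ 2 := by positivity
  have hsq : (69 / 100 * ‖g‖) ^ 2 ≤ 5 / 2 * ‖w‖ ^ 2 + 5 / 3 * ‖E v‖ ^ 2 := by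
    have h1 := pow_le_pow_left₀ (by positivity) (hgE.trans hEv) 2
    nlinarith [sq_nonneg (3 * ‖w‖ - 2 * ‖E v‖)]
  refine le_of_mul_le_mul_right ?_ hvpos
  refine le_trans ?_ henergy
  have h1 := mul_le_mul_of_nonneg_left hsq hD0
  have h2 := mul_le_mul_of_nonneg_right hD4 (sq_nonneg ‖E v‖)
  have h3 := mul_nonneg hD0 (sq_nonneg ‖w‖)
  have h4 := sq_nonneg ‖E v‖
  rw [hpyth]
  nlinarith

theorem specGap_windowHam_div_le (hn : 7 ≤ n) :
    specGap (windowHam (id : Fin 7 → Fin 7)) / 32 ≤ specGap (chainHam n) := by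
  have hn0 : 0 < n := by omega
  have hne : chainOp n (testVec (⟨0, hn0⟩ : Fin n)) ≠ 0 := by
    intro h
    have h1 := specGap_mul_perp_sq_le_bulkEnergy hn (testVec (⟨0, hn0⟩ : Fin n))
    have h2 := re_inner_chainOp hn0 (testVec (⟨0, hn0⟩ : Fin n))
    have h3 := testVec_ne_zero (⟨0, hn0⟩ : Fin n)
    have hD := specGap_windowHam_pos
    rw [blockSpace, block_zero_self, perp_testVec (mem_univ _)] at h1
    rw [h, inner_zero_left, Complex.zero_re] at h2
    have h4 : 0 < 119 / 600 * specGap (windowHam (id : Fin 7 → Fin 7))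
        * ‖testVec (⟨0, hn0⟩ : Fin n)‖ ^ 2 := by positivity
    have h5 := sq_nonneg ‖localOp (cluster ⟨0, hn0⟩) (testVec (⟨0, hn0⟩ : Fin n))‖
    linarith
  obtain ⟨μ, hμ, w, hw, hTw⟩ := exists_pos_eigenvector (T := (chainOp n).toLinearMap)
    chainOp_symm (re_inner_chainOp_nonneg hn0) hne
  have hspec : chainHam n *ᵥ w.ofLp = (μ : ℂ) • w.ofLp := by
    have := congrArg WithLp.ofLp hTw
    rwa [ContinuousLinearMap.coe_coe, chainOp, Matrix.ofLp_toEuclideanCLM] at this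
  refine le_csInf ⟨μ, hμ, mem_spectrum_iff_exists_mulVec.2
    ⟨w.ofLp, fun h0 => hw (WithLp.ofLp_injective 2 h0), hspec⟩⟩ ?_
  rintro c ⟨hc, hcs⟩
  obtain ⟨u, hu, hcu⟩ := mem_spectrum_iff_exists_mulVec.1 hcs
  refine specGap_windowHam_div_le_eigenvalue hn hc (v := WithLp.toLp 2 u)
    (fun h => hu (congrArg WithLp.ofLp h)) (WithLp.ofLp_injective 2 ?_)
  rw [chainOp, Matrix.ofLp_toEuclideanCLM]
  exact hcu

end FullChain

/-- **Uniform lower bound on the spectral gaps:** `Δ(H^B_7) > 0` and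
`Δ(H_n) ≥ Δ(H^B_7)/32` for all `n ≥ 8`; in particular the gaps `Δ(H_n)` are bounded
below by a positive constant independent of `n`. -/
theorem spectral_gap_lower_bound :
    0 < specGap (HhamB 7 (by norm_num)) ∧
    ∀ n : ℕ, 8 ≤ n → specGap (HhamB 7 (by norm_num)) / 32 ≤ specGap (Hham n) := by
  have hB : specGap (HhamB 7 (by norm_num)) = specGap (windowHam (id : Fin 7 → Fin 7)) := by
    rw [← specGap_reindex (siteEquiv 7), reindex_HhamB]
  rw [hB]
  refine ⟨specGap_windowHam_pos, fun n hn => ?_⟩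
  rw [← specGap_reindex (siteEquiv n), reindex_Hham]
  exact specGap_windowHam_div_le (by omega)
end
end

section
/- For every k ≥ 2, let G^B_k be the orthogonal projection of (ℂ^{16})^{⊗k} onto span{ψ_0^{⊗k}, ψ_1^{⊗k}, ψ_φ^{⊗k}} and G^L_k the orthogonal projection onto span{ψ_0^{⊗k}, ψ_1^{⊗k}}. Then ‖Σ_{σ∈{0,1,φ}} (ψ_σψ_σ^†)^{⊗k} − G^B_k‖ ≤ √6/2^k and ‖Σ_{σ∈{0,1}} (ψ_σψ_σ^†)^{⊗k} − G^L_k‖ ≤ √2/2^k, where ‖·‖ is the operator (spectral) norm and ψ_σψ_σ^† denotes the rank-one projector onto ψ_σ. -/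
open MeasureTheory Matrix Finset
open scoped Real ComplexConjugate ComplexOrder

noncomputable section

/-- The operator (spectral) norm of a complex matrix, i.e. the norm of the induced
linear map between Euclidean spaces. -/
def opNorm {m n : Type*} [Fintype m] [Fintype n] [DecidableEq n] (A : Matrix m n ℂ) : ℝ :=
  ‖LinearMap.toContinuousLinearMap (Matrix.toEuclideanLin A)‖

/-- `ψ₀ = ½(|0000⟩+|0101⟩+|1010⟩+|1111⟩)` in `(ℂ²)^{⊗4}`. -/
def psi0 : (Fin 4 → Fin 2) → ℂ :=
  fun b => if b 0 = b 2 ∧ b 1 = b 3 then (1 / 2 : ℂ) else 0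
/-- `ψ₁ = ½(|0000⟩+|0110⟩+|1001⟩+|1111⟩)` in `(ℂ²)^{⊗4}`. -/
def psi1 : (Fin 4 → Fin 2) → ℂ :=
  fun b => if b 0 = b 3 ∧ b 1 = b 2 then (1 / 2 : ℂ) else 0
/-- `ψ_φ = ψ₀ - ψ₁`. -/
def psiphi : (Fin 4 → Fin 2) → ℂ := psi0 - psi1

/-- The tensor power `ψ^{⊗k}` of a vector in `ℂ¹⁶ = (ℂ²)^{⊗4}`. -/
def tpowVec (k : ℕ) (ψ : (Fin 4 → Fin 2) → ℂ) : (Fin k → (Fin 4 → Fin 2)) → ℂ :=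
  fun f => ∏ i, ψ (f i)

/-- The `k`-fold tensor power `(ψψ^†)^{⊗k}` of the rank-one projector onto `ψ`. -/
def rankOnePow (k : ℕ) (ψ : (Fin 4 → Fin 2) → ℂ) :
    Matrix (Fin k → (Fin 4 → Fin 2)) (Fin k → (Fin 4 → Fin 2)) ℂ :=
  Matrix.of fun x y => (∏ i, ψ (x i)) * conj (∏ i, ψ (y i))

open scoped Matrix.Norms.L2Operator in
/-- The operator norm of a Hermitian matrix is at most any bound on its spectrum. -/
lemma opNorm_le_of_spectrum {n : Type*} [Fintype n] [DecidableEq n] {A : Matrix n n ℂ}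
    (hA : A.IsHermitian) {r : ℝ} (hr : 0 ≤ r) (h : ∀ z ∈ spectrum ℂ A, ‖z‖ ≤ r) :
    opNorm A ≤ r := by
  lift r to NNReal using hr
  have hs : IsSelfAdjoint A := hA
  have hrad := hs.spectralRadius_eq_nnnorm
  have hle : spectralRadius ℂ A ≤ r :=
    iSup₂_le fun z hz => ENNReal.coe_le_coe.mpr (h z hz)
  rw [hrad, ENNReal.coe_le_coe] at hle
  exact hle

/-- If the Gram matrix of `v` differs from the identity by at most `r` in absolute row sums, then
the sum of the rank-one operators of `v` differs from the orthogonal projection onto the span of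
`v` by at most `r` in operator norm. -/
lemma opNorm_sum_vecMulVec_sub_le {n ι : Type*} [Fintype n] [DecidableEq n] [Fintype ι]
    [DecidableEq ι] (v : ι → n → ℂ) {P : Matrix n n ℂ} (hidem : P * P = P) (hherm : Pᴴ = P)
    (hrange : ∀ x, P *ᵥ x = x ↔ x ∈ Submodule.span ℂ (Set.range v)) {r : ℝ} (hr : 0 ≤ r)
    (hgram : ∀ i, ∑ j, ‖star (v i) ⬝ᵥ v j - if i = j then 1 else 0‖ ≤ r) :
    opNorm (∑ i, vecMulVec (v i) (star (v i)) - P) ≤ r := by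
  have hS : (∑ i, vecMulVec (v i) (star (v i)))ᴴ = ∑ i, vecMulVec (v i) (star (v i)) := by
    simp [conjTranspose_sum, conjTranspose_vecMulVec]
  refine opNorm_le_of_spectrum (by rw [IsHermitian, conjTranspose_sub, hS, hherm]) hr ?_
  intro z hz
  rw [← Matrix.spectrum_toLin', ← Module.End.hasEigenvalue_iff_mem_spectrum] at hz
  obtain ⟨x, hx⟩ := hz.exists_hasEigenvector
  have hx0 := hx.2
  have hzx : (∑ i, vecMulVec (v i) (star (v i)) - P) *ᵥ x = z • x := by
    rw [← toLin'_apply, hx.apply_eq_smul]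
  have hSx : (∑ i, vecMulVec (v i) (star (v i))) *ᵥ x = ∑ i, (star (v i) ⬝ᵥ x) • v i := by
    rw [Matrix.sum_mulVec]
    refine Finset.sum_congr rfl fun i _ => ?_
    rw [vecMulVec_mulVec]
    simp
  rw [Matrix.sub_mulVec, hSx] at hzx
  have hPl (y : n → ℂ) : star y ⬝ᵥ (P *ᵥ x) = star (P *ᵥ y) ⬝ᵥ x := by
    rw [star_mulVec, hherm, dotProduct_mulVec]
  have hPv (i : ι) : P *ᵥ v i = v i := (hrange _).2 (Submodule.subset_span ⟨i, rfl⟩)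
  by_cases hc : ∀ i, star (v i) ⬝ᵥ x = 0
  · have hspan : P *ᵥ x ∈ Submodule.span ℂ (Set.range v) :=
      (hrange _).1 (by rw [mulVec_mulVec, hidem])
    have horth : ∀ y ∈ Submodule.span ℂ (Set.range v), star y ⬝ᵥ x = 0 := by
      intro y hy
      induction hy using Submodule.span_induction with
      | mem y hy => obtain ⟨i, rfl⟩ := hy; exact hc i
      | zero => simp
      | add a b _ _ ha hb => rw [star_add, add_dotProduct, ha, hb, add_zero]
      | smul a b _ hb => rw [star_smul, smul_dotProduct, hb, smul_zero]
    have hPx : P *ᵥ x = 0 := by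
      rw [← dotProduct_star_self_eq_zero, hPl, mulVec_mulVec, hidem]
      exact horth _ hspan
    have hz0 : z = 0 := by
      simpa [hc, hPx, hx0, eq_comm] using hzx
    simpa [hz0] using hr
  · push Not at hc
    obtain ⟨i₀, hi₀⟩ := hc
    obtain ⟨i, -, hi⟩ := Finset.exists_max_image Finset.univ (fun i => ‖star (v i) ⬝ᵥ x‖)
      ⟨i₀, Finset.mem_univ _⟩
    have hpos : 0 < ‖star (v i) ⬝ᵥ x‖ :=
      (norm_pos_iff.2 hi₀).trans_le (hi i₀ (Finset.mem_univ _))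
    have key : z * (star (v i) ⬝ᵥ x) =
        ∑ j, (star (v i) ⬝ᵥ v j - if i = j then 1 else 0) * (star (v j) ⬝ᵥ x) := by
      have h := congrArg (star (v i) ⬝ᵥ ·) hzx
      simp only [dotProduct_sub, dotProduct_sum, dotProduct_smul, hPl, hPv, smul_eq_mul] at h
      rw [← h]
      simp [sub_mul, Finset.sum_sub_distrib, mul_comm]
    refine le_of_mul_le_mul_right ?_ hpos
    calc ‖z‖ * ‖star (v i) ⬝ᵥ x‖
        = ‖∑ j, (star (v i) ⬝ᵥ v j - if i = j then 1 else 0) * (star (v j) ⬝ᵥ x)‖ := by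
          rw [← key, norm_mul]
      _ ≤ ∑ j, ‖star (v i) ⬝ᵥ v j - if i = j then 1 else 0‖ * ‖star (v i) ⬝ᵥ x‖ := by
          refine norm_sum_le_of_le _ fun j _ => ?_
          rw [norm_mul]
          exact mul_le_mul_of_nonneg_left (hi j (Finset.mem_univ _)) (norm_nonneg _)
      _ ≤ r * ‖star (v i) ⬝ᵥ x‖ := by
          rw [← Finset.sum_mul]
          exact mul_le_mul_of_nonneg_right (hgram i) hpos.le

lemma rankOnePow_eq_vecMulVec (k : ℕ) (ψ : (Fin 4 → Fin 2) → ℂ) :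
    rankOnePow k ψ = vecMulVec (tpowVec k ψ) (star (tpowVec k ψ)) := rfl

/-- Inner products of tensor powers are powers of inner products. -/
lemma star_tpowVec_dotProduct (k : ℕ) (ψ χ : (Fin 4 → Fin 2) → ℂ) :
    star (tpowVec k ψ) ⬝ᵥ tpowVec k χ = (star ψ ⬝ᵥ χ) ^ k := by
  have h := Finset.prod_univ_sum (fun _ : Fin k => (Finset.univ : Finset (Fin 4 → Fin 2)))
    (fun _ b => star (ψ b) * χ b)
  simp only [Finset.prod_const, Finset.card_univ, Fintype.card_fin, Fintype.piFinset_univ] at h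
  simp only [dotProduct, tpowVec, Pi.star_apply, star_prod, ← Finset.prod_mul_distrib]
  exact h.symm

lemma star_psi0 : star psi0 = psi0 := by
  ext b
  simp only [psi0, Pi.star_apply]
  split_ifs <;> simp

lemma star_psi1 : star psi1 = psi1 := by
  ext b
  simp only [psi1, Pi.star_apply]
  split_ifs <;> simp

lemma sum_half_mul_half {p q : (Fin 4 → Fin 2) → Prop} [DecidablePred p] [DecidablePred q] :
    (fun b => if p b then (1 / 2 : ℂ) else 0) ⬝ᵥ (fun b => if q b then (1 / 2 : ℂ) else 0) =
      #{b | p b ∧ q b} / 4 := by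
  have h (b : Fin 4 → Fin 2) : (if p b then (1 / 2 : ℂ) else 0) * (if q b then (1 / 2 : ℂ) else 0) =
      if p b ∧ q b then 1 / 4 else 0 := by
    by_cases hp : p b <;> by_cases hq : q b <;> norm_num [hp, hq]
  simp only [dotProduct, h, ← Finset.sum_filter, Finset.sum_const, nsmul_eq_mul]
  ring

lemma psi0_dotProduct_psi0 : psi0 ⬝ᵥ psi0 = 1 := by
  refine sum_half_mul_half.trans ?_
  rw [show #{b : Fin 4 → Fin 2 | (b 0 = b 2 ∧ b 1 = b 3) ∧ (b 0 = b 2 ∧ b 1 = b 3)} = 4 by decide]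
  norm_num

lemma psi1_dotProduct_psi1 : psi1 ⬝ᵥ psi1 = 1 := by
  refine sum_half_mul_half.trans ?_
  rw [show #{b : Fin 4 → Fin 2 | (b 0 = b 3 ∧ b 1 = b 2) ∧ (b 0 = b 3 ∧ b 1 = b 2)} = 4 by decide]
  norm_num

lemma psi0_dotProduct_psi1 : psi0 ⬝ᵥ psi1 = 1 / 2 := by
  refine sum_half_mul_half.trans ?_
  rw [show #{b : Fin 4 → Fin 2 | (b 0 = b 2 ∧ b 1 = b 3) ∧ (b 0 = b 3 ∧ b 1 = b 2)} = 2 by decide]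
  norm_num

lemma psi1_dotProduct_psi0 : psi1 ⬝ᵥ psi0 = 1 / 2 := by
  rw [dotProduct_comm, psi0_dotProduct_psi1]

/-- **Approximate ground-space projectors:** the sums of tensor powers of the rank-one
projectors approximate the orthogonal projections `G^B_k` (onto
`span{ψ₀^{⊗k},ψ₁^{⊗k},ψ_φ^{⊗k}}`) and `G^L_k` (onto `span{ψ₀^{⊗k},ψ₁^{⊗k}}`) up to
`√6/2^k` and `√2/2^k` in operator norm, respectively. -/
theorem approx_ground_projectors (k : ℕ) (hk : 2 ≤ k)
    (Gb Gl : Matrix (Fin k → (Fin 4 → Fin 2)) (Fin k → (Fin 4 → Fin 2)) ℂ)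
    (hBidem : Gb * Gb = Gb) (hBherm : Gbᴴ = Gb)
    (hBrange : ∀ v, Gb.mulVec v = v ↔
      v ∈ Submodule.span ℂ {tpowVec k psi0, tpowVec k psi1, tpowVec k psiphi})
    (hLidem : Gl * Gl = Gl) (hLherm : Glᴴ = Gl)
    (hLrange : ∀ v, Gl.mulVec v = v ↔
      v ∈ Submodule.span ℂ {tpowVec k psi0, tpowVec k psi1}) :
    opNorm (rankOnePow k psi0 + rankOnePow k psi1 + rankOnePow k psiphi - Gb) ≤
        Real.sqrt 6 / 2 ^ k ∧
      opNorm (rankOnePow k psi0 + rankOnePow k psi1 - Gl) ≤ Real.sqrt 2 / 2 ^ k := by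
  have h00 : star psi0 ⬝ᵥ psi0 = 1 := by rw [star_psi0, psi0_dotProduct_psi0]
  have h01 : star psi0 ⬝ᵥ psi1 = 1 / 2 := by rw [star_psi0, psi0_dotProduct_psi1]
  have h10 : star psi1 ⬝ᵥ psi0 = 1 / 2 := by rw [star_psi1, psi1_dotProduct_psi0]
  have h11 : star psi1 ⬝ᵥ psi1 = 1 := by rw [star_psi1, psi1_dotProduct_psi1]
  have h0φ : star psi0 ⬝ᵥ psiphi = 1 / 2 := by
    rw [psiphi, dotProduct_sub, h00, h01]; norm_num
  have h1φ : star psi1 ⬝ᵥ psiphi = -(1 / 2) := by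
    rw [psiphi, dotProduct_sub, h10, h11]; norm_num
  have hφ0 : star psiphi ⬝ᵥ psi0 = 1 / 2 := by
    rw [psiphi, star_sub, sub_dotProduct, h00, h10]; norm_num
  have hφ1 : star psiphi ⬝ᵥ psi1 = -(1 / 2) := by
    rw [psiphi, star_sub, sub_dotProduct, h01, h11]; norm_num
  have hφφ : star psiphi ⬝ᵥ psiphi = 1 := by
    conv_lhs => rw [psiphi, star_sub, sub_dotProduct, ← psiphi, h0φ, h1φ]
    norm_num
  have hpow : (0 : ℝ) < 2 ^ k := by positivity
  constructor
  · have hB := opNorm_sum_vecMulVec_sub_le ![tpowVec k psi0, tpowVec k psi1, tpowVec k psiphi]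
      hBidem hBherm (r := 2 / 2 ^ k)
      (by
        have : Set.range ![tpowVec k psi0, tpowVec k psi1, tpowVec k psiphi] =
            {tpowVec k psi0, tpowVec k psi1, tpowVec k psiphi} := by
          simp only [Matrix.range_cons, Matrix.range_empty, Set.union_empty, Set.singleton_union]
        rwa [this])
      (by positivity)
      (by
        intro i
        fin_cases i <;>
          simp [Fin.sum_univ_three, star_tpowVec_dotProduct, h00, h01, h10, h11, h0φ, h1φ, hφ0,
            hφ1, hφφ] <;> ring_nf <;> exact le_rfl)
    simp only [Fin.sum_univ_three, Matrix.cons_val] at hB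
    refine hB.trans (div_le_div_of_nonneg_right ?_ hpow.le)
    exact Real.le_sqrt_of_sq_le (by norm_num)
  · have hL := opNorm_sum_vecMulVec_sub_le ![tpowVec k psi0, tpowVec k psi1]
      hLidem hLherm (r := 1 / 2 ^ k)
      (by
        have : Set.range ![tpowVec k psi0, tpowVec k psi1] =
            {tpowVec k psi0, tpowVec k psi1} := by
          simp only [Matrix.range_cons, Matrix.range_empty, Set.union_empty, Set.singleton_union]
        rwa [this])
      (by positivity)
      (by
        intro i
        fin_cases i <;>
          simp [Fin.sum_univ_two, star_tpowVec_dotProduct, h00, h01, h10, h11])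
    simp only [Fin.sum_univ_two, Matrix.cons_val] at hL
    refine hL.trans (div_le_div_of_nonneg_right ?_ hpow.le)
    exact Real.le_sqrt_of_sq_le (by norm_num)
end
end
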